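/- arXiv:2303.03489 — 2 statements merged into one kernel-verified Lean document; each statement's English description precedes it below -/
import Mathlib

section
/- Let Ω ⊂ ℝ³ be a bounded smooth domain and let K be the kernel of S in H¹_{σ,tan}(Ω). There exists a constant C = C(Ω) > 0 such that every u ∈ H¹_{σ,tan}(Ω) that is L²-orthogonal to K satisfies ‖u‖_{L²(Ω)} ≤ C ‖Su‖_{L²(Ω)}. -/
open Matrix MeasureTheory

noncomputable def grad12 (f : (Fin 3 → ℝ) → ℝ) (x : Fin 3 → ℝ) : Fin 3 → ℝ :=
  fun i => fderiv ℝ f x (Pi.single i 1)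

noncomputable def jac12 (u : (Fin 3 → ℝ) → (Fin 3 → ℝ)) (x : Fin 3 → ℝ) :
    Fin 3 → Fin 3 → ℝ :=
  fun i j => fderiv ℝ u x (Pi.single j 1) i

/-- The symmetrized gradient `Su = (Du + (Du)ᵀ)/2`. -/
noncomputable def symJac12 (u : (Fin 3 → ℝ) → (Fin 3 → ℝ)) (x : Fin 3 → ℝ) :
    Fin 3 → Fin 3 → ℝ :=
  fun i j => (jac12 u x i j + jac12 u x j i) / 2

/-- Squared Frobenius norm of a 3×3 matrix. -/
def frobSq12 (M : Fin 3 → Fin 3 → ℝ) : ℝ := ∑ i, ∑ j, (M i j) ^ 2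

/-- Membership in `H¹_{σ,tan}(Ω)`: `u` and `Du` square integrable on `Ω`,
`u` divergence free and tangent to `∂Ω` (normal direction given by `∇f`). -/
def memH1SigmaTan (Ω : Set (Fin 3 → ℝ)) (f : (Fin 3 → ℝ) → ℝ)
    (u : (Fin 3 → ℝ) → (Fin 3 → ℝ)) : Prop :=
  ContinuousOn u (closure Ω) ∧
  (∀ x ∈ Ω, DifferentiableAt ℝ u x) ∧
  (∀ x ∈ Ω, ∑ i, jac12 u x i i = 0) ∧
  (∀ x ∈ frontier Ω, u x ⬝ᵥ grad12 f x = 0) ∧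
  IntegrableOn (fun x => ∑ i, (u x i) ^ 2) Ω ∧
  IntegrableOn (fun x => frobSq12 (jac12 u x)) Ω

namespace KornPoincare

open Set Filter Topology Metric
open scoped ENNReal NNReal

local notation "ℝ³" => Fin 3 → ℝ

/-- The pointwise strain energy density `|Su|²`, valued in `[0, ∞]`. -/
noncomputable def strain (u : ℝ³ → ℝ³) (x : ℝ³) : ℝ≥0∞ :=
  ENNReal.ofReal (frobSq12 (symJac12 u x))

lemma measurable_jac12 (u : ℝ³ → ℝ³) (i j : Fin 3) : Measurable fun x => jac12 u x i j :=
  (measurable_pi_apply i).comp (measurable_fderiv_apply_const ℝ u (Pi.single j 1))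

lemma measurable_symJac12 (u : ℝ³ → ℝ³) (i j : Fin 3) : Measurable fun x => symJac12 u x i j :=
  ((measurable_jac12 u i j).add (measurable_jac12 u j i)).div_const 2

lemma measurable_frobSq12_symJac12 (u : ℝ³ → ℝ³) :
    Measurable fun x => frobSq12 (symJac12 u x) := by
  unfold frobSq12
  exact Finset.measurable_fun_sum _ fun i _ => Finset.measurable_fun_sum _ fun j _ =>
    (measurable_symJac12 u i j).pow_const 2

lemma measurable_strain (u : ℝ³ → ℝ³) : Measurable (strain u) :=
  (measurable_frobSq12_symJac12 u).ennreal_ofReal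

lemma frobSq12_nonneg (M : Fin 3 → Fin 3 → ℝ) : 0 ≤ frobSq12 M :=
  Finset.sum_nonneg fun _ _ => Finset.sum_nonneg fun _ _ => sq_nonneg _

lemma sq_quadForm_le (S : Fin 3 → Fin 3 → ℝ) (z : ℝ³) :
    (∑ i, ∑ j, S i j * (z i * z j)) ^ 2 ≤ (∑ i, z i ^ 2) ^ 2 * frobSq12 S := by
  have h := Finset.sum_mul_sq_le_sq_mul_sq (Finset.univ : Finset (Fin 3 × Fin 3))
    (fun p => S p.1 p.2) (fun p => z p.1 * z p.2)
  simp only [Fintype.sum_prod_type] at h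
  refine h.trans (le_of_eq ?_)
  have hz : ∑ i, ∑ j, (z i * z j) ^ 2 = (∑ i, z i ^ 2) ^ 2 := by
    simp only [mul_pow]
    rw [sq (∑ i, z i ^ 2), Finset.sum_mul_sum]
  rw [hz, frobSq12, mul_comm]

lemma fderiv_apply_dotProduct (u : ℝ³ → ℝ³) (x z : ℝ³) :
    fderiv ℝ u x z ⬝ᵥ z = ∑ i, ∑ j, symJac12 u x i j * (z i * z j) := by
  have hz : z = ∑ j, z j • (Pi.single j (1 : ℝ) : ℝ³) := by
    ext k; simp [Finset.sum_apply, Pi.single_apply]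
  have h : ∀ i, fderiv ℝ u x z i = ∑ j, z j * jac12 u x i j := by
    intro i
    conv_lhs => rw [hz]
    simp [map_sum, Finset.sum_apply, jac12]
  simp only [dotProduct, h, symJac12, Fin.sum_univ_three]
  ring

lemma sq_integral_le {g : ℝ → ℝ} (hg : Measurable g) :
    ENNReal.ofReal ((∫ t in Ioc (0 : ℝ) 1, g t) ^ 2) ≤
      ∫⁻ t in Ioc (0 : ℝ) 1, ENNReal.ofReal (g t ^ 2) := by
  by_cases htop : ∫⁻ t in Ioc (0 : ℝ) 1, ENNReal.ofReal (g t ^ 2) = ∞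
  · simp [htop]
  have : IsProbabilityMeasure (volume.restrict (Ioc (0 : ℝ) 1)) := ⟨by simp⟩
  have h2 : Integrable (fun t => g t ^ 2) (volume.restrict (Ioc (0 : ℝ) 1)) :=
    ⟨(hg.pow_const 2).aestronglyMeasurable,
      (hasFiniteIntegral_iff_ofReal (ae_of_all _ fun t => sq_nonneg _)).2 (lt_top_iff_ne_top.2 htop)⟩
  have h1 : Integrable g (volume.restrict (Ioc (0 : ℝ) 1)) :=
    ((memLp_two_iff_integrable_sq hg.aestronglyMeasurable).2 h2).integrable one_le_two
  rw [← ofReal_integral_eq_lintegral_ofReal h2 (ae_of_all _ fun t => sq_nonneg _)]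
  refine ENNReal.ofReal_le_ofReal ?_
  exact (even_two.convexOn_pow (𝕜 := ℝ)).map_integral_le (continuous_pow 2).continuousOn isClosed_univ
    (ae_of_all _ fun _ => mem_univ _) h1 h2

/-- Only the symmetric gradient enters the increment of `u` along a segment, in its direction. -/
lemma sq_inner_sub_le {u : ℝ³ → ℝ³} {x y : ℝ³}
    (hu : ∀ t ∈ Icc (0 : ℝ) 1, DifferentiableAt ℝ u (y + t • (x - y))) {D : ℝ} (hD : 0 < D)
    (hxy : ∑ i, (x i - y i) ^ 2 ≤ D) :
    ENNReal.ofReal (((u x - u y) ⬝ᵥ (x - y)) ^ 2) ≤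
      ENNReal.ofReal (D ^ 2) * ∫⁻ t in Ioc (0 : ℝ) 1, strain u (y + t • (x - y)) := by
  set z := x - y with hz
  set g' : ℝ → ℝ := fun t => ∑ i, ∑ j, symJac12 u (y + t • z) i j * (z i * z j) with hg'
  have hline : Measurable fun t : ℝ => y + t • z := by fun_prop
  have hmeas : Measurable g' :=
    Finset.measurable_fun_sum _ fun i _ => Finset.measurable_fun_sum _ fun j _ =>
      ((measurable_symJac12 u i j).comp hline).mul_const _
  have hbound : ∀ t, ENNReal.ofReal (g' t ^ 2) ≤
      ENNReal.ofReal (D ^ 2) * strain u (y + t • z) := by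
    intro t
    rw [strain, ← ENNReal.ofReal_mul (by positivity)]
    refine ENNReal.ofReal_le_ofReal ((sq_quadForm_le _ z).trans ?_)
    refine mul_le_mul_of_nonneg_right ?_ (frobSq12_nonneg _)
    exact pow_le_pow_left₀ (Finset.sum_nonneg fun _ _ => sq_nonneg _) hxy 2
  have hle : ∫⁻ t in Ioc (0 : ℝ) 1, ENNReal.ofReal (g' t ^ 2) ≤
      ENNReal.ofReal (D ^ 2) * ∫⁻ t in Ioc (0 : ℝ) 1, strain u (y + t • z) := by
    have hm : Measurable fun t : ℝ => strain u (y + t • z) := (measurable_strain u).comp hline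
    rw [← lintegral_const_mul _ hm]
    exact lintegral_mono fun t => hbound t
  by_cases htop : ∫⁻ t in Ioc (0 : ℝ) 1, strain u (y + t • z) = ∞
  · rw [htop, ENNReal.mul_top (by simpa using by positivity)]
    exact le_top
  have hfin : ∫⁻ t in Ioc (0 : ℝ) 1, ENNReal.ofReal (g' t ^ 2) < ∞ :=
    hle.trans_lt (ENNReal.mul_lt_top ENNReal.ofReal_lt_top (lt_top_iff_ne_top.2 htop))
  have h2 : Integrable (fun t => g' t ^ 2) (volume.restrict (Ioc (0 : ℝ) 1)) :=
    ⟨(hmeas.pow_const 2).aestronglyMeasurable,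
      (hasFiniteIntegral_iff_ofReal (ae_of_all _ fun t => sq_nonneg _)).2 hfin⟩
  have h1 : Integrable g' (volume.restrict (Ioc (0 : ℝ) 1)) :=
    ((memLp_two_iff_integrable_sq hmeas.aestronglyMeasurable).2 h2).integrable one_le_two
  have hder : ∀ t ∈ uIcc (0 : ℝ) 1, HasDerivAt (fun t => u (y + t • z) ⬝ᵥ z) (g' t) t := by
    intro t ht
    rw [uIcc_of_le zero_le_one] at ht
    have hl : HasDerivAt (fun t : ℝ => y + t • z) z t := by
      simpa using ((hasDerivAt_id t).smul_const z).const_add y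
    have hc := (hu t ht).hasFDerivAt.comp_hasDerivAt t hl
    rw [hasDerivAt_pi] at hc
    have := HasDerivAt.fun_sum (u := Finset.univ) fun i _ => (hc i).mul_const (z i)
    rw [hg']
    simp only [← fderiv_apply_dotProduct]
    exact this
  have hftc := intervalIntegral.integral_eq_sub_of_hasDerivAt hder
    ((intervalIntegrable_iff_integrableOn_Ioc_of_le zero_le_one).2 h1)
  rw [intervalIntegral.integral_of_le zero_le_one] at hftc
  have hval : (u x - u y) ⬝ᵥ z = ∫ t in Ioc (0 : ℝ) 1, g' t := by
    rw [hftc, sub_dotProduct]; simp [hz]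
  rw [hval]
  exact (sq_integral_le hmeas).trans hle

lemma lintegral_comp_smul_add (e : ℝ³ → ℝ≥0∞) (he : Measurable e) {t : ℝ} (ht : 1 / 2 ≤ t)
    (b : ℝ³) : ∫⁻ x, e (t • x + b) ≤ 8 * ∫⁻ x, e x := by
  have ht0 : 0 < t := by linarith
  have h1 : ∫⁻ x, e (t • x + b) = ∫⁻ x, e (x + b) ∂(Measure.map (t • ·) volume) :=
    (lintegral_map (he.comp (measurable_add_const b)) (measurable_const_smul t)).symm
  rw [h1, Measure.map_addHaar_smul volume ht0.ne', lintegral_smul_measure, smul_eq_mul,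
    lintegral_add_right_eq_self e b]
  gcongr
  simp only [Module.finrank_fintype_fun_eq_card, Fintype.card_fin]
  rw [abs_of_pos (by positivity)]
  refine (ENNReal.ofReal_le_ofReal (?_ : (t ^ 3)⁻¹ ≤ 8)).trans (by norm_num)
  rw [inv_le_comm₀ (by positivity) (by norm_num)]
  calc (8 : ℝ)⁻¹ = (1 / 2) ^ 3 := by norm_num
    _ ≤ t ^ 3 := by gcongr

lemma measurable_segment_integral (e : ℝ³ → ℝ≥0∞) (he : Measurable e) :
    Measurable fun p : ℝ³ × ℝ³ => ∫⁻ t in Ioc (0 : ℝ) 1, e (p.2 + t • (p.1 - p.2)) := by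
  refine Measurable.lintegral_prod_right' (f := fun q : (ℝ³ × ℝ³) × ℝ =>
    e (q.1.2 + q.2 • (q.1.1 - q.1.2))) (he.comp ?_)
  fun_prop

lemma lintegral_segment_le (e : ℝ³ → ℝ≥0∞) (he : Measurable e) (A B : Set ℝ³) :
    ∫⁻ y in B, ∫⁻ x in A, ∫⁻ t in Ioc (0 : ℝ) 1, e (y + t • (x - y)) ≤
      8 * (volume A + volume B) * ∫⁻ x, e x := by
  have hsw1 : ∀ y, ∫⁻ x in A, ∫⁻ t in Ioc (0 : ℝ) 1, e (y + t • (x - y)) =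
      ∫⁻ t in Ioc (0 : ℝ) 1, ∫⁻ x in A, e (y + t • (x - y)) := fun y =>
    lintegral_lintegral_swap (he.comp (by fun_prop)).aemeasurable
  simp only [hsw1]
  rw [lintegral_lintegral_swap]
  swap
  · refine Measurable.aemeasurable ?_
    refine Measurable.lintegral_prod_right' (f := fun q : (ℝ³ × ℝ) × ℝ³ =>
      e (q.1.1 + q.1.2 • (q.2 - q.1.1))) (he.comp (by fun_prop))
  have key : ∀ t ∈ Ioc (0 : ℝ) 1, ∫⁻ y in B, ∫⁻ x in A, e (y + t • (x - y)) ≤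
      8 * (volume A + volume B) * ∫⁻ x, e x := by
    intro t _
    rcases le_total (1 / 2) t with h | h
    · have hx : ∀ y, ∫⁻ x in A, e (y + t • (x - y)) ≤ 8 * ∫⁻ x, e x := by
        intro y
        refine (setLIntegral_le_lintegral _ _).trans ?_
        refine le_trans (le_of_eq ?_) (lintegral_comp_smul_add e he h ((1 - t) • y))
        refine lintegral_congr fun x => congrArg e ?_
        module
      calc _ ≤ ∫⁻ y in B, 8 * ∫⁻ x, e x := lintegral_mono hx
        _ = 8 * volume B * ∫⁻ x, e x := by rw [setLIntegral_const]; ring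
        _ ≤ _ := by gcongr; exact le_add_self
    · have hm' : Measurable fun q : ℝ³ × ℝ³ => e (q.1 + t • (q.2 - q.1)) := he.comp (by fun_prop)
      rw [lintegral_lintegral_swap hm'.aemeasurable]
      have hy : ∀ x, ∫⁻ y in B, e (y + t • (x - y)) ≤ 8 * ∫⁻ x, e x := by
        intro x
        refine (setLIntegral_le_lintegral _ _).trans ?_
        refine le_trans (le_of_eq ?_)
          (lintegral_comp_smul_add e he (by linarith : 1 / 2 ≤ 1 - t) (t • x))
        refine lintegral_congr fun x => congrArg e ?_
        module
      calc _ ≤ ∫⁻ x in A, 8 * ∫⁻ x, e x := lintegral_mono hy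
        _ = 8 * volume A * ∫⁻ x, e x := by rw [setLIntegral_const]; ring
        _ ≤ _ := by gcongr; exact le_self_add
  calc _ ≤ ∫⁻ t in Ioc (0 : ℝ) 1, 8 * (volume A + volume B) * ∫⁻ x, e x :=
        setLIntegral_mono' measurableSet_Ioc key
    _ = _ := by rw [setLIntegral_const]; simp

/-- The infinitesimal rigid motion `x ↦ a + b × x`, parametrized by `(a, b)`. -/
def rigidMotion (p : ℝ³ × ℝ³) (x : ℝ³) : ℝ³ := p.1 + p.2 ⨯₃ x

lemma rigidMotion_apply (p : ℝ³ × ℝ³) (x : ℝ³) :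
    rigidMotion p x = ![p.1 0 + (p.2 1 * x 2 - p.2 2 * x 1), p.1 1 + (p.2 2 * x 0 - p.2 0 * x 2),
      p.1 2 + (p.2 0 * x 1 - p.2 1 * x 0)] := by
  ext i
  fin_cases i <;> simp [rigidMotion, cross_apply]

/-- The vertices of a tetrahedron with three orthogonal edges of length `h` at the origin. -/
def tetra (h : ℝ) : Fin 4 → ℝ³ := ![![0, 0, 0], ![h, 0, 0], ![0, h, 0], ![0, 0, h]]

/-- The squared longitudinal increment of `u` between two points. -/
def longIncr (u : ℝ³ → ℝ³) (x y : ℝ³) : ℝ := ((u x - u y) ⬝ᵥ (x - y)) ^ 2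

lemma sq_le_of_linear_identity {h R s w Q Q' e₀ e₁ e₂ d₁ d₂ X₀ X₁ X₂ : ℝ} (hh : 0 < h) (hR : h ≤ R)
    (hQ : |Q| ≤ s) (hQ' : |Q'| ≤ s) (he₀ : |e₀| ≤ s) (he₁ : |e₁| ≤ s) (he₂ : |e₂| ≤ s)
    (hd₁ : |d₁| ≤ s) (hd₂ : |d₂| ≤ s) (hX₀ : |X₀| ≤ R) (hX₁ : |X₁| ≤ R) (hX₂ : |X₂| ≤ R)
    (hw : h ^ 2 * w = h * Q - h * Q' - (e₀ * (X₀ - h) + (e₀ + e₁ - d₁) / 2 * X₁ +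
      (e₀ + e₂ - d₂) / 2 * X₂)) :
    w ^ 2 ≤ (7 * R / h ^ 2) ^ 2 * s ^ 2 := by
  have hs : 0 ≤ s := (abs_nonneg _).trans hQ
  have hR0 : 0 ≤ R := hh.le.trans hR
  have hh' : |h| ≤ R := by rwa [abs_of_pos hh]
  have mul : ∀ {a b : ℝ}, |a| ≤ s → |b| ≤ R → -(R * s) ≤ a * b ∧ a * b ≤ R * s := by
    intro a b ha hb
    rw [← abs_le, abs_mul, mul_comm R]
    exact mul_le_mul ha hb (abs_nonneg _) hs
  have h1 := mul hQ hh'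
  have h2 := mul hQ' hh'
  have h3 := mul he₀ hX₀
  have h4 := mul he₀ hh'
  have h5 := mul he₀ hX₁
  have h6 := mul he₁ hX₁
  have h7 := mul hd₁ hX₁
  have h8 := mul he₀ hX₂
  have h9 := mul he₂ hX₂
  have h10 := mul hd₂ hX₂
  have habs : |h ^ 2 * w| ≤ 7 * (R * s) := by
    rw [hw, abs_le]
    constructor <;> nlinarith
  have : |w| ≤ 7 * R / h ^ 2 * s := by
    rw [abs_mul, abs_of_pos (by positivity)] at habs
    rw [div_mul_eq_mul_div, le_div_iff₀ (by positivity)]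
    linarith
  rw [← mul_pow, ← sq_abs w]
  exact pow_le_pow_left₀ (abs_nonneg _) this 2

/-- A field is close to the rigid motion interpolating it at the vertices of a tetrahedron, with an
error controlled by the longitudinal increments along the segments issued from these vertices. -/
lemma exists_rigidMotion_sq_sub_le {h R : ℝ} (hh : 0 < h) (hR : h ≤ R) (u : ℝ³ → ℝ³) (y : ℝ³) :
    ∃ p, ∀ x, (∀ i, |x i - y i| ≤ R) → ∑ i, (u x i - rigidMotion p x i) ^ 2 ≤
      3 * (7 * R / h ^ 2) ^ 2 * (∑ k, longIncr u x (y + tetra h k) +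
        ∑ k, ∑ l, longIncr u (y + tetra h k) (y + tetra h l)) := by
  set U : Fin 4 → ℝ³ := fun k => u (y + tetra h k) with hU
  set b : ℝ³ := ![((U 2 2 - U 0 2) - (U 3 1 - U 0 1)) / (2 * h),
    ((U 3 0 - U 0 0) - (U 1 2 - U 0 2)) / (2 * h),
    ((U 1 1 - U 0 1) - (U 2 0 - U 0 0)) / (2 * h)] with hb
  refine ⟨(U 0 - b ⨯₃ y, b), fun x hx => ?_⟩
  set G := ∑ k, longIncr u x (y + tetra h k) +
    ∑ k, ∑ l, longIncr u (y + tetra h k) (y + tetra h l) with hG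
  have hnn : ∀ a c, 0 ≤ longIncr u a c := fun _ _ => sq_nonneg _
  have hG0 : 0 ≤ G := add_nonneg (Finset.sum_nonneg fun _ _ => hnn _ _)
    (Finset.sum_nonneg fun _ _ => Finset.sum_nonneg fun _ _ => hnn _ _)
  have hQ : ∀ k, |(u x - U k) ⬝ᵥ (x - (y + tetra h k))| ≤ √G := by
    intro k
    refine Real.abs_le_sqrt ?_
    have h1 : longIncr u x (y + tetra h k) ≤ ∑ k, longIncr u x (y + tetra h k) :=
      Finset.single_le_sum (f := fun k => longIncr u x (y + tetra h k))
        (fun _ _ => hnn _ _) (Finset.mem_univ k)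
    refine h1.trans (le_add_of_nonneg_right ?_)
    exact Finset.sum_nonneg fun _ _ => Finset.sum_nonneg fun _ _ => hnn _ _
  have he : ∀ k l, |(U k - U l) ⬝ᵥ ((y + tetra h k) - (y + tetra h l))| ≤ √G := by
    intro k l
    refine Real.abs_le_sqrt ?_
    have h1 : longIncr u (y + tetra h k) (y + tetra h l) ≤
        ∑ l, longIncr u (y + tetra h k) (y + tetra h l) :=
      Finset.single_le_sum (f := fun l => longIncr u (y + tetra h k) (y + tetra h l))
        (fun _ _ => hnn _ _) (Finset.mem_univ l)
    have h2 : ∑ l, longIncr u (y + tetra h k) (y + tetra h l) ≤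
        ∑ k, ∑ l, longIncr u (y + tetra h k) (y + tetra h l) :=
      Finset.single_le_sum (f := fun k => ∑ l, longIncr u (y + tetra h k) (y + tetra h l))
        (fun _ _ => Finset.sum_nonneg fun _ _ => hnn _ _) (Finset.mem_univ k)
    exact (h1.trans h2).trans (le_add_of_nonneg_left (Finset.sum_nonneg fun _ _ => hnn _ _))
  have key : ∀ i, (u x i - rigidMotion (U 0 - b ⨯₃ y, b) x i) ^ 2 ≤
      (7 * R / h ^ 2) ^ 2 * √G ^ 2 := by
    intro i
    fin_cases i
    · refine sq_le_of_linear_identity hh hR (hQ 0) (hQ 1) (he 1 0) (he 2 0) (he 3 0) (he 1 2)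
        (he 1 3) (hx 0) (hx 1) (hx 2) ?_
      simp [rigidMotion_apply, cross_apply, dotProduct, Fin.sum_univ_three, tetra, hb, vecHead,
        vecTail]
      field_simp
      ring
    · refine sq_le_of_linear_identity hh hR (hQ 0) (hQ 2) (he 2 0) (he 1 0) (he 3 0) (he 2 1)
        (he 2 3) (hx 1) (hx 0) (hx 2) ?_
      simp [rigidMotion_apply, cross_apply, dotProduct, Fin.sum_univ_three, tetra, hb, vecHead,
        vecTail]
      field_simp
      ring
    · refine sq_le_of_linear_identity hh hR (hQ 0) (hQ 3) (he 3 0) (he 1 0) (he 2 0) (he 3 1)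
        (he 3 2) (hx 2) (hx 0) (hx 1) ?_
      simp [rigidMotion_apply, cross_apply, dotProduct, Fin.sum_univ_three, tetra, hb, vecHead,
        vecTail]
      field_simp
      ring
  rw [Real.sq_sqrt hG0] at key
  refine (Finset.sum_le_sum fun i _ => key i).trans (le_of_eq ?_)
  simp
  ring

/-- On `A ⊆ Ω`, every field is close in `L²(A)` to a rigid motion, with an error controlled by the
strain energy on `Ω`. -/
def RigidEstimate (Ω A : Set ℝ³) : Prop :=
  ∃ C : ℝ≥0∞, C ≠ ∞ ∧ ∀ u : ℝ³ → ℝ³, (∀ x ∈ Ω, DifferentiableAt ℝ u x) →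
    ∃ p, ∫⁻ x in A, ENNReal.ofReal (∑ i, (u x i - rigidMotion p x i) ^ 2) ≤
      C * ∫⁻ x in Ω, strain u x

lemma setLIntegral_comp_add_le {B B' : Set ℝ³} (hB : MeasurableSet B) (hB' : MeasurableSet B')
    (v : ℝ³) (hv : ∀ y ∈ B, y + v ∈ B') (g : ℝ³ → ℝ≥0∞) :
    ∫⁻ y in B, g (y + v) ≤ ∫⁻ y in B', g y := by
  calc ∫⁻ y in B, g (y + v) = ∫⁻ y in B, B'.indicator g (y + v) :=
        setLIntegral_congr_fun hB fun y hy => (indicator_of_mem (hv y hy) g).symm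
    _ ≤ ∫⁻ y, B'.indicator g (y + v) := setLIntegral_le_lintegral _ _
    _ = ∫⁻ y, B'.indicator g y := lintegral_add_right_eq_self _ v
    _ = _ := lintegral_indicator hB' g

lemma norm_tetra_le {h : ℝ} (hh : 0 ≤ h) (k : Fin 4) : ‖tetra h k‖ ≤ h := by
  rw [pi_norm_le_iff_of_nonneg hh]
  intro i
  fin_cases k <;> fin_cases i <;> simp [tetra, abs_of_nonneg hh, hh]

lemma rigidEstimate_of_segments {Ω A : Set ℝ³} (hΩ : IsOpen Ω) (hA : MeasurableSet A)
    (hAb : Bornology.IsBounded A) {y₀ : ℝ³} {ρ : ℝ} (hρ : 0 < ρ)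
    (hseg : ∀ x ∈ A ∪ ball y₀ ρ, ∀ y ∈ ball y₀ ρ, ∀ t ∈ Icc (0 : ℝ) 1, y + t • (x - y) ∈ Ω) :
    RigidEstimate Ω A := by
  set h := ρ / 2 with hh
  have hh0 : 0 < h := by positivity
  set B := ball y₀ h with hB
  set B' := ball y₀ ρ with hB'
  have hBB' : ∀ k, ∀ y ∈ B, y + tetra h k ∈ B' := by
    intro k y hy
    rw [hB, mem_ball] at hy
    rw [hB', mem_ball]
    calc dist (y + tetra h k) y₀ ≤ dist (y + tetra h k) y + dist y y₀ := dist_triangle _ _ _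
      _ < h + h := add_lt_add_of_le_of_lt (by simpa using norm_tetra_le hh0.le k) hy
      _ = ρ := by rw [hh]; ring
  have hA'b : Bornology.IsBounded (A ∪ B') := hAb.union isBounded_ball
  set R := diam (A ∪ B') + h with hR
  have hhR : h ≤ R := le_add_of_nonneg_left diam_nonneg
  have hR0 : 0 < R := hh0.trans_le hhR
  have hdist : ∀ x ∈ A ∪ B', ∀ y ∈ B', ∀ i, |x i - y i| ≤ R := fun x hx y hy i =>
    (dist_le_pi_dist x y i).trans
      ((dist_le_diam_of_mem hA'b hx (Or.inr hy)).trans (le_add_of_nonneg_right hh0.le))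
  set D := 3 * R ^ 2 with hD
  have hD0 : 0 < D := by positivity
  have hAfin : volume A ≠ ∞ := hAb.measure_lt_top.ne
  have hB'fin : volume B' ≠ ∞ := measure_ball_lt_top.ne
  have hBfin : volume B ≠ ∞ := measure_ball_lt_top.ne
  have hB0 : volume B ≠ 0 := (measure_ball_pos _ _ hh0).ne'
  set M : ℝ≥0∞ := 4 * (8 * (volume A + volume B')) + 16 with hM
  have hMfin : M ≠ ∞ := by
    simp [hM, ENNReal.add_eq_top, ENNReal.mul_eq_top, hAfin, hB'fin]
  set c : ℝ≥0∞ := ENNReal.ofReal (3 * (7 * R / h ^ 2) ^ 2) * ENNReal.ofReal (D ^ 2) with hc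
  refine ⟨c * (1 + volume A) * (M / volume B), ?_, fun u hu => ?_⟩
  · refine ENNReal.mul_ne_top (ENNReal.mul_ne_top ?_ (by simp [hAfin])) (ENNReal.div_ne_top hMfin hB0)
    exact ENNReal.mul_ne_top ENNReal.ofReal_ne_top ENNReal.ofReal_ne_top
  set e : ℝ³ → ℝ≥0∞ := Ω.indicator (strain u) with he
  have hem : Measurable e := (measurable_strain u).indicator hΩ.measurableSet
  have heE : ∫⁻ x, e x = ∫⁻ x in Ω, strain u x := lintegral_indicator hΩ.measurableSet _
  set Φ : ℝ³ → ℝ³ → ℝ≥0∞ := fun x y => ∫⁻ t in Ioc (0 : ℝ) 1, e (y + t • (x - y)) with hΦ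
  have hΦm : Measurable fun p : ℝ³ × ℝ³ => Φ p.1 p.2 := measurable_segment_integral e hem
  have hinc : ∀ x ∈ A ∪ B', ∀ y ∈ B', ENNReal.ofReal (longIncr u x y) ≤
      ENNReal.ofReal (D ^ 2) * Φ x y := by
    intro x hx y hy
    have hsum : ∑ i, (x i - y i) ^ 2 ≤ D := by
      calc ∑ i, (x i - y i) ^ 2 ≤ ∑ _i : Fin 3, R ^ 2 := Finset.sum_le_sum fun i _ => by
            rw [← sq_abs]; exact pow_le_pow_left₀ (abs_nonneg _) (hdist x hx y hy i) 2
        _ = D := by simp [hD]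
    refine (sq_inner_sub_le (fun t ht => hu _ (hseg x hx y hy t ht)) hD0 hsum).trans (le_of_eq ?_)
    congr 1
    refine setLIntegral_congr_fun measurableSet_Ioc fun t ht => ?_
    exact (indicator_of_mem (hseg x hx y hy t ⟨ht.1.le, ht.2⟩) (strain u)).symm
  set G : ℝ³ → ℝ≥0∞ := fun y => ∑ k, (∫⁻ x in A, Φ x (y + tetra h k)) +
    ∑ k, ∑ l, Φ (y + tetra h k) (y + tetra h l) with hG
  have hm1 : ∀ k, Measurable fun y => ∫⁻ x in A, Φ x (y + tetra h k) := fun k =>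
    Measurable.lintegral_prod_right' (f := fun q : ℝ³ × ℝ³ => Φ q.2 (q.1 + tetra h k))
      (hΦm.comp (by fun_prop : Measurable fun q : ℝ³ × ℝ³ => (q.2, q.1 + tetra h k)))
  have hm2 : ∀ k l, Measurable fun y => Φ (y + tetra h k) (y + tetra h l) := fun k l =>
    hΦm.comp (by fun_prop : Measurable fun y : ℝ³ => (y + tetra h k, y + tetra h l))
  have hGm : Measurable G := (Finset.measurable_fun_sum _ fun k _ => hm1 k).add
    (Finset.measurable_fun_sum _ fun k _ => Finset.measurable_fun_sum _ fun l _ => hm2 k l)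
  have hvert : ∀ k, ∫⁻ y in B, ∫⁻ x in A, Φ x (y + tetra h k) ≤
      8 * (volume A + volume B') * ∫⁻ x, e x := fun k =>
    (setLIntegral_comp_add_le measurableSet_ball measurableSet_ball (tetra h k) (hBB' k)
      (fun y => ∫⁻ x in A, Φ x y)).trans (lintegral_segment_le e hem A B')
  have hedge : ∀ k l, ∫⁻ y in B, Φ (y + tetra h k) (y + tetra h l) ≤ ∫⁻ x, e x := by
    intro k l
    have hm3 : Measurable fun q : ℝ³ × ℝ =>
        e (q.1 + tetra h l + q.2 • (q.1 + tetra h k - (q.1 + tetra h l))) := hem.comp (by fun_prop)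
    simp only [hΦ]
    rw [lintegral_lintegral_swap hm3.aemeasurable]
    calc _ ≤ ∫⁻ t in Ioc (0 : ℝ) 1, ∫⁻ x, e x := by
          refine lintegral_mono fun t => (setLIntegral_le_lintegral _ _).trans (le_of_eq ?_)
          rw [← lintegral_add_right_eq_self e (tetra h l + t • (tetra h k - tetra h l))]
          refine lintegral_congr fun y => congrArg e ?_
          module
      _ = _ := by rw [setLIntegral_const]; simp
  have hGint : ∫⁻ y in B, G y ≤ M * ∫⁻ x, e x := by
    rw [lintegral_add_left (Finset.measurable_fun_sum _ fun k _ => hm1 k),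
      lintegral_finsetSum _ fun k _ => hm1 k,
      lintegral_finsetSum _ fun k _ => Finset.measurable_fun_sum _ fun l _ => hm2 k l]
    simp only [fun k => lintegral_finsetSum (μ := volume.restrict B) (Finset.univ : Finset (Fin 4))
      (f := fun l y => Φ (y + tetra h k) (y + tetra h l)) fun l _ => hm2 k l]
    refine (add_le_add (Finset.sum_le_sum fun k _ => hvert k)
      (Finset.sum_le_sum fun k _ => Finset.sum_le_sum fun l _ => hedge k l)).trans (le_of_eq ?_)
    simp [hM]
    ring
  obtain ⟨y, hyB, hy⟩ := exists_le_setLAverage hB0 hBfin hGm.aemeasurable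
  rw [setLAverage_eq] at hy
  obtain ⟨p, hp⟩ := exists_rigidMotion_sq_sub_le hh0 hhR u y
  have hyB' : y ∈ B' := ball_subset_ball (by linarith) hyB
  refine ⟨p, ?_⟩
  have hnn : ∀ a b, 0 ≤ longIncr u a b := fun _ _ => sq_nonneg _
  have hpt : ∀ x ∈ A, ENNReal.ofReal (∑ i, (u x i - rigidMotion p x i) ^ 2) ≤
      c * (∑ k, Φ x (y + tetra h k) + ∑ k, ∑ l, Φ (y + tetra h k) (y + tetra h l)) := by
    intro x hx
    refine (ENNReal.ofReal_le_ofReal (hp x (hdist x (Or.inl hx) y hyB'))).trans ?_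
    rw [ENNReal.ofReal_mul (by positivity), ENNReal.ofReal_add
      (Finset.sum_nonneg fun _ _ => hnn _ _)
      (Finset.sum_nonneg fun _ _ => Finset.sum_nonneg fun _ _ => hnn _ _),
      ENNReal.ofReal_sum_of_nonneg fun _ _ => hnn _ _,
      ENNReal.ofReal_sum_of_nonneg fun _ _ => Finset.sum_nonneg fun _ _ => hnn _ _, hc, mul_assoc]
    simp only [fun k => ENNReal.ofReal_sum_of_nonneg (s := (Finset.univ : Finset (Fin 4)))
      (f := fun l => longIncr u (y + tetra h k) (y + tetra h l)) fun _ _ => hnn _ _]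
    gcongr
    rw [mul_add, Finset.mul_sum, Finset.mul_sum]
    simp only [Finset.mul_sum]
    refine add_le_add (Finset.sum_le_sum fun k _ => hinc x (Or.inl hx) _ (hBB' k y hyB))
      (Finset.sum_le_sum fun k _ => Finset.sum_le_sum fun l _ =>
        hinc _ (Or.inr (hBB' k y hyB)) _ (hBB' l y hyB))
  have hm4 : ∀ k, Measurable fun x => Φ x (y + tetra h k) := fun k =>
    hΦm.comp (by fun_prop : Measurable fun x : ℝ³ => (x, y + tetra h k))
  calc _ ≤ ∫⁻ x in A, c * (∑ k, Φ x (y + tetra h k) +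
          ∑ k, ∑ l, Φ (y + tetra h k) (y + tetra h l)) := setLIntegral_mono' hA hpt
    _ = c * (∑ k, (∫⁻ x in A, Φ x (y + tetra h k)) +
          volume A * ∑ k, ∑ l, Φ (y + tetra h k) (y + tetra h l)) := by
        rw [lintegral_const_mul _ ((Finset.measurable_fun_sum _ fun k _ => hm4 k).add_const _),
          lintegral_add_right _ measurable_const, lintegral_finsetSum _ fun k _ => hm4 k,
          setLIntegral_const, mul_comm (volume A)]
    _ ≤ c * ((1 + volume A) * G y) := by
        gcongr
        simp only [hG, mul_add]
        gcongr
        · exact le_mul_of_one_le_left' le_self_add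
        · exact le_add_self
    _ ≤ c * ((1 + volume A) * ((M * ∫⁻ x, e x) / volume B)) := by
        gcongr
        exact hy.trans (by gcongr)
    _ = _ := by rw [heE]; simp only [ENNReal.div_eq_inv_mul]; ring

lemma rigidMotion_sub (p q : ℝ³ × ℝ³) (x : ℝ³) :
    rigidMotion (p - q) x = rigidMotion p x - rigidMotion q x := by
  simp [rigidMotion]; abel

lemma continuous_rigidMotion_uncurry :
    Continuous fun z : (ℝ³ × ℝ³) × ℝ³ => rigidMotion z.1 z.2 := by
  simp only [rigidMotion_apply]
  refine continuous_pi fun i => ?_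
  fin_cases i <;> simp <;> fun_prop

lemma continuous_rigidMotion (p : ℝ³ × ℝ³) : Continuous (rigidMotion p) :=
  continuous_rigidMotion_uncurry.comp (by fun_prop : Continuous fun x : ℝ³ => (p, x))

lemma abs_rigidMotion_le (p : ℝ³ × ℝ³) {x : ℝ³} {R : ℝ} (hx : ‖x‖ ≤ R) (i : Fin 3) :
    |rigidMotion p x i| ≤ (1 + 2 * R) * ‖p‖ := by
  have ha : ∀ j, |p.1 j| ≤ ‖p‖ := fun j => (norm_le_pi_norm p.1 j).trans (norm_fst_le p)
  have hb : ∀ j, |p.2 j| ≤ ‖p‖ := fun j => (norm_le_pi_norm p.2 j).trans (norm_snd_le p)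
  have hX : ∀ j, |x j| ≤ R := fun j => (norm_le_pi_norm x j).trans hx
  have hm : ∀ j k, |p.2 j * x k| ≤ ‖p‖ * R := fun j k => by
    rw [abs_mul]; exact mul_le_mul (hb j) (hX k) (abs_nonneg _) (norm_nonneg _)
  have key : ∀ j k l m, |p.1 i + (p.2 j * x k - p.2 l * x m)| ≤ (1 + 2 * R) * ‖p‖ := by
    intro j k l m
    refine (abs_add_le _ _).trans ((add_le_add_right (abs_sub _ _) _).trans ?_)
    linarith [ha i, hm j k, hm l m]
  rw [rigidMotion_apply]
  fin_cases i
  · exact key _ _ _ _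
  · exact key _ _ _ _
  · exact key _ _ _ _

lemma sum_sq_rigidMotion_le (p : ℝ³ × ℝ³) {x : ℝ³} {R : ℝ} (hx : ‖x‖ ≤ R) :
    ∑ i, rigidMotion p x i ^ 2 ≤ 3 * (1 + 2 * R) ^ 2 * ‖p‖ ^ 2 := by
  calc ∑ i, rigidMotion p x i ^ 2 ≤ ∑ _i : Fin 3, ((1 + 2 * R) * ‖p‖) ^ 2 :=
        Finset.sum_le_sum fun i _ => by
          rw [← sq_abs]; exact pow_le_pow_left₀ (abs_nonneg _) (abs_rigidMotion_le p hx i) 2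
    _ = _ := by simp; ring

/-- The parameters of a rigid motion are controlled by its values at the vertices of a
tetrahedron. -/
lemma norm_sq_le_of_tetra (p : ℝ³ × ℝ³) {y : ℝ³} {h R : ℝ} (hh : 0 < h) (hy : ‖y‖ ≤ R) :
    ‖p‖ ^ 2 ≤ (1 + 4 * R / h + 2 / h) ^ 2 *
      ∑ k, ∑ i, rigidMotion p (y + tetra h k) i ^ 2 := by
  have hR : 0 ≤ R := (norm_nonneg _).trans hy
  set S := ∑ k, ∑ i, rigidMotion p (y + tetra h k) i ^ 2 with hS
  have hS0 : 0 ≤ S := Finset.sum_nonneg fun _ _ => Finset.sum_nonneg fun _ _ => sq_nonneg _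
  set s := √S with hs
  have hs0 : 0 ≤ s := Real.sqrt_nonneg _
  have hr : ∀ k i, |rigidMotion p (y + tetra h k) i| ≤ s := by
    intro k i
    refine Real.abs_le_sqrt ?_
    refine (Finset.single_le_sum (f := fun i => rigidMotion p (y + tetra h k) i ^ 2)
      (fun _ _ => sq_nonneg _) (Finset.mem_univ i)).trans ?_
    exact Finset.single_le_sum (f := fun k => ∑ i, rigidMotion p (y + tetra h k) i ^ 2)
      (fun _ _ => Finset.sum_nonneg fun _ _ => sq_nonneg _) (Finset.mem_univ k)
  have hb : ∀ j, |p.2 j| ≤ 2 / h * s := by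
    have aux : ∀ j k i, h * p.2 j =
        rigidMotion p (y + tetra h k) i - rigidMotion p (y + tetra h 0) i →
        |p.2 j| ≤ 2 / h * s := by
      intro j k i heq
      have h1 : |h * p.2 j| ≤ 2 * s := by
        rw [heq]
        exact (abs_sub _ _).trans (by linarith [hr k i, hr 0 i])
      rw [abs_mul, abs_of_pos hh] at h1
      rw [div_mul_eq_mul_div, le_div_iff₀ hh]
      linarith
    intro j
    fin_cases j
    · refine aux 0 2 2 ?_
      simp [rigidMotion_apply, tetra]
      ring
    · refine aux 1 3 0 ?_
      simp [rigidMotion_apply, tetra]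
      ring
    · refine aux 2 1 1 ?_
      simp [rigidMotion_apply, tetra]
      ring
  have hY : ∀ j, |y j| ≤ R := fun j => (norm_le_pi_norm y j).trans hy
  have hby : ∀ j k, |p.2 j * y k| ≤ 2 / h * s * R := fun j k => by
    rw [abs_mul]; exact mul_le_mul (hb j) (hY k) (abs_nonneg _) (by positivity)
  have ha : ∀ j, |p.1 j| ≤ s + 4 * R / h * s := by
    have aux : ∀ i j k l m, p.1 i =
        rigidMotion p (y + tetra h 0) i - (p.2 j * y k - p.2 l * y m) →
        |p.1 i| ≤ s + 4 * R / h * s := by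
      intro i j k l m heq
      rw [heq]
      refine (abs_sub _ _).trans ?_
      have h3 : 4 * R / h * s = 2 / h * s * R + 2 / h * s * R := by ring
      rw [h3]
      exact add_le_add (hr 0 i) ((abs_sub _ _).trans (add_le_add (hby j k) (hby l m)))
    intro i
    fin_cases i
    · refine aux 0 1 2 2 1 ?_
      simp [rigidMotion_apply, tetra, vecHead, vecTail]
    · refine aux 1 2 0 0 2 ?_
      simp [rigidMotion_apply, tetra, vecHead, vecTail]
    · refine aux 2 0 1 1 0 ?_
      simp [rigidMotion_apply, tetra, vecHead, vecTail]
  have hpos : 0 ≤ 4 * R / h * s := by positivity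
  have hpos' : 0 ≤ 2 / h * s := by positivity
  have hp : ‖p‖ ≤ (1 + 4 * R / h + 2 / h) * s := by
    rw [Prod.norm_def]
    refine max_le ((pi_norm_le_iff_of_nonneg (by positivity)).2 fun j => (ha j).trans ?_)
      ((pi_norm_le_iff_of_nonneg (by positivity)).2 fun j => (hb j).trans ?_)
    · linarith
    · linarith
  calc ‖p‖ ^ 2 ≤ ((1 + 4 * R / h + 2 / h) * s) ^ 2 := pow_le_pow_left₀ (norm_nonneg _) hp 2
    _ = _ := by rw [mul_pow, hs, Real.sq_sqrt hS0]

lemma exists_norm_sq_le_lintegral {O : Set ℝ³} (hO : IsOpen O) (hne : O.Nonempty) :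
    ∃ C : ℝ≥0∞, C ≠ ∞ ∧ ∀ p : ℝ³ × ℝ³, ENNReal.ofReal (‖p‖ ^ 2) ≤
      C * ∫⁻ x in O, ENNReal.ofReal (∑ i, rigidMotion p x i ^ 2) := by
  obtain ⟨y₀, hy₀⟩ := hne
  obtain ⟨ρ, hρ, hball⟩ := Metric.isOpen_iff.1 hO y₀ hy₀
  set h := ρ / 2 with hh
  have hh0 : 0 < h := by positivity
  set B := ball y₀ h with hB
  have hBO : ∀ k, ∀ y ∈ B, y + tetra h k ∈ O := by
    intro k y hy
    refine hball ?_
    rw [hB, mem_ball] at hy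
    rw [mem_ball]
    calc dist (y + tetra h k) y₀ ≤ dist (y + tetra h k) y + dist y y₀ := dist_triangle _ _ _
      _ < h + h := add_lt_add_of_le_of_lt (by simpa using norm_tetra_le hh0.le k) hy
      _ = ρ := by rw [hh]; ring
  have hBfin : volume B ≠ ∞ := measure_ball_lt_top.ne
  have hB0 : volume B ≠ 0 := (measure_ball_pos _ _ hh0).ne'
  set R := ‖y₀‖ + h with hR
  set c := ENNReal.ofReal ((1 + 4 * R / h + 2 / h) ^ 2) with hc
  refine ⟨c * 4 / volume B,
    ENNReal.div_ne_top (ENNReal.mul_ne_top ENNReal.ofReal_ne_top (by norm_num)) hB0, fun p => ?_⟩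
  set g : ℝ³ → ℝ≥0∞ := fun x => ENNReal.ofReal (∑ i, rigidMotion p x i ^ 2) with hg
  have hgm : Measurable g := by
    have := continuous_rigidMotion p
    exact (by fun_prop : Measurable fun x => ∑ i, rigidMotion p x i ^ 2).ennreal_ofReal
  have hpt : ∀ y ∈ B, ENNReal.ofReal (‖p‖ ^ 2) ≤ c * ∑ k, g (y + tetra h k) := by
    intro y hy
    have hyR : ‖y‖ ≤ R := by
      have h1 := norm_sub_norm_le y y₀
      rw [hB, mem_ball, dist_eq_norm] at hy
      linarith
    refine (ENNReal.ofReal_le_ofReal (norm_sq_le_of_tetra p hh0 hyR)).trans (le_of_eq ?_)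
    rw [ENNReal.ofReal_mul (by positivity),
      ENNReal.ofReal_sum_of_nonneg fun _ _ => Finset.sum_nonneg fun _ _ => sq_nonneg _]
  have hmul : ENNReal.ofReal (‖p‖ ^ 2) * volume B ≤ c * 4 * ∫⁻ x in O, g x := by
    calc ENNReal.ofReal (‖p‖ ^ 2) * volume B = ∫⁻ y in B, ENNReal.ofReal (‖p‖ ^ 2) := by
          rw [setLIntegral_const]
      _ ≤ ∫⁻ y in B, c * ∑ k, g (y + tetra h k) := setLIntegral_mono' measurableSet_ball hpt
      _ = c * ∑ k, ∫⁻ y in B, g (y + tetra h k) := by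
          have hm : ∀ k, Measurable fun y => g (y + tetra h k) := fun k =>
            hgm.comp (measurable_add_const _)
          rw [lintegral_const_mul _ (Finset.measurable_fun_sum _ fun k _ => hm k),
            lintegral_finsetSum _ fun k _ => hm k]
      _ ≤ c * ∑ _k : Fin 4, ∫⁻ x in O, g x := by
          refine mul_le_mul_right (Finset.sum_le_sum fun k _ => ?_) _
          exact setLIntegral_comp_add_le measurableSet_ball hO.measurableSet _ (hBO k) g
      _ = _ := by simp; ring
  rw [ENNReal.mul_comm_div, ← mul_div_assoc, ENNReal.le_div_iff_mul_le (Or.inl hB0) (Or.inl hBfin)]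
  exact hmul

lemma ofReal_sum_sq_sub_le (a b c : ℝ³) :
    ENNReal.ofReal (∑ i, (a i - c i) ^ 2) ≤
      2 * ENNReal.ofReal (∑ i, (a i - b i) ^ 2) + 2 * ENNReal.ofReal (∑ i, (b i - c i) ^ 2) := by
  rw [← ENNReal.ofReal_ofNat 2, ← ENNReal.ofReal_mul zero_le_two, ← ENNReal.ofReal_mul zero_le_two,
    ← ENNReal.ofReal_add (by positivity) (by positivity)]
  refine ENNReal.ofReal_le_ofReal ?_
  rw [Finset.mul_sum, Finset.mul_sum, ← Finset.sum_add_distrib]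
  exact Finset.sum_le_sum fun i _ => by nlinarith [sq_nonneg ((a i - b i) - (b i - c i))]

lemma RigidEstimate.union {Ω A A' : Set ℝ³} (hΩb : Bornology.IsBounded Ω) (hA : IsOpen A)
    (hA' : IsOpen A') (hAΩ : A ⊆ Ω) (hA'Ω : A' ⊆ Ω) (hne : (A ∩ A').Nonempty)
    (h : RigidEstimate Ω A) (h' : RigidEstimate Ω A') : RigidEstimate Ω (A ∪ A') := by
  obtain ⟨C, hC, h⟩ := h
  obtain ⟨C', hC', h'⟩ := h'
  obtain ⟨C₀, hC₀, h₀⟩ := exists_norm_sq_le_lintegral (hA.inter hA') hne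
  obtain ⟨R, hR⟩ := hΩb.exists_norm_le
  set c := ENNReal.ofReal (3 * (1 + 2 * R) ^ 2) with hc
  have hA'fin : volume A' ≠ ∞ := (hΩb.subset hA'Ω).measure_lt_top.ne
  refine ⟨C + (2 * C' + 2 * (c * (C₀ * (2 * C + 2 * C')) * volume A')), ?_, fun u hu => ?_⟩
  · simp [ENNReal.add_eq_top, ENNReal.mul_eq_top, hC, hC', hC₀, hA'fin, hc]
  obtain ⟨p, hp⟩ := h u hu
  obtain ⟨q, hq⟩ := h' u hu
  set E := ∫⁻ x in Ω, strain u x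
  have huc : ContinuousOn u Ω := fun x hx => (hu x hx).continuousAt.continuousWithinAt
  have hmeas : ∀ (r : ℝ³ × ℝ³) (O : Set ℝ³), IsOpen O → O ⊆ Ω →
      AEMeasurable (fun x => ENNReal.ofReal (∑ i, (u x i - rigidMotion r x i) ^ 2))
        (volume.restrict O) := by
    intro r O hO hOΩ
    refine AEMeasurable.ennreal_ofReal (ContinuousOn.aemeasurable ?_ hO.measurableSet)
    have h1 := huc.mono hOΩ
    have h2 := (continuous_rigidMotion r).continuousOn (s := O)
    fun_prop
  have hpq : ENNReal.ofReal (‖q - p‖ ^ 2) ≤ C₀ * ((2 * C + 2 * C') * E) := by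
    refine (h₀ (q - p)).trans (mul_le_mul_right ?_ _)
    calc _ ≤ ∫⁻ x in A ∩ A', (2 * ENNReal.ofReal (∑ i, (u x i - rigidMotion p x i) ^ 2) +
          2 * ENNReal.ofReal (∑ i, (u x i - rigidMotion q x i) ^ 2)) := by
          refine lintegral_mono fun x => ?_
          simp only [rigidMotion_sub, Pi.sub_apply]
          refine (ofReal_sum_sq_sub_le _ (u x) _).trans (le_of_eq ?_)
          rw [add_comm]
          congr 5 with i
          ring
      _ = 2 * (∫⁻ x in A ∩ A', ENNReal.ofReal (∑ i, (u x i - rigidMotion p x i) ^ 2)) +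
          2 * (∫⁻ x in A ∩ A', ENNReal.ofReal (∑ i, (u x i - rigidMotion q x i) ^ 2)) := by
          have hsub : A ∩ A' ⊆ Ω := inter_subset_left.trans hAΩ
          rw [lintegral_add_left' ((hmeas p _ (hA.inter hA') hsub).const_mul 2),
            lintegral_const_mul'' _ (hmeas p _ (hA.inter hA') hsub),
            lintegral_const_mul'' _ (hmeas q _ (hA.inter hA') hsub)]
      _ ≤ 2 * (C * E) + 2 * (C' * E) := by
          gcongr
          · exact (lintegral_mono_set inter_subset_left).trans hp
          · exact (lintegral_mono_set inter_subset_right).trans hq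
      _ = _ := by ring
  refine ⟨p, (lintegral_union_le _ _ _).trans ?_⟩
  calc _ ≤ C * E + ∫⁻ x in A', (2 * ENNReal.ofReal (∑ i, (u x i - rigidMotion q x i) ^ 2) +
        2 * (c * ENNReal.ofReal (‖q - p‖ ^ 2))) := by
        refine add_le_add hp (setLIntegral_mono' hA'.measurableSet fun x hx => ?_)
        refine (ofReal_sum_sq_sub_le _ (rigidMotion q x) _).trans ?_
        gcongr
        rw [hc, ← ENNReal.ofReal_mul (by positivity)]
        refine ENNReal.ofReal_le_ofReal (le_trans (le_of_eq ?_)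
          (sum_sq_rigidMotion_le (q - p) (hR x (hA'Ω hx))))
        simp only [rigidMotion_sub, Pi.sub_apply]
    _ = C * E + (2 * (∫⁻ x in A', ENNReal.ofReal (∑ i, (u x i - rigidMotion q x i) ^ 2)) +
        2 * (c * ENNReal.ofReal (‖q - p‖ ^ 2)) * volume A') := by
        rw [lintegral_add_right _ measurable_const, lintegral_const_mul'' _ (hmeas q _ hA' hA'Ω),
          setLIntegral_const]
    _ ≤ C * E + (2 * (C' * E) + 2 * (c * (C₀ * ((2 * C + 2 * C') * E))) * volume A') := by
        gcongr
    _ = _ := by ring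

lemma RigidEstimate.mono {Ω A A' : Set ℝ³} (hAA' : A ⊆ A') (h : RigidEstimate Ω A') :
    RigidEstimate Ω A := by
  obtain ⟨C, hC, h⟩ := h
  refine ⟨C, hC, fun u hu => ?_⟩
  obtain ⟨p, hp⟩ := h u hu
  exact ⟨p, (lintegral_mono_set hAA').trans hp⟩

/-- On the sublevel set of a function with nonzero differential at `x₀`, all points near `x₀` see a
fixed small ball. -/
lemma exists_segment_subset {f : ℝ³ → ℝ} (hf : ContDiff ℝ 1 f) {x₀ : ℝ³} (hx₀ : fderiv ℝ f x₀ ≠ 0) :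
    ∃ ρ > 0, ∃ y₀, ∀ x ∈ ball x₀ ρ, f x < 0 → ∀ y ∈ ball y₀ ρ, ∀ t ∈ Icc (0 : ℝ) 1,
      f (y + t • (x - y)) < 0 := by
  obtain ⟨v₀, hv₀⟩ : ∃ v, fderiv ℝ f x₀ v ≠ 0 := by
    by_contra! h
    exact hx₀ (ContinuousLinearMap.ext h)
  obtain ⟨v, hv⟩ : ∃ v, fderiv ℝ f x₀ v < 0 := by
    rcases lt_or_gt_of_ne hv₀ with h | h
    · exact ⟨v₀, h⟩
    · exact ⟨-v₀, by simpa using h⟩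
  have hcont : Continuous fun z : ℝ³ × ℝ³ => fderiv ℝ f z.1 z.2 :=
    hf.continuous_fderiv_apply (by norm_num)
  obtain ⟨δ, hδ, hball⟩ := Metric.isOpen_iff.1 (isOpen_Iio.preimage hcont) (x₀, v) hv
  obtain ⟨s, hs, hsv⟩ : ∃ s > 0, s * ‖v‖ < δ / 2 := by
    refine ⟨δ / (4 * (1 + ‖v‖)), by positivity, ?_⟩
    rw [div_mul_eq_mul_div, div_lt_div_iff₀ (by positivity) two_pos]
    nlinarith [norm_nonneg v]
  set ρ := min (δ / 2) (s * δ / 2) with hρ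
  have hρ1 : ρ ≤ δ / 2 := min_le_left _ _
  have hρ2 : ρ ≤ s * δ / 2 := min_le_right _ _
  refine ⟨ρ, by positivity, x₀ + s • v, fun x hx hfx y hy t ht => ?_⟩
  rw [mem_ball_iff_norm] at hx hy
  have hx' : x ∈ ball x₀ δ := by rw [mem_ball_iff_norm]; linarith
  have hy' : y ∈ ball x₀ δ := by
    rw [mem_ball_iff_norm]
    calc ‖y - x₀‖ = ‖(y - (x₀ + s • v)) + s • v‖ := by congr 1; abel
      _ ≤ ‖y - (x₀ + s • v)‖ + s * ‖v‖ := by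
        refine (norm_add_le _ _).trans ?_
        rw [norm_smul, Real.norm_of_nonneg hs.le]
      _ < δ := by linarith
  set w := s⁻¹ • (y - x) with hw
  have hwv : ‖w - v‖ < δ := by
    have : w - v = s⁻¹ • ((y - (x₀ + s • v)) - (x - x₀)) := by
      have : v = s⁻¹ • (s • v) := by rw [inv_smul_smul₀ hs.ne']
      conv_lhs => rw [hw, this, ← smul_sub]
      congr 1
      abel
    rw [this, norm_smul, norm_inv, Real.norm_of_nonneg hs.le, inv_mul_lt_iff₀ hs]
    refine (norm_sub_le _ _).trans_lt ?_
    linarith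
  have hwx : x - y = -(s • w) := by rw [hw, smul_inv_smul₀ hs.ne']; abel
  have hder : ∀ τ : ℝ, HasDerivAt (fun τ : ℝ => f (y + τ • (x - y)))
      (fderiv ℝ f (y + τ • (x - y)) (x - y)) τ := fun τ => by
    have h1 : HasDerivAt (fun τ : ℝ => y + τ • (x - y)) (x - y) τ := by
      simpa using ((hasDerivAt_id τ).smul_const (x - y)).const_add y
    exact ((hf.differentiable one_ne_zero).differentiableAt.hasFDerivAt).comp_hasDerivAt τ h1
  have hmono : MonotoneOn (fun τ : ℝ => f (y + τ • (x - y))) (Icc 0 1) := by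
    refine monotoneOn_of_deriv_nonneg (convex_Icc 0 1)
      (fun τ _ => (hder τ).continuousAt.continuousWithinAt)
      (fun τ _ => (hder τ).differentiableAt.differentiableWithinAt) fun τ hτ => ?_
    rw [interior_Icc] at hτ
    rw [(hder τ).deriv, hwx, map_neg, map_smul, smul_eq_mul, ← hwx]
    have hmem : y + τ • (x - y) ∈ ball x₀ δ :=
      (convex_ball x₀ δ).add_smul_sub_mem hy' hx' ⟨hτ.1.le, hτ.2.le⟩
    have : fderiv ℝ f (y + τ • (x - y)) w < 0 := by
      have hz : (y + τ • (x - y), w) ∈ ball (x₀, v) δ := by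
        rw [← ball_prod_same]
        exact ⟨hmem, by rwa [mem_ball_iff_norm]⟩
      exact hball hz
    nlinarith
  have := hmono ht (right_mem_Icc.2 zero_le_one) ht.2
  simp only [one_smul, add_sub_cancel] at this
  exact this.trans_lt hfx

lemma exists_local_rigidEstimate {f : ℝ³ → ℝ} (hf : ContDiff ℝ 1 f) {Ω : Set ℝ³}
    (hΩ : Ω = f ⁻¹' Iio 0) (hgrad : ∀ x ∈ frontier Ω, fderiv ℝ f x ≠ 0) {x₀ : ℝ³}
    (hx₀ : x₀ ∈ closure Ω) : ∃ ρ > 0, RigidEstimate Ω (ball x₀ ρ ∩ Ω) := by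
  have hO : IsOpen Ω := hΩ ▸ isOpen_Iio.preimage hf.continuous
  by_cases hx : x₀ ∈ Ω
  · obtain ⟨ρ, hρ, hb⟩ := Metric.isOpen_iff.1 hO x₀ hx
    refine ⟨ρ, hρ, rigidEstimate_of_segments (y₀ := x₀) hO (measurableSet_ball.inter hO.measurableSet)
      (isBounded_ball.subset inter_subset_left) hρ fun x hx y hy t ht => hb ?_⟩
    have hx' : x ∈ ball x₀ ρ := hx.elim (fun h => h.1) id
    exact (convex_ball x₀ ρ).add_smul_sub_mem hy hx' ht
  · have hfr : x₀ ∈ frontier Ω := ⟨hx₀, by rwa [hO.interior_eq]⟩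
    obtain ⟨ρ, hρ, y₀, hseg⟩ := exists_segment_subset hf (hgrad x₀ hfr)
    refine ⟨ρ, hρ, rigidEstimate_of_segments (y₀ := y₀) hO (measurableSet_ball.inter hO.measurableSet)
      (isBounded_ball.subset inter_subset_left) hρ ?_⟩
    obtain ⟨z, hzb, hz⟩ : ∃ z ∈ ball x₀ ρ, z ∈ Ω := by
      obtain ⟨z, hz, hd⟩ := Metric.mem_closure_iff.1 hx₀ ρ hρ
      exact ⟨z, by rwa [mem_ball'], hz⟩
    have hball : ball y₀ ρ ⊆ Ω := fun y hy => by
      have := hseg z hzb (by simpa [hΩ] using hz) y hy 0 (left_mem_Icc.2 zero_le_one)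
      simpa [hΩ] using this
    rintro x (hx | hx) y hy t ht
    · rw [hΩ]
      exact hseg x hx.1 (by simpa [hΩ] using hx.2) y hy t ht
    · exact hball ((convex_ball y₀ ρ).add_smul_sub_mem hy hx ht)

/-- Chaining the local estimates along the connected set `Ω`. -/
lemma rigidEstimate_self {Ω : Set ℝ³} (hO : IsOpen Ω) (hb : Bornology.IsBounded Ω)
    (hc : IsConnected Ω)
    (hloc : ∀ x ∈ closure Ω, ∃ ρ > 0, RigidEstimate Ω (ball x ρ ∩ Ω)) : RigidEstimate Ω Ω := by
  obtain ⟨x₀, hx₀⟩ := hc.nonempty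
  set T : Set ℝ³ := {x | ∃ A, IsOpen A ∧ A ⊆ Ω ∧ x₀ ∈ A ∧ x ∈ A ∧ RigidEstimate Ω A} with hT
  have hTO : IsOpen T := by
    rw [isOpen_iff_mem_nhds]
    rintro x ⟨A, hA, hAΩ, h0, hx, hr⟩
    filter_upwards [hA.mem_nhds hx] with y hy
    exact ⟨A, hA, hAΩ, h0, hy, hr⟩
  -- a point of `Ω` in the local patch around `x` that lies in `T` lets us attach the patch
  have hattach : ∀ x ∈ closure Ω, ∀ ρ > 0, RigidEstimate Ω (ball x ρ ∩ Ω) →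
      (ball x ρ ∩ Ω ∩ T).Nonempty →
      ∃ A, IsOpen A ∧ A ⊆ Ω ∧ x₀ ∈ A ∧ ball x ρ ∩ Ω ⊆ A ∧ RigidEstimate Ω A := by
    rintro x hx ρ hρ hr ⟨z, hz, A, hA, hAΩ, h0, hzA, hAr⟩
    exact ⟨A ∪ (ball x ρ ∩ Ω), hA.union (isOpen_ball.inter hO),
      union_subset hAΩ inter_subset_right, Or.inl h0, subset_union_right,
      hAr.union hb hA (isOpen_ball.inter hO) hAΩ inter_subset_right ⟨z, hzA, hz⟩ hr⟩
  have hΩT : Ω ⊆ T := by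
    refine hc.isPreconnected.subset_of_closure_inter_subset hTO ⟨x₀, hx₀, ?_⟩ ?_
    · obtain ⟨ρ, hρ, hr⟩ := hloc x₀ (subset_closure hx₀)
      exact ⟨_, isOpen_ball.inter hO, inter_subset_right, ⟨mem_ball_self hρ, hx₀⟩,
        ⟨mem_ball_self hρ, hx₀⟩, hr⟩
    · rintro x ⟨hxT, hxΩ⟩
      obtain ⟨ρ, hρ, hr⟩ := hloc x (subset_closure hxΩ)
      have hn : (ball x ρ ∩ Ω ∩ T).Nonempty :=
        mem_closure_iff.1 hxT _ (isOpen_ball.inter hO) ⟨mem_ball_self hρ, hxΩ⟩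
      obtain ⟨A, hA, hAΩ, h0, hsub, hAr⟩ := hattach x (subset_closure hxΩ) ρ hρ hr hn
      exact ⟨A, hA, hAΩ, h0, hsub ⟨mem_ball_self hρ, hxΩ⟩, hAr⟩
  have hcomp : IsCompact (closure Ω) := hb.isCompact_closure
  obtain ⟨A, -, hAΩ, -, hsub, hAr⟩ := hcomp.induction_on
    (p := fun s => ∃ A, IsOpen A ∧ A ⊆ Ω ∧ x₀ ∈ A ∧ s ∩ Ω ⊆ A ∧ RigidEstimate Ω A)
    (by
      obtain ⟨A, hA, hAΩ, h0, -, hAr⟩ := hΩT hx₀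
      exact ⟨A, hA, hAΩ, h0, by simp, hAr⟩)
    (by
      rintro s t hst ⟨A, hA, hAΩ, h0, hs, hAr⟩
      exact ⟨A, hA, hAΩ, h0, (inter_subset_inter_left _ hst).trans hs, hAr⟩)
    (by
      rintro s t ⟨A, hA, hAΩ, h0, hs, hAr⟩ ⟨A', hA', hA'Ω, h0', hs', hA'r⟩
      refine ⟨A ∪ A', hA.union hA', union_subset hAΩ hA'Ω, Or.inl h0, ?_,
        hAr.union hb hA hA' hAΩ hA'Ω ⟨x₀, h0, h0'⟩ hA'r⟩
      rw [union_inter_distrib_right]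
      exact union_subset_union hs hs')
    (by
      intro x hx
      obtain ⟨ρ, hρ, hr⟩ := hloc x hx
      obtain ⟨z, hz, hd⟩ := Metric.mem_closure_iff.1 hx ρ hρ
      exact ⟨ball x ρ, mem_nhdsWithin_of_mem_nhds (ball_mem_nhds x hρ),
        hattach x hx ρ hρ hr ⟨z, ⟨by rwa [mem_ball'], hz⟩, hΩT hz⟩⟩)
  exact hAr.mono fun x hx => hsub ⟨subset_closure hx, hx⟩

/-- The divergence theorem for compactly supported differentiable vector fields. -/
lemma integral_div_eq_zero {F : ℝ³ → ℝ³} {K : Set ℝ³} (hK : Bornology.IsBounded K)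
    (hF : Differentiable ℝ F) (hFK : ∀ x ∉ K, F x = 0)
    (hi : Integrable fun x => ∑ i, jac12 F x i i) : ∫ x, ∑ i, jac12 F x i i = 0 := by
  obtain ⟨R, hR0, hR⟩ := hK.exists_pos_norm_lt
  have hF0 : ∀ x : ℝ³, R ≤ ‖x‖ → F x = 0 := fun x hx => hFK x fun h => (hR x h).not_ge hx
  set a : ℝ³ := fun _ => -R with ha
  set b : ℝ³ := fun _ => R with hb
  have hle : a ≤ b := fun _ => by simp only [ha, hb]; linarith
  have hout : ∀ x, x ∉ Icc a b → ∑ i, jac12 F x i i = 0 := by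
    intro x hx
    have hxR : R < ‖x‖ := by
      by_contra! h
      refine hx ⟨fun i => ?_, fun i => ?_⟩
      · exact (abs_le.1 ((norm_le_pi_norm x i).trans h)).1
      · exact (abs_le.1 ((norm_le_pi_norm x i).trans h)).2
    have hev : F =ᶠ[𝓝 x] fun _ => 0 := by
      filter_upwards [(isOpen_lt continuous_const continuous_norm).mem_nhds hxR] with y hy
      exact hF0 y (le_of_lt hy)
    have : fderiv ℝ F x = 0 := by rw [hev.fderiv_eq]; simp
    simp [jac12, this]
  have hface : ∀ (i : Fin 3) (c : ℝ) (x : Fin 2 → ℝ), |c| = R → F (i.insertNth c x) = 0 := by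
    intro i c x hc
    refine hF0 _ ?_
    rw [← hc]
    have := norm_le_pi_norm (i.insertNth c x : ℝ³) i
    rwa [Fin.insertNth_apply_same] at this
  rw [← setIntegral_eq_integral_of_forall_compl_eq_zero hout]
  refine (integral_divergence_of_hasFDerivAt_off_countable a b hle F (fderiv ℝ F) ∅ countable_empty
    hF.continuous.continuousOn (fun x _ => (hF x).hasFDerivAt) hi.integrableOn).trans ?_
  refine Finset.sum_eq_zero fun i _ => ?_
  have h1 : ∀ x : Fin 2 → ℝ, F (i.insertNth (b i) x) = 0 := fun x =>
    hface i _ x (by simp [hb, abs_of_pos hR0])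
  have h2 : ∀ x : Fin 2 → ℝ, F (i.insertNth (a i) x) = 0 := fun x =>
    hface i _ x (by simp [ha, abs_of_pos hR0])
  simp [h1, h2]

lemma integrableOn_of_eq_zero_near {f : ℝ³ → ℝ} (hf : Continuous f) {Ω : Set ℝ³}
    (hΩ : Ω = f ⁻¹' Iio 0) (hb : Bornology.IsBounded Ω) {ε : ℝ} (hε : 0 < ε) {g : ℝ³ → ℝ}
    (hg : ContinuousOn g Ω) (hg0 : ∀ x, -ε < f x → g x = 0) : IntegrableOn g Ω := by
  have hKΩ : f ⁻¹' Iic (-ε) ⊆ Ω := fun x hx => by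
    rw [hΩ]
    have : f x ≤ -ε := hx
    exact this.trans_lt (by linarith)
  have hK : IsCompact (f ⁻¹' Iic (-ε)) :=
    Metric.isCompact_of_isClosed_isBounded (isClosed_Iic.preimage hf) (hb.subset hKΩ)
  refine ((hg.mono hKΩ).integrableOn_compact hK).of_forall_sdiff_eq_zero
    (hΩ ▸ (isOpen_Iio.preimage hf).measurableSet) fun x hx => hg0 x ?_
  simpa using hx.2

lemma sum_jac12_smul {c : ℝ³ → ℝ} {w : ℝ³ → ℝ³} {x : ℝ³} (hc : DifferentiableAt ℝ c x)
    (hw : DifferentiableAt ℝ w x) :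
    ∑ i, jac12 (fun y => c y • w y) x i i = w x ⬝ᵥ grad12 c x + c x * ∑ i, jac12 w x i i := by
  simp only [jac12, fderiv_fun_smul hc hw, dotProduct, grad12, Finset.mul_sum,
    ← Finset.sum_add_distrib]
  refine Finset.sum_congr rfl fun i _ => ?_
  simp
  ring

lemma grad12_comp {f : ℝ³ → ℝ} {χ : ℝ → ℝ} {x : ℝ³} (hf : DifferentiableAt ℝ f x)
    (hχ : DifferentiableAt ℝ χ (f x)) :
    grad12 (fun y => χ (f y)) x = deriv χ (f x) • grad12 f x := by
  funext i
  have : HasFDerivAt (fun y => χ (f y)) (deriv χ (f x) • fderiv ℝ f x) x :=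
    hχ.hasDerivAt.comp_hasFDerivAt x hf.hasFDerivAt
  simp [grad12, this.fderiv]

lemma continuous_grad12 {f : ℝ³ → ℝ} (hf : ContDiff ℝ 1 f) : Continuous (grad12 f) :=
  continuous_pi fun _ => (hf.continuous_fderiv (by norm_num)).clm_apply continuous_const

lemma continuousOn_dotProduct {s : Set ℝ³} {v w : ℝ³ → ℝ³} (hv : ContinuousOn v s)
    (hw : ContinuousOn w s) : ContinuousOn (fun x => v x ⬝ᵥ w x) s := by
  simp only [dotProduct]
  exact continuousOn_finsetSum _ fun i _ =>
    (continuousOn_pi.1 hv i).mul (continuousOn_pi.1 hw i)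

/-- Divergence theorem for a vector field on `{f < 0}`, cut off by a function of `f`. -/
lemma integral_cutoff {f : ℝ³ → ℝ} (hf : ContDiff ℝ 1 f) {Ω : Set ℝ³}
    (hΩ : Ω = f ⁻¹' Iio 0) (hb : Bornology.IsBounded Ω) {w : ℝ³ → ℝ³} {D : ℝ³ → ℝ}
    (hw : ∀ x ∈ Ω, DifferentiableAt ℝ w x) (hD : ContinuousOn D Ω)
    (hwD : ∀ x ∈ Ω, ∑ i, jac12 w x i i = D x) {χ : ℝ → ℝ} (hχ : ContDiff ℝ 1 χ) {ε : ℝ}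
    (hε : 0 < ε) (hχ0 : ∀ t, -ε < t → χ t = 0) :
    IntegrableOn (fun x => deriv χ (f x) * (w x ⬝ᵥ grad12 f x)) Ω ∧
    IntegrableOn (fun x => χ (f x) * D x) Ω ∧
    ∫ x in Ω, deriv χ (f x) * (w x ⬝ᵥ grad12 f x) = -∫ x in Ω, χ (f x) * D x := by
  have hO : IsOpen Ω := hΩ ▸ isOpen_Iio.preimage hf.continuous
  have hev : ∀ t, -ε < t → χ =ᶠ[𝓝 t] fun _ => 0 := fun t ht => by
    filter_upwards [lt_mem_nhds ht] with s hs
    exact hχ0 s hs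
  have hχ'0 : ∀ t, -ε < t → deriv χ t = 0 := fun t ht => by
    rw [(hev t ht).deriv_eq]; simp
  have hwc : ContinuousOn w Ω := fun x hx => (hw x hx).continuousAt.continuousWithinAt
  have hχ' : Continuous (deriv χ) := hχ.continuous_deriv le_rfl
  have h1 : IntegrableOn (fun x => deriv χ (f x) * (w x ⬝ᵥ grad12 f x)) Ω :=
    integrableOn_of_eq_zero_near hf.continuous hΩ hb hε
      ((hχ'.comp hf.continuous).continuousOn.mul
        (continuousOn_dotProduct hwc (continuous_grad12 hf).continuousOn))
      fun x hx => by rw [hχ'0 _ hx, zero_mul]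
  have h2 : IntegrableOn (fun x => χ (f x) * D x) Ω :=
    integrableOn_of_eq_zero_near hf.continuous hΩ hb hε
      ((hχ.continuous.comp hf.continuous).continuousOn.mul hD)
      fun x hx => by rw [hχ0 _ hx, zero_mul]
  refine ⟨h1, h2, ?_⟩
  have hcd : ∀ x, DifferentiableAt ℝ (fun y => χ (f y)) x := fun x =>
    ((hχ.comp hf).differentiable one_ne_zero).differentiableAt
  have hevx : ∀ x ∉ Ω, (fun y => χ (f y) • w y) =ᶠ[𝓝 x] fun _ => 0 := fun x hx => by
    have : -ε < f x := by
      rw [hΩ] at hx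
      have : 0 ≤ f x := by simpa using hx
      linarith
    filter_upwards [hf.continuous.continuousAt.eventually (lt_mem_nhds this)] with y hy
    rw [hχ0 _ hy, zero_smul]
  have hdiv : ∀ x ∈ Ω, ∑ i, jac12 (fun y => χ (f y) • w y) x i i =
      deriv χ (f x) * (w x ⬝ᵥ grad12 f x) + χ (f x) * D x := fun x hx => by
    rw [sum_jac12_smul (hcd x) (hw x hx), hwD x hx,
      grad12_comp (hf.differentiable one_ne_zero x) (hχ.differentiable one_ne_zero _),
      dotProduct_smul, smul_eq_mul]
  have hdiv0 : ∀ x ∉ Ω, ∑ i, jac12 (fun y => χ (f y) • w y) x i i = 0 := fun x hx => by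
    simp [jac12, (hevx x hx).fderiv_eq]
  have hiO : IntegrableOn (fun x => ∑ i, jac12 (fun y => χ (f y) • w y) x i i) Ω :=
    (h1.add h2).congr_fun (fun x hx => (hdiv x hx).symm) hO.measurableSet
  have hz := integral_div_eq_zero (F := fun y => χ (f y) • w y) hb
    (fun x => by
      by_cases hx : x ∈ Ω
      · exact (hcd x).smul (hw x hx)
      · exact (hevx x hx).differentiableAt_iff.2 (differentiableAt_const _))
    (fun x hx => (hevx x hx).eq_of_nhds)
    ((integrableOn_iff_integrable_of_support_subset fun x hx => by
      by_contra h
      exact hx (hdiv0 x h)).1 hiO)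
  rw [← setIntegral_eq_integral_of_forall_compl_eq_zero hdiv0,
    setIntegral_congr_fun hO.measurableSet hdiv, integral_add h1 h2] at hz
  linarith

lemma exists_abs_dotProduct_le {f : ℝ³ → ℝ} (hf : ContDiff ℝ 1 f) {Ω : Set ℝ³}
    (hΩ : Ω = f ⁻¹' Iio 0) (hb : Bornology.IsBounded Ω)
    (hgrad : ∀ x ∈ frontier Ω, grad12 f x ≠ 0) {u : ℝ³ → ℝ³} (hu : ContinuousOn u (closure Ω))
    (htan : ∀ x ∈ frontier Ω, u x ⬝ᵥ grad12 f x = 0) {η : ℝ} (hη : 0 < η) :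
    ∃ ε > 0, ∀ x ∈ Ω, -ε < f x → |u x ⬝ᵥ grad12 f x| ≤ η * (grad12 f x ⬝ᵥ grad12 f x) := by
  have hO : IsOpen Ω := hΩ ▸ isOpen_Iio.preimage hf.continuous
  set G : ℝ³ → ℝ := fun x => |u x ⬝ᵥ grad12 f x| - η * (grad12 f x ⬝ᵥ grad12 f x) with hG
  have hgc := (continuous_grad12 hf).continuousOn (s := closure Ω)
  have hGc : ContinuousOn G (closure Ω) := (continuousOn_dotProduct hu hgc).abs.sub
    (continuousOn_const.mul (continuousOn_dotProduct hgc hgc))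
  have hK : IsCompact (closure Ω ∩ G ⁻¹' Ici 0) :=
    (hb.isCompact_closure).of_isClosed_subset
      (hGc.preimage_isClosed_of_isClosed isClosed_closure isClosed_Ici) inter_subset_left
  have hneg : ∀ x ∈ closure Ω ∩ G ⁻¹' Ici 0, f x < 0 := by
    rintro x ⟨hx, hGx⟩
    by_contra hfx
    have hfr : x ∈ frontier Ω := ⟨hx, by rw [hO.interior_eq, hΩ]; exact hfx⟩
    have h0 : 0 ≤ G x := hGx
    have hpos : 0 < grad12 f x ⬝ᵥ grad12 f x :=
      lt_of_le_of_ne (Finset.sum_nonneg fun i _ => mul_self_nonneg _)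
        fun h => hgrad x hfr (dotProduct_self_eq_zero.1 h.symm)
    rw [hG] at h0
    simp only [htan x hfr, abs_zero] at h0
    nlinarith
  rcases (closure Ω ∩ G ⁻¹' Ici 0).eq_empty_or_nonempty with he | hne
  · refine ⟨1, one_pos, fun x hx _ => ?_⟩
    by_contra! h
    have : x ∈ closure Ω ∩ G ⁻¹' Ici 0 := ⟨subset_closure hx, by
      show 0 ≤ G x
      simp only [hG]; linarith⟩
    simp [he] at this
  · obtain ⟨z, hz, hmax⟩ := hK.exists_isMaxOn hne hf.continuous.continuousOn
    refine ⟨-f z, by linarith [hneg z hz], fun x hx hfx => ?_⟩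
    by_contra! h
    have : x ∈ closure Ω ∩ G ⁻¹' Ici 0 := ⟨subset_closure hx, by
      show 0 ≤ G x
      simp only [hG]; linarith⟩
    have : f x ≤ f z := hmax this
    linarith

lemma integrableOn_of_continuousOn_closure {Ω : Set ℝ³} (hb : Bornology.IsBounded Ω) {g : ℝ³ → ℝ}
    (hg : ContinuousOn g (closure Ω)) : IntegrableOn g Ω :=
  (hg.integrableOn_compact hb.isCompact_closure).mono_set subset_closure

/-- The cutoff `1` on `(-∞, -2 / N]` and `0` on `[-1 / N, ∞)`. -/
noncomputable def cutoff (N t : ℝ) : ℝ := Real.smoothTransition (-N * t - 1)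

lemma contDiff_cutoff (N : ℝ) : ContDiff ℝ 1 (cutoff N) :=
  Real.smoothTransition.contDiff.comp (by fun_prop)

lemma cutoff_mem_Icc (N t : ℝ) : cutoff N t ∈ Icc (0 : ℝ) 1 :=
  ⟨Real.smoothTransition.nonneg _, Real.smoothTransition.le_one _⟩

lemma cutoff_eq_zero {N t : ℝ} (hN : 0 < N) (ht : -(1 / N) < t) : cutoff N t = 0 := by
  refine Real.smoothTransition.zero_of_nonpos ?_
  rw [← neg_div, div_lt_iff₀ hN] at ht
  linarith

lemma cutoff_eq_one {N t : ℝ} (hN : 0 < N) (ht : t ≤ -(2 / N)) : cutoff N t = 1 := by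
  refine Real.smoothTransition.one_of_one_le ?_
  rw [← neg_div, le_div_iff₀ hN] at ht
  linarith

lemma deriv_cutoff_nonpos {N : ℝ} (hN : 0 < N) (t : ℝ) : deriv (cutoff N) t ≤ 0 := by
  have : Antitone (cutoff N) := fun s t hst => Real.smoothTransition.monotone (by nlinarith)
  exact this.deriv_nonpos

lemma deriv_cutoff_eq_zero {N t : ℝ} (hN : 0 < N) (ht : t < -(2 / N)) :
    deriv (cutoff N) t = 0 := by
  have : cutoff N =ᶠ[𝓝 t] fun _ => 1 := by
    filter_upwards [gt_mem_nhds ht] with s hs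
    exact cutoff_eq_one hN (le_of_lt hs)
  rw [this.deriv_eq]; simp

lemma tendsto_cutoff {t : ℝ} (ht : t < 0) :
    Tendsto (fun n : ℕ => cutoff (n + 1) t) atTop (𝓝 1) := by
  refine tendsto_const_nhds.congr' ?_
  obtain ⟨m, hm⟩ := exists_nat_gt (2 / (-t))
  filter_upwards [eventually_ge_atTop m] with n hn
  refine (cutoff_eq_one (by positivity) ?_).symm
  have hn' : (m : ℝ) ≤ n := by exact_mod_cast hn
  rw [div_lt_iff₀ (by linarith)] at hm
  rw [← neg_div, le_div_iff₀ (by positivity)]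
  nlinarith

/-- Divergence-free tangent fields are `L²`-orthogonal to gradients. -/
lemma integral_dotProduct_grad12_eq_zero {f : ℝ³ → ℝ} (hf : ContDiff ℝ 2 f) {Ω : Set ℝ³}
    (hΩ : Ω = f ⁻¹' Iio 0) (hb : Bornology.IsBounded Ω)
    (hgrad : ∀ x ∈ frontier Ω, grad12 f x ≠ 0) {u : ℝ³ → ℝ³} (hu : ContinuousOn u (closure Ω))
    (hdiff : ∀ x ∈ Ω, DifferentiableAt ℝ u x) (hdiv : ∀ x ∈ Ω, ∑ i, jac12 u x i i = 0)
    (htan : ∀ x ∈ frontier Ω, u x ⬝ᵥ grad12 f x = 0) {φ : ℝ³ → ℝ} (hφ : ContDiff ℝ 1 φ) :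
    ∫ x in Ω, u x ⬝ᵥ grad12 φ x = 0 := by
  have hf1 : ContDiff ℝ 1 f := hf.of_le (by norm_num)
  have hO : IsOpen Ω := hΩ ▸ isOpen_Iio.preimage hf.continuous
  have hgf : ContDiff ℝ 1 (grad12 f) :=
    contDiff_pi.2 fun i => (hf.fderiv_right (m := 1) (by norm_num)).clm_apply contDiff_const
  set D : ℝ³ → ℝ := fun x => ∑ i, jac12 (grad12 f) x i i with hD
  have hDc : Continuous D := by
    refine continuous_finsetSum _ fun i _ => ?_
    exact continuous_pi_iff.1
      ((hgf.continuous_fderiv (by norm_num)).clm_apply continuous_const) i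
  obtain ⟨M, hM⟩ := hb.isCompact_closure.exists_bound_of_continuousOn hφ.continuous.continuousOn
  set g : ℝ³ → ℝ := fun x => u x ⬝ᵥ grad12 φ x with hg
  have hgc : ContinuousOn g (closure Ω) :=
    continuousOn_dotProduct hu (continuous_grad12 hφ).continuousOn
  have hgi : IntegrableOn g Ω := integrableOn_of_continuousOn_closure hb hgc
  have hDi : IntegrableOn D Ω := integrableOn_of_continuousOn_closure hb hDc.continuousOn
  set L := ∫ x in Ω, |D x| with hL
  have hL0 : 0 ≤ L := integral_nonneg fun _ => abs_nonneg _
  have hlim : Tendsto (fun n : ℕ => ∫ x in Ω, cutoff (n + 1) (f x) * g x) atTop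
      (𝓝 (∫ x in Ω, g x)) := by
    refine tendsto_integral_of_dominated_convergence (fun x => |g x|)
      (fun n => (((contDiff_cutoff _).continuous.comp hf.continuous).aestronglyMeasurable).mul
        hgi.aestronglyMeasurable) hgi.abs (fun n => ?_) ?_
    · refine Eventually.of_forall fun x => ?_
      have := cutoff_mem_Icc (n + 1) (f x)
      rw [Real.norm_eq_abs, abs_mul, abs_of_nonneg this.1]
      exact mul_le_of_le_one_left (abs_nonneg _) this.2
    · filter_upwards [ae_restrict_mem hO.measurableSet] with x hx
      have hfx : f x < 0 := by simpa [hΩ] using hx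
      simpa using (tendsto_cutoff hfx).mul_const (g x)
  have hwdiv : ∀ x ∈ Ω, ∑ i, jac12 (fun y => φ y • u y) x i i = g x := fun x hx => by
    rw [sum_jac12_smul (hφ.differentiable one_ne_zero x) (hdiff x hx), hdiv x hx, mul_zero,
      add_zero]
  have hkey : ∀ η > 0, |∫ x in Ω, g x| ≤ |M| * η * L := by
    intro η hη
    obtain ⟨ε, hε, hsmall⟩ := exists_abs_dotProduct_le hf1 hΩ hb hgrad hu htan hη
    refine le_of_tendsto hlim.abs ?_
    obtain ⟨m, hm⟩ := exists_nat_gt (2 / ε)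
    filter_upwards [eventually_ge_atTop m] with n hn
    have hN : (0 : ℝ) < n + 1 := by positivity
    have hNε : 2 / ((n : ℝ) + 1) < ε := by
      have hn' : (m : ℝ) ≤ n := by exact_mod_cast hn
      rw [div_lt_iff₀ hε] at hm
      rw [div_lt_iff₀ hN]
      nlinarith
    obtain ⟨hi1, hi2, he⟩ := integral_cutoff hf1 hΩ hb (w := fun y => φ y • u y) (D := g)
      (fun x hx => (hφ.differentiable one_ne_zero x).smul (hdiff x hx))
      (hgc.mono subset_closure) hwdiv (contDiff_cutoff (n + 1)) (one_div_pos.2 hN)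
      fun t ht => cutoff_eq_zero hN ht
    obtain ⟨hi1', hi2', he'⟩ := integral_cutoff hf1 hΩ hb (w := grad12 f) (D := D)
      (fun x hx => hgf.differentiable one_ne_zero x)
      hDc.continuousOn (fun x _ => rfl) (contDiff_cutoff (n + 1)) (one_div_pos.2 hN)
      fun t ht => cutoff_eq_zero hN ht
    have hb1 : ∫ x in Ω, cutoff (n + 1) (f x) * D x ≤ L := by
      refine integral_mono hi2' hDi.abs fun x => ?_
      have := cutoff_mem_Icc (n + 1) (f x)
      calc _ ≤ |cutoff (n + 1) (f x) * D x| := le_abs_self _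
        _ ≤ _ := by
          rw [abs_mul, abs_of_nonneg this.1]
          exact mul_le_of_le_one_left (abs_nonneg _) this.2
    rw [← neg_neg (∫ x in Ω, cutoff (n + 1) (f x) * g x), ← he, abs_neg]
    calc _ ≤ ∫ x in Ω, |deriv (cutoff (n + 1)) (f x) * ((φ x • u x) ⬝ᵥ grad12 f x)| :=
          abs_integral_le_integral_abs
      _ ≤ ∫ x in Ω, -(|M| * η) *
            (deriv (cutoff (n + 1)) (f x) * (grad12 f x ⬝ᵥ grad12 f x)) := by
          refine setIntegral_mono_on hi1.abs (hi1'.const_mul _) hO.measurableSet fun x hx => ?_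
          rcases lt_or_ge (f x) (-(2 / ((n : ℝ) + 1))) with h | h
          · simp [deriv_cutoff_eq_zero hN h]
          · have h1 := hsmall x hx (by linarith)
            have h2 : |φ x| ≤ |M| := (hM x (subset_closure hx)).trans (le_abs_self _)
            have h3 := deriv_cutoff_nonpos hN (f x)
            rw [smul_dotProduct, smul_eq_mul, abs_mul, abs_mul, abs_of_nonpos h3]
            have h4 := mul_le_mul h2 h1 (abs_nonneg _) (abs_nonneg _)
            nlinarith
      _ = |M| * η * ∫ x in Ω, cutoff (n + 1) (f x) * D x := by
          rw [integral_const_mul, he']; ring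
      _ ≤ _ := by gcongr
  by_contra hne
  have hpos : 0 < |∫ x in Ω, g x| := abs_pos.2 hne
  have h := hkey (|∫ x in Ω, g x| / (2 * (|M| * L + 1))) (by positivity)
  have : |M| * (|∫ x in Ω, g x| / (2 * (|M| * L + 1))) * L ≤ |∫ x in Ω, g x| / 2 := by
    rw [mul_div_assoc', div_mul_eq_mul_div, div_le_div_iff₀ (by positivity) two_pos]
    nlinarith [mul_nonneg (abs_nonneg M) hL0]
  linarith

lemma deriv_expNegInvGlue_nonneg (t : ℝ) : 0 ≤ deriv expNegInvGlue t :=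
  expNegInvGlue.monotone.deriv_nonneg

lemma deriv_expNegInvGlue_of_nonpos {t : ℝ} (ht : t ≤ 0) : deriv expNegInvGlue t = 0 := by
  refine IsLocalMin.deriv_eq_zero (Eventually.of_forall fun s => ?_)
  rw [expNegInvGlue.zero_of_nonpos ht]
  exact expNegInvGlue.nonneg s

lemma deriv_expNegInvGlue_pos {t : ℝ} (ht : 0 < t) : 0 < deriv expNegInvGlue t := by
  have hev : expNegInvGlue =ᶠ[𝓝 t] fun s => Real.exp (-s⁻¹) := by
    filter_upwards [lt_mem_nhds ht] with s hs
    simp [expNegInvGlue, not_le.2 hs]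
  have hd : HasDerivAt (fun s : ℝ => Real.exp (-s⁻¹)) (Real.exp (-t⁻¹) * -(-(t ^ 2)⁻¹)) t :=
    (hasDerivAt_inv ht.ne').neg.exp
  rw [hev.deriv_eq, hd.deriv]
  have := Real.exp_pos (-t⁻¹)
  rw [neg_neg]
  positivity

lemma not_pos_of_integral_grad12_eq_zero {f : ℝ³ → ℝ} (hf : ContDiff ℝ 1 f) {Ω : Set ℝ³}
    (hΩ : Ω = f ⁻¹' Iio 0) (hb : Bornology.IsBounded Ω) (hfront : frontier Ω = f ⁻¹' {0})
    {r : ℝ³ → ℝ³} (hr : Continuous r)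
    (h : ∀ φ : ℝ³ → ℝ, ContDiff ℝ 1 φ → ∫ x in Ω, r x ⬝ᵥ grad12 φ x = 0) {x₀ : ℝ³}
    (hx₀ : x₀ ∈ frontier Ω) : ¬ 0 < r x₀ ⬝ᵥ grad12 f x₀ := by
  intro hpos
  have hO : IsOpen Ω := hΩ ▸ isOpen_Iio.preimage hf.continuous
  set ψ : ℝ → ℝ³ → ℝ := fun s x => f x - ∑ i, (x i - x₀ i) ^ 2 + s with hψ
  have hψc : ∀ s, ContDiff ℝ 1 (ψ s) := fun s => by
    refine (hf.sub (ContDiff.sum fun i _ => ?_)).add contDiff_const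
    exact ((contDiff_apply ℝ ℝ i).sub contDiff_const).pow 2
  have hgψ : ∀ s, grad12 (ψ s) = grad12 (ψ 0) := fun s => by
    funext x i
    simp only [grad12, hψ]
    rw [fderiv_add_const, fderiv_add_const]
  have hgψ₀ : grad12 (ψ 0) x₀ = grad12 f x₀ := by
    have hq : HasFDerivAt (fun x : ℝ³ => ∑ i, (x i - x₀ i) ^ 2) (0 : ℝ³ →L[ℝ] ℝ) x₀ := by
      have : HasFDerivAt (fun x : ℝ³ => ∑ i, (x i - x₀ i) ^ 2) (∑ i : Fin 3,
          (2 * (x₀ i - x₀ i) ^ 1) • (ContinuousLinearMap.proj i : ℝ³ →L[ℝ] ℝ)) x₀ := by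
        refine HasFDerivAt.fun_sum fun i _ => ?_
        have hi : HasFDerivAt (fun x : ℝ³ => x i - x₀ i)
            (ContinuousLinearMap.proj i : ℝ³ →L[ℝ] ℝ) x₀ :=
          (ContinuousLinearMap.proj i : ℝ³ →L[ℝ] ℝ).hasFDerivAt.sub_const (x₀ i)
        simpa using hi.pow 2
      simpa using this
    funext i
    have := ((hf.differentiable one_ne_zero x₀).hasFDerivAt.sub hq).add_const (0 : ℝ)
    simp only [grad12, hψ]
    erw [this.fderiv]
    simp
  set G : ℝ³ → ℝ := fun x => r x ⬝ᵥ grad12 (ψ 0) x with hG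
  have hGc : Continuous G := continuousOn_univ.1
    (continuousOn_dotProduct hr.continuousOn (continuous_grad12 (hψc 0)).continuousOn)
  obtain ⟨δ, hδ, hball⟩ := Metric.isOpen_iff.1 (isOpen_Ioi.preimage hGc) x₀
    (show 0 < r x₀ ⬝ᵥ grad12 (ψ 0) x₀ by rwa [hgψ₀])
  set s := δ ^ 2 with hs
  have hs0 : 0 < s := by positivity
  set φ : ℝ³ → ℝ := fun x => expNegInvGlue (ψ s x) with hφ
  have hφc : ContDiff ℝ 1 φ := expNegInvGlue.contDiff.comp (hψc s)
  have hval : ∀ x, r x ⬝ᵥ grad12 φ x = deriv expNegInvGlue (ψ s x) * G x := fun x => by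
    rw [hφ, grad12_comp ((hψc s).differentiable one_ne_zero x)
      ((expNegInvGlue.contDiff (n := 1)).differentiable one_ne_zero _),
      dotProduct_smul, smul_eq_mul, hgψ]
  have hgc : Continuous fun x => r x ⬝ᵥ grad12 φ x := continuousOn_univ.1
    (continuousOn_dotProduct hr.continuousOn (continuous_grad12 hφc).continuousOn)
  have hnn : ∀ x ∈ Ω, 0 ≤ r x ⬝ᵥ grad12 φ x := by
    intro x hx
    rw [hval]
    rcases le_or_gt (ψ s x) 0 with hle | hgt
    · rw [deriv_expNegInvGlue_of_nonpos hle, zero_mul]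
    · refine mul_nonneg (deriv_expNegInvGlue_nonneg _) (le_of_lt (hball ?_))
      have hfx : f x < 0 := by simpa [hΩ] using hx
      rw [mem_ball, dist_pi_lt_iff hδ]
      intro i
      have h1 : (x i - x₀ i) ^ 2 ≤ ∑ i, (x i - x₀ i) ^ 2 :=
        Finset.single_le_sum (f := fun i => (x i - x₀ i) ^ 2) (fun _ _ => sq_nonneg _)
          (Finset.mem_univ i)
      have h2 : (x i - x₀ i) ^ 2 < δ ^ 2 := by
        simp only [hψ] at hgt
        linarith
      exact abs_lt_of_sq_lt_sq h2 hδ.le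
  have hφ0 := h φ hφc
  rw [setIntegral_eq_zero_iff_of_nonneg_ae
    ((ae_restrict_mem hO.measurableSet).mono fun x hx => hnn x hx)
    (integrableOn_of_continuousOn_closure hb hgc.continuousOn)] at hφ0
  have hzero := Measure.eqOn_open_of_ae_eq hφ0 hO hgc.continuousOn continuousOn_const
  have hfx₀ : f x₀ = 0 := by
    rw [hfront] at hx₀
    exact hx₀
  have hU : {x | 0 < ψ s x} ∩ ball x₀ δ ∈ 𝓝 x₀ := by
    refine inter_mem ((isOpen_lt continuous_const (hψc s).continuous).mem_nhds ?_)
      (ball_mem_nhds _ hδ)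
    simpa [hψ, hfx₀] using hs0
  obtain ⟨x, ⟨hx1, hx2⟩, hxΩ⟩ := mem_closure_iff_nhds.1 (frontier_subset_closure hx₀) _ hU
  have h0 : r x ⬝ᵥ grad12 φ x = 0 := hzero hxΩ
  rw [hval] at h0
  exact (mul_pos (deriv_expNegInvGlue_pos hx1) (hball hx2)).ne' h0

/-- A continuous field that is `L²`-orthogonal to gradients is tangent to the boundary. -/
lemma dotProduct_grad12_eq_zero_of_integral {f : ℝ³ → ℝ} (hf : ContDiff ℝ 1 f) {Ω : Set ℝ³}
    (hΩ : Ω = f ⁻¹' Iio 0) (hb : Bornology.IsBounded Ω) (hfront : frontier Ω = f ⁻¹' {0})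
    {r : ℝ³ → ℝ³} (hr : Continuous r)
    (h : ∀ φ : ℝ³ → ℝ, ContDiff ℝ 1 φ → ∫ x in Ω, r x ⬝ᵥ grad12 φ x = 0) {x₀ : ℝ³}
    (hx₀ : x₀ ∈ frontier Ω) : r x₀ ⬝ᵥ grad12 f x₀ = 0 := by
  have h1 := not_pos_of_integral_grad12_eq_zero hf hΩ hb hfront hr h hx₀
  have h2 := not_pos_of_integral_grad12_eq_zero hf hΩ hb hfront (r := fun x => -r x) hr.neg
    (fun φ hφ => by simp only [neg_dotProduct, integral_neg, h φ hφ, neg_zero]) hx₀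
  rw [neg_dotProduct] at h2
  linarith

lemma jac12_smul {u : ℝ³ → ℝ³} {x : ℝ³} (hu : DifferentiableAt ℝ u x) (c : ℝ) (i j : Fin 3) :
    jac12 (c • u) x i j = c * jac12 u x i j := by
  simp [jac12, fderiv_const_smul hu]

lemma symJac12_smul {u : ℝ³ → ℝ³} {x : ℝ³} (hu : DifferentiableAt ℝ u x) (c : ℝ) (i j : Fin 3) :
    symJac12 (c • u) x i j = c * symJac12 u x i j := by
  simp only [symJac12, jac12_smul hu]
  ring

lemma frobSq12_const_mul (M : Fin 3 → Fin 3 → ℝ) (c : ℝ) :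
    frobSq12 (fun i j => c * M i j) = c ^ 2 * frobSq12 M := by
  simp only [frobSq12, mul_pow, Finset.mul_sum]

lemma memH1SigmaTan_smul {Ω : Set ℝ³} (hO : MeasurableSet Ω) {f : ℝ³ → ℝ} {u : ℝ³ → ℝ³}
    (hu : memH1SigmaTan Ω f u) (c : ℝ) : memH1SigmaTan Ω f (c • u) := by
  obtain ⟨h1, h2, h3, h4, h5, h6⟩ := hu
  refine ⟨h1.const_smul c, fun x hx => (h2 x hx).const_smul c, fun x hx => ?_, fun x hx => ?_, ?_,
    ?_⟩
  · simp only [jac12_smul (h2 x hx), ← Finset.mul_sum, h3 x hx, mul_zero]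
  · rw [Pi.smul_apply, smul_dotProduct, h4 x hx, smul_zero]
  · refine IntegrableOn.congr_fun (h5.const_mul (c ^ 2)) (fun x _ => ?_) hO
    simp [mul_pow, Finset.mul_sum]
  · refine IntegrableOn.congr_fun (h6.const_mul (c ^ 2)) (fun x hx => ?_) hO
    simp only [← frobSq12_const_mul, ← jac12_smul (h2 x hx)]

lemma frobSq12_symJac12_le (u : ℝ³ → ℝ³) (x : ℝ³) :
    frobSq12 (symJac12 u x) ≤ frobSq12 (jac12 u x) := by
  simp only [frobSq12, symJac12, Fin.sum_univ_three]
  nlinarith [sq_nonneg (jac12 u x 0 1 - jac12 u x 1 0), sq_nonneg (jac12 u x 0 2 - jac12 u x 2 0),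
    sq_nonneg (jac12 u x 1 2 - jac12 u x 2 1)]

lemma integrableOn_frobSq12_symJac12 {Ω : Set ℝ³} {f : ℝ³ → ℝ} {u : ℝ³ → ℝ³}
    (hu : memH1SigmaTan Ω f u) : IntegrableOn (fun x => frobSq12 (symJac12 u x)) Ω := by
  refine Integrable.mono' hu.2.2.2.2.2 (measurable_frobSq12_symJac12 u).aestronglyMeasurable
    (Eventually.of_forall fun x => ?_)
  rw [Real.norm_of_nonneg (frobSq12_nonneg _)]
  exact frobSq12_symJac12_le u x

lemma continuousOn_sum_sq_sub {s : Set ℝ³} {v w : ℝ³ → ℝ³} (hv : ContinuousOn v s)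
    (hw : ContinuousOn w s) : ContinuousOn (fun x => ∑ i, (v x i - w x i) ^ 2) s :=
  continuousOn_finsetSum _ fun i _ =>
    ((continuousOn_pi.1 hv i).sub (continuousOn_pi.1 hw i)).pow 2

lemma integrableOn_sum_sq_sub {Ω : Set ℝ³} (hb : Bornology.IsBounded Ω) {v w : ℝ³ → ℝ³}
    (hv : ContinuousOn v (closure Ω)) (hw : ContinuousOn w (closure Ω)) :
    IntegrableOn (fun x => ∑ i, (v x i - w x i) ^ 2) Ω :=
  integrableOn_of_continuousOn_closure hb (continuousOn_sum_sq_sub hv hw)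

/-- The Korn-type estimate in terms of Bochner integrals. -/
lemma exists_rigidMotion_integral_le {Ω : Set ℝ³} (hb : Bornology.IsBounded Ω)
    (h : RigidEstimate Ω Ω) (f : ℝ³ → ℝ) :
    ∃ C : ℝ, 0 ≤ C ∧ ∀ u, memH1SigmaTan Ω f u → ∃ p,
      ∫ x in Ω, ∑ i, (u x i - rigidMotion p x i) ^ 2 ≤
        C * ∫ x in Ω, frobSq12 (symJac12 u x) := by
  obtain ⟨C, hC, h⟩ := h
  refine ⟨C.toReal, ENNReal.toReal_nonneg, fun u hu => ?_⟩
  obtain ⟨p, hp⟩ := h u hu.2.1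
  refine ⟨p, ?_⟩
  have hE0 : 0 ≤ ∫ x in Ω, frobSq12 (symJac12 u x) := integral_nonneg fun x => frobSq12_nonneg _
  rw [← ofReal_integral_eq_lintegral_ofReal
    (integrableOn_sum_sq_sub hb hu.1 (continuous_rigidMotion p).continuousOn)
    (Eventually.of_forall fun x => Finset.sum_nonneg fun _ _ => sq_nonneg _)] at hp
  simp only [strain] at hp
  rw [← ofReal_integral_eq_lintegral_ofReal (integrableOn_frobSq12_symJac12 hu)
    (Eventually.of_forall fun x => frobSq12_nonneg _), ← ENNReal.ofReal_toReal hC,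
    ← ENNReal.ofReal_mul ENNReal.toReal_nonneg] at hp
  exact (ENNReal.ofReal_le_ofReal_iff (mul_nonneg ENNReal.toReal_nonneg hE0)).1 hp

lemma exists_norm_sq_le_integral {Ω : Set ℝ³} (hO : IsOpen Ω) (hb : Bornology.IsBounded Ω)
    (hne : Ω.Nonempty) :
    ∃ C : ℝ, 0 ≤ C ∧ ∀ p, ‖p‖ ^ 2 ≤ C * ∫ x in Ω, ∑ i, rigidMotion p x i ^ 2 := by
  obtain ⟨C, hC, h⟩ := exists_norm_sq_le_lintegral hO hne
  refine ⟨C.toReal, ENNReal.toReal_nonneg, fun p => ?_⟩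
  have hp := h p
  have hi : IntegrableOn (fun x => ∑ i, rigidMotion p x i ^ 2) Ω := by
    simpa using integrableOn_sum_sq_sub hb (continuous_rigidMotion p).continuousOn
      (continuousOn_const (c := (0 : ℝ³)))
  have hnn : ∀ x, 0 ≤ ∑ i, rigidMotion p x i ^ 2 := fun x =>
    Finset.sum_nonneg fun _ _ => sq_nonneg _
  rw [← ofReal_integral_eq_lintegral_ofReal hi (Eventually.of_forall hnn),
    ← ENNReal.ofReal_toReal hC, ← ENNReal.ofReal_mul ENNReal.toReal_nonneg] at hp
  exact (ENNReal.ofReal_le_ofReal_iff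
    (mul_nonneg ENNReal.toReal_nonneg (integral_nonneg hnn))).1 hp

lemma sum_sq_sub_le (a b c : ℝ³) :
    ∑ i, (a i - c i) ^ 2 ≤ 2 * ∑ i, (a i - b i) ^ 2 + 2 * ∑ i, (b i - c i) ^ 2 := by
  rw [Finset.mul_sum, Finset.mul_sum, ← Finset.sum_add_distrib]
  exact Finset.sum_le_sum fun i _ => by nlinarith [sq_nonneg ((a i - b i) - (b i - c i))]

lemma integral_sum_sq_sub_le {Ω : Set ℝ³} (hb : Bornology.IsBounded Ω) {a b c : ℝ³ → ℝ³}
    (ha : ContinuousOn a (closure Ω)) (hb' : ContinuousOn b (closure Ω))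
    (hc : ContinuousOn c (closure Ω)) :
    ∫ x in Ω, ∑ i, (a x i - c x i) ^ 2 ≤ 2 * (∫ x in Ω, ∑ i, (a x i - b x i) ^ 2) +
      2 * ∫ x in Ω, ∑ i, (b x i - c x i) ^ 2 := by
  have h1 := (integrableOn_sum_sq_sub hb ha hb').const_mul 2
  have h2 := (integrableOn_sum_sq_sub hb hb' hc).const_mul 2
  rw [← integral_const_mul, ← integral_const_mul, ← integral_add h1 h2]
  exact integral_mono (integrableOn_sum_sq_sub hb ha hc) (h1.add h2) fun x =>
    sum_sq_sub_le (a x) (b x) (c x)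

/-- Orthogonality to a fixed field passes to `L²` limits. -/
lemma integral_dotProduct_eq_zero_of_tendsto {Ω : Set ℝ³} (hb : Bornology.IsBounded Ω)
    {v : ℕ → ℝ³ → ℝ³} {r w : ℝ³ → ℝ³} (hv : ∀ n, ContinuousOn (v n) (closure Ω))
    (hr : ContinuousOn r (closure Ω)) (hw : ContinuousOn w (closure Ω))
    (hlim : Tendsto (fun n => ∫ x in Ω, ∑ i, (v n x i - r x i) ^ 2) atTop (𝓝 0))
    (h0 : ∀ n, ∫ x in Ω, v n x ⬝ᵥ w x = 0) : ∫ x in Ω, r x ⬝ᵥ w x = 0 := by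
  set W := ∫ x in Ω, ∑ i, (w x i - (0 : ℝ³ → ℝ³) x i) ^ 2 with hW
  have hWi := integrableOn_sum_sq_sub hb hw (continuousOn_const (c := (0 : ℝ³)))
  have hW0 : 0 ≤ W := integral_nonneg fun x => Finset.sum_nonneg fun _ _ => sq_nonneg _
  have hri := integrableOn_of_continuousOn_closure hb (continuousOn_dotProduct hr hw)
  have hstep : ∀ τ > 0, ∀ n, |∫ x in Ω, r x ⬝ᵥ w x| ≤
      τ⁻¹ * (∫ x in Ω, ∑ i, (v n x i - r x i) ^ 2) + τ * W := by
    intro τ hτ n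
    have hvi := integrableOn_of_continuousOn_closure hb (continuousOn_dotProduct (hv n) hw)
    have h1 := (integrableOn_sum_sq_sub hb (hv n) hr).const_mul τ⁻¹
    have h2 := hWi.const_mul τ
    have : |∫ x in Ω, r x ⬝ᵥ w x| = |∫ x in Ω, (v n x ⬝ᵥ w x - r x ⬝ᵥ w x)| := by
      rw [integral_sub hvi hri, h0 n, zero_sub, abs_neg]
    rw [this, hW, ← integral_const_mul, ← integral_const_mul]
    refine abs_integral_le_integral_abs.trans ?_
    refine (integral_mono (hvi.sub hri).abs (h1.add h2) fun x => ?_).trans_eq (integral_add h1 h2)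
    change |v n x ⬝ᵥ w x - r x ⬝ᵥ w x| ≤ τ⁻¹ * (∑ i, (v n x i - r x i) ^ 2) +
      τ * ∑ i, (w x i - 0) ^ 2
    rw [← sub_dotProduct, Finset.mul_sum, Finset.mul_sum, ← Finset.sum_add_distrib]
    refine (Finset.abs_sum_le_sum_abs _ _).trans (Finset.sum_le_sum fun i _ => ?_)
    set a := v n x i - r x i with ha
    have hab : |a| * |w x i| ≤ τ⁻¹ * |a| ^ 2 + τ * |w x i| ^ 2 := by
      have h3 : 0 ≤ τ * (τ⁻¹ * |a| - |w x i|) ^ 2 := by positivity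
      have h4 : τ * (τ⁻¹ * |a| - |w x i|) ^ 2 =
          τ⁻¹ * |a| ^ 2 - 2 * (|a| * |w x i|) + τ * |w x i| ^ 2 := by
        field_simp
        ring
      have h5 : 0 ≤ |a| * |w x i| := by positivity
      linarith
    simpa [abs_mul] using hab
  have hstep' : ∀ τ > 0, |∫ x in Ω, r x ⬝ᵥ w x| ≤ τ * W := fun τ hτ => by
    have ht : Tendsto (fun n => τ⁻¹ * (∫ x in Ω, ∑ i, (v n x i - r x i) ^ 2) + τ * W) atTop
        (𝓝 (τ * W)) := by
      simpa using (hlim.const_mul τ⁻¹).add_const (τ * W)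
    exact ge_of_tendsto' ht (hstep τ hτ)
  by_contra hne
  have hpos := abs_pos.2 hne
  have h := hstep' (|∫ x in Ω, r x ⬝ᵥ w x| / (2 * (W + 1))) (by positivity)
  rw [div_mul_eq_mul_div, le_div_iff₀ (by positivity)] at h
  nlinarith

lemma hasFDerivAt_rigidMotion (p : ℝ³ × ℝ³) (x : ℝ³) :
    HasFDerivAt (rigidMotion p) (LinearMap.toContinuousLinearMap (crossProduct p.2)) x :=
  (LinearMap.toContinuousLinearMap (crossProduct p.2)).hasFDerivAt.const_add p.1

lemma jac12_rigidMotion (p : ℝ³ × ℝ³) (x : ℝ³) (i j : Fin 3) :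
    jac12 (rigidMotion p) x i j = (p.2 ⨯₃ (Pi.single j 1 : ℝ³)) i := by
  simp [jac12, (hasFDerivAt_rigidMotion p x).fderiv]

lemma symJac12_rigidMotion (p : ℝ³ × ℝ³) (x : ℝ³) (i j : Fin 3) :
    symJac12 (rigidMotion p) x i j = 0 := by
  simp only [symJac12, jac12_rigidMotion]
  fin_cases i <;> fin_cases j <;> simp [cross_apply]

lemma memH1SigmaTan_rigidMotion {Ω : Set ℝ³} (hb : Bornology.IsBounded Ω) {f : ℝ³ → ℝ}
    {p : ℝ³ × ℝ³} (htan : ∀ x ∈ frontier Ω, rigidMotion p x ⬝ᵥ grad12 f x = 0) :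
    memH1SigmaTan Ω f (rigidMotion p) := by
  refine ⟨(continuous_rigidMotion p).continuousOn,
    fun x _ => (hasFDerivAt_rigidMotion p x).differentiableAt, fun x _ => ?_, htan, ?_, ?_⟩
  · have := fun i => symJac12_rigidMotion p x i i
    simp only [symJac12, add_self_div_two] at this
    exact Finset.sum_eq_zero fun i _ => this i
  · simpa using integrableOn_sum_sq_sub hb (continuous_rigidMotion p).continuousOn
      (continuousOn_const (c := (0 : ℝ³)))
  · simp only [show jac12 (rigidMotion p) = fun _ i j => (p.2 ⨯₃ (Pi.single j 1 : ℝ³)) i from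
      funext fun x => funext fun i => funext fun j => jac12_rigidMotion p x i j]
    exact integrableOn_of_continuousOn_closure hb continuousOn_const

lemma grad12_ne_zero_imp {f : ℝ³ → ℝ} {x : ℝ³} (h : grad12 f x ≠ 0) : fderiv ℝ f x ≠ 0 :=
  fun h0 => h (by funext i; simp [grad12, h0])

/-- A sequence of rigid motions `L²`-close to a bounded sequence of fields has bounded parameters,
hence the fields subconverge to a rigid motion. -/
lemma exists_subseq_tendsto_rigidMotion {Ω : Set ℝ³} (hO : IsOpen Ω)
    (hb : Bornology.IsBounded Ω) (hne : Ω.Nonempty) {v : ℕ → ℝ³ → ℝ³}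
    (hv : ∀ n, ContinuousOn (v n) (closure Ω)) (hnorm : ∀ n, ∫ x in Ω, ∑ i, v n x i ^ 2 = 1)
    {p : ℕ → ℝ³ × ℝ³}
    (hp : Tendsto (fun n => ∫ x in Ω, ∑ i, (v n x i - rigidMotion (p n) x i) ^ 2) atTop (𝓝 0)) :
    ∃ (q : ℝ³ × ℝ³) (ι : ℕ → ℕ), StrictMono ι ∧
      Tendsto (fun n => ∫ x in Ω, ∑ i, (v (ι n) x i - rigidMotion q x i) ^ 2) atTop (𝓝 0) := by
  have hrc : ∀ q, ContinuousOn (rigidMotion q) (closure Ω) := fun q =>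
    (continuous_rigidMotion q).continuousOn
  obtain ⟨C, hC0, hC⟩ := exists_norm_sq_le_integral hO hb hne
  obtain ⟨B, hB⟩ := hp.bddAbove_range
  have hB' : ∀ n, ∫ x in Ω, ∑ i, (v n x i - rigidMotion (p n) x i) ^ 2 ≤ B := fun n =>
    hB ⟨n, rfl⟩
  have hbound : ∀ n, ‖p n‖ ≤ C * (2 * B + 2) + 1 := by
    intro n
    have h1 := integral_sum_sq_sub_le hb (hrc (p n)) (hv n) (continuousOn_const (c := (0 : ℝ³)))
    simp only [Pi.zero_apply, sub_zero, hnorm n] at h1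
    have hsymm : ∫ x in Ω, ∑ i, (rigidMotion (p n) x i - v n x i) ^ 2 =
        ∫ x in Ω, ∑ i, (v n x i - rigidMotion (p n) x i) ^ 2 := by
      simp only [sub_sq_comm]
    rw [hsymm] at h1
    have h2 : ‖p n‖ ^ 2 ≤ C * (2 * B + 2) := (hC (p n)).trans
      (mul_le_mul_of_nonneg_left (by linarith [hB' n]) hC0)
    nlinarith [sq_nonneg (‖p n‖ - 1), norm_nonneg (p n)]
  obtain ⟨q, -, ι, hι, hq⟩ := tendsto_subseq_of_bounded
    (Metric.isBounded_closedBall (x := (0 : ℝ³ × ℝ³)) (r := C * (2 * B + 2) + 1))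
    (x := p) fun n => by simpa using hbound n
  refine ⟨q, ι, hι, ?_⟩
  obtain ⟨R, hR⟩ := hb.exists_norm_le
  have hdiff : ∀ n, ∫ x in Ω, ∑ i, (rigidMotion (p (ι n)) x i - rigidMotion q x i) ^ 2 ≤
      3 * (1 + 2 * R) ^ 2 * ‖p (ι n) - q‖ ^ 2 * volume.real Ω := by
    intro n
    have hfin : volume Ω ≠ ∞ := hb.measure_lt_top.ne
    calc _ ≤ ∫ _x in Ω, 3 * (1 + 2 * R) ^ 2 * ‖p (ι n) - q‖ ^ 2 := by
          refine setIntegral_mono_on (integrableOn_sum_sq_sub hb (hrc _) (hrc _))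
            (integrableOn_const hfin) hO.measurableSet fun x hx => ?_
          have := sum_sq_rigidMotion_le (p (ι n) - q) (hR x hx)
          simpa [rigidMotion_sub] using this
      _ = _ := by rw [setIntegral_const, smul_eq_mul, mul_comm]
  have hlim : Tendsto (fun n => 2 * (∫ x in Ω, ∑ i,
      (v (ι n) x i - rigidMotion (p (ι n)) x i) ^ 2) +
      2 * (3 * (1 + 2 * R) ^ 2 * ‖p (ι n) - q‖ ^ 2 * volume.real Ω)) atTop (𝓝 0) := by
    have h1 := (hp.comp hι.tendsto_atTop).const_mul 2
    have h2 : Tendsto (fun n => ‖p (ι n) - q‖) atTop (𝓝 0) := by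
      simpa using (hq.sub_const q).norm
    have h3 := ((((h2.pow 2).const_mul (3 * (1 + 2 * R) ^ 2)).mul_const (volume.real Ω))).const_mul 2
    simpa using h1.add h3
  refine squeeze_zero (fun n => integral_nonneg fun x => Finset.sum_nonneg fun _ _ => sq_nonneg _)
    (fun n => ?_) hlim
  refine (integral_sum_sq_sub_le hb (hv (ι n)) (hrc (p (ι n))) (hrc q)).trans ?_
  gcongr
  exact hdiff n

end KornPoincare

open KornPoincare Filter Topology

/-- Proposition 5.1 (symmetric Poincaré inequality): on a bounded smooth
domain `Ω ⊆ ℝ³` there is `C = C(Ω) > 0` such that every `u ∈ H¹_{σ,tan}(Ω)`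
which is `L²`-orthogonal to `Ker S` satisfies `‖u‖_{L²} ≤ C ‖Su‖_{L²}`. -/
theorem symmetric_poincare
    (f : (Fin 3 → ℝ) → ℝ) (hf : ContDiff ℝ (⊤ : ℕ∞) f)
    (Ω : Set (Fin 3 → ℝ))
    (hΩ : Ω = f ⁻¹' Set.Iio (0 : ℝ))
    (hbdd : Bornology.IsBounded Ω) (hconn : IsConnected Ω)
    (hfront : frontier Ω = f ⁻¹' {(0 : ℝ)})
    (hgrad : ∀ x ∈ frontier Ω, grad12 f x ≠ 0) :
    ∃ C > 0, ∀ u, memH1SigmaTan Ω f u →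
      (∀ v, memH1SigmaTan Ω f v → (∀ x ∈ Ω, ∀ i j, symJac12 v x i j = 0) →
        ∫ x in Ω, u x ⬝ᵥ v x = 0) →
      ∫ x in Ω, ∑ i, (u x i) ^ 2 ≤ C ^ 2 * ∫ x in Ω, frobSq12 (symJac12 u x) := by
  have hf2 : ContDiff ℝ 2 f := contDiff_infty.1 hf 2
  have hf1 : ContDiff ℝ 1 f := hf2.of_le (by norm_num)
  have hO : IsOpen Ω := hΩ ▸ isOpen_Iio.preimage hf1.continuous
  obtain ⟨C₀, hC₀, hkorn⟩ := exists_rigidMotion_integral_le hbdd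
    (rigidEstimate_self hO hbdd hconn fun x hx => exists_local_rigidEstimate hf1 hΩ
      (fun y hy => grad12_ne_zero_imp (hgrad y hy)) hx) f
  by_contra! hcon
  have hseq : ∀ n : ℕ, ∃ v, memH1SigmaTan Ω f v ∧
      (∀ w, memH1SigmaTan Ω f w → (∀ x ∈ Ω, ∀ i j, symJac12 w x i j = 0) →
        ∫ x in Ω, v x ⬝ᵥ w x = 0) ∧
      ∫ x in Ω, ∑ i, (v x i) ^ 2 = 1 ∧
      ∫ x in Ω, frobSq12 (symJac12 v x) ≤ 1 / ((n : ℝ) + 1) := by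
    intro n
    obtain ⟨u, hu, horth, hlt⟩ := hcon (n + 1) (by positivity)
    set N := ∫ x in Ω, ∑ i, (u x i) ^ 2 with hN
    set E := ∫ x in Ω, frobSq12 (symJac12 u x) with hE
    have hE0 : 0 ≤ E := integral_nonneg fun x => frobSq12_nonneg _
    have hN0 : 0 < N := lt_of_le_of_lt (by positivity) hlt
    have hc : (√N)⁻¹ ^ 2 = N⁻¹ := by rw [inv_pow, Real.sq_sqrt hN0.le]
    refine ⟨(√N)⁻¹ • u, memH1SigmaTan_smul hO.measurableSet hu _, fun w hw hw0 => ?_, ?_, ?_⟩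
    · simp only [Pi.smul_apply, smul_dotProduct, integral_smul, horth w hw hw0, smul_zero]
    · simp only [Pi.smul_apply, smul_eq_mul, mul_pow, ← Finset.mul_sum, integral_const_mul, hc]
      exact inv_mul_cancel₀ hN0.ne'
    · have : ∫ x in Ω, frobSq12 (symJac12 ((√N)⁻¹ • u) x) = N⁻¹ * E := by
        rw [hE, ← integral_const_mul]
        refine setIntegral_congr_fun hO.measurableSet fun x hx => ?_
        simp only [← hc, ← frobSq12_const_mul, ← symJac12_smul (hu.2.1 x hx)]
      rw [this, inv_mul_le_iff₀ hN0, mul_one_div, le_div_iff₀ (by positivity)]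
      nlinarith [Nat.cast_nonneg (α := ℝ) n]
  choose v hv horth hnorm hstrain using hseq
  choose p hp using fun n => hkorn (v n) (hv n)
  have hlim0 : Tendsto (fun n => ∫ x in Ω, ∑ i, (v n x i - rigidMotion (p n) x i) ^ 2) atTop
      (𝓝 0) := by
    refine squeeze_zero
      (fun n => integral_nonneg fun x => Finset.sum_nonneg fun _ _ => sq_nonneg _)
      (fun n => (hp n).trans (mul_le_mul_of_nonneg_left (hstrain n) hC₀)) ?_
    simpa using (tendsto_one_div_add_atTop_nhds_zero_nat (𝕜 := ℝ)).const_mul C₀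
  obtain ⟨q, ι, -, hlim⟩ := exists_subseq_tendsto_rigidMotion hO hbdd hconn.nonempty
    (fun n => (hv n).1) hnorm hlim0
  have hqc : ContinuousOn (rigidMotion q) (closure Ω) := (continuous_rigidMotion q).continuousOn
  have hqgrad : ∀ φ : (Fin 3 → ℝ) → ℝ, ContDiff ℝ 1 φ →
      ∫ x in Ω, rigidMotion q x ⬝ᵥ grad12 φ x = 0 := fun φ hφ =>
    integral_dotProduct_eq_zero_of_tendsto hbdd (fun n => (hv (ι n)).1) hqc
      (continuous_grad12 hφ).continuousOn hlim fun n =>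
      integral_dotProduct_grad12_eq_zero hf2 hΩ hbdd hgrad (hv (ι n)).1 (hv (ι n)).2.1
        (hv (ι n)).2.2.1 (hv (ι n)).2.2.2.1 hφ
  have hqmem : memH1SigmaTan Ω f (rigidMotion q) := memH1SigmaTan_rigidMotion hbdd fun x hx =>
    dotProduct_grad12_eq_zero_of_integral hf1 hΩ hbdd hfront (continuous_rigidMotion q) hqgrad hx
  have hqq := integral_dotProduct_eq_zero_of_tendsto hbdd (fun n => (hv (ι n)).1) hqc hqc hlim
    fun n => horth (ι n) _ hqmem fun x _ i j => symJac12_rigidMotion q x i j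
  have hle : ∀ n, 1 ≤ 2 * ∫ x in Ω, ∑ i, (v (ι n) x i - rigidMotion q x i) ^ 2 := by
    intro n
    have h := integral_sum_sq_sub_le hbdd (hv (ι n)).1 hqc
      (continuousOn_const (c := (0 : Fin 3 → ℝ)))
    have h0 : ∫ x in Ω, ∑ i, rigidMotion q x i ^ 2 = 0 := by
      simpa [dotProduct, ← sq] using hqq
    simpa [hnorm, h0] using h
  have := ge_of_tendsto' (hlim.const_mul 2) hle
  norm_num at this
end

section
/- Let Ω ⊂ ℝ³ be a bounded smooth domain and let λ be the supremum over ∂Ω of the maximum absolute principal curvature. There is a constant K > 0 (depending only on Ω via the trace inequality) such that every u ∈ H¹_{σ,tan}(Ω) satisfies ‖Du‖_{L²(Ω)} ≤ 2 ‖Su‖_{L²(Ω)} + K λ ‖u‖_{L²(Ω)}. -/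
open Matrix MeasureTheory

noncomputable def grad13 (f : (Fin 3 → ℝ) → ℝ) (x : Fin 3 → ℝ) : Fin 3 → ℝ :=
  fun i => fderiv ℝ f x (Pi.single i 1)

noncomputable def jac13 (u : (Fin 3 → ℝ) → (Fin 3 → ℝ)) (x : Fin 3 → ℝ) :
    Fin 3 → Fin 3 → ℝ :=
  fun i j => fderiv ℝ u x (Pi.single j 1) i

noncomputable def symJac13 (u : (Fin 3 → ℝ) → (Fin 3 → ℝ)) (x : Fin 3 → ℝ) :
    Fin 3 → Fin 3 → ℝ :=
  fun i j => (jac13 u x i j + jac13 u x j i) / 2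

def frobSq13 (M : Fin 3 → Fin 3 → ℝ) : ℝ := ∑ i, ∑ j, (M i j) ^ 2

/-- The outward unit normal field `N = ∇f / |∇f|` of the level set domain. -/
noncomputable def unitNormal13 (f : (Fin 3 → ℝ) → ℝ) (x : Fin 3 → ℝ) : Fin 3 → ℝ :=
  (Real.sqrt (∑ i, (grad13 f x i) ^ 2))⁻¹ • grad13 f x

def memH13 (Ω : Set (Fin 3 → ℝ)) (f : (Fin 3 → ℝ) → ℝ)
    (u : (Fin 3 → ℝ) → (Fin 3 → ℝ)) : Prop :=
  ContinuousOn u (closure Ω) ∧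
  (∀ x ∈ Ω, DifferentiableAt ℝ u x) ∧
  (∀ x ∈ Ω, ∑ i, jac13 u x i i = 0) ∧
  (∀ x ∈ frontier Ω, u x ⬝ᵥ grad13 f x = 0) ∧
  IntegrableOn (fun x => ∑ i, (u x i) ^ 2) Ω ∧
  IntegrableOn (fun x => frobSq13 (jac13 u x)) Ω

section Correlation

variable {E : Type*} [NormedAddCommGroup E] [NormedSpace ℝ E] [FiniteDimensional ℝ E]
  [MeasurableSpace E] [BorelSpace E] {μ : Measure E} [μ.IsAddHaarMeasure]

/-- The correlation of two real functions on a vector space. -/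
noncomputable def correlation (μ : Measure E) (F G : E → ℝ) (t : E) : ℝ := ∫ x, F (t + x) * G x ∂μ

lemma continuous_correlation {F G : E → ℝ} (hF : MemLp F 2 μ) (hG : MemLp G 2 μ) :
    Continuous (correlation μ F G) := by
  have : Fact ((2 : ENNReal) ≠ ⊤) := ⟨by simp⟩
  have h : correlation μ F G =
      fun t => inner ℝ (DomAddAct.mk t +ᵥ hF.toLp F) (hG.toLp G) := by
    funext t
    rw [DomAddAct.mk_vadd_toLp, MeasureTheory.L2.inner_def]
    refine integral_congr_ae ?_
    have hm := (hF.comp_measurePreserving (measurePreserving_vadd t μ)).coeFn_toLp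
    filter_upwards [hm, hG.coeFn_toLp] with x h1 h2
    rw [h2]
    refine Eq.trans ?_ (congrArg (fun y => inner ℝ y (G x)) h1.symm)
    simp [mul_comm]
  rw [h]
  exact (((DomAddAct.continuous_mk).vadd continuous_const).inner continuous_const)

lemma integral_mul_correlation {φ F G : E → ℝ} (hφ : Continuous φ) (hφc : HasCompactSupport φ)
    (hF : Integrable F μ) (hG : Integrable G μ) :
    ∫ t, φ t * correlation μ F G t ∂μ = ∫ x, (∫ t, φ t * F (t + x) ∂μ) * G x ∂μ := by
  obtain ⟨C, hC⟩ := hφ.bounded_above_of_compact_support hφc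
  have h : Integrable (fun z : E × E => F (z.1 + z.2) * G z.2) (μ.prod μ) :=
    (measurePreserving_add_prod μ μ).integrable_comp_of_integrable (hF.mul_prod hG)
  have h' : Integrable (Function.uncurry fun t x => φ t * (F (t + x) * G x)) (μ.prod μ) :=
    h.bdd_mul (c := C) (f := fun z : E × E => φ z.1)
      (hφ.comp continuous_fst).aestronglyMeasurable (.of_forall fun z => hC z.1)
  simp only [correlation, ← integral_const_mul, ← integral_mul_const]
  rw [integral_integral_swap h']
  simp only [mul_assoc]

lemma integral_mul_correlation_swap (φ F G : E → ℝ) :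
    ∫ t, φ t * correlation μ F G t ∂μ = ∫ t, φ (-t) * correlation μ G F t ∂μ := by
  rw [← integral_neg_eq_self]
  refine integral_congr_ae (.of_forall fun t => ?_)
  simp only [correlation]
  rw [← integral_add_left_eq_self _ t]
  simp [mul_comm]

/-- A directional derivative moves from the first argument of a correlation to the weight. -/
lemma integral_mul_correlation_fderiv_left {φ a G : E → ℝ} (hφ : ContDiff ℝ 1 φ)
    (hφc : HasCompactSupport φ) (ha : Differentiable ℝ a) (v : E) (hai : Integrable a μ)
    (ha' : Integrable (fun x => fderiv ℝ a x v) μ) (hG : Integrable G μ) :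
    ∫ t, φ t * correlation μ (fun x => fderiv ℝ a x v) G t ∂μ =
      -∫ t, fderiv ℝ φ t v * correlation μ a G t ∂μ := by
  have hφ' : Continuous fun t => fderiv ℝ φ t v :=
    (hφ.continuous_fderiv one_ne_zero).clm_apply continuous_const
  have hφc' : HasCompactSupport fun t => fderiv ℝ φ t v := hφc.fderiv_apply (𝕜 := ℝ) v
  obtain ⟨C, hC⟩ := hφ.continuous.bounded_above_of_compact_support hφc
  obtain ⟨C', hC'⟩ := hφ'.bounded_above_of_compact_support hφc'
  rw [integral_mul_correlation hφ.continuous hφc ha' hG,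
    integral_mul_correlation hφ' hφc' hai hG, ← integral_neg]
  refine integral_congr_ae (.of_forall fun x => ?_)
  simp only [← neg_mul]
  congr 1
  have e := integral_mul_fderiv_eq_neg_fderiv_mul_of_integrable (μ := μ) (f := φ)
    (g := fun t => a (t + x)) (v := v)
    ((hai.comp_add_right x).bdd_mul hφ'.aestronglyMeasurable (.of_forall hC'))
    (by
      simp only [fderiv_comp_add_right]
      exact (ha'.comp_add_right x).bdd_mul hφ.continuous.aestronglyMeasurable (.of_forall hC))
    ((hai.comp_add_right x).bdd_mul hφ.continuous.aestronglyMeasurable (.of_forall hC))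
    (fun t _ => hφ.differentiable one_ne_zero t)
    (fun t _ => (ha.comp (differentiable_id.add_const x)) t)
  simpa only [fderiv_comp_add_right] using e

/-- A directional derivative moves from the second argument of a correlation to the weight. -/
lemma integral_mul_correlation_fderiv_right {φ F b : E → ℝ} (hφ : ContDiff ℝ 1 φ)
    (hφc : HasCompactSupport φ) (hb : Differentiable ℝ b) (v : E) (hbi : Integrable b μ)
    (hb' : Integrable (fun x => fderiv ℝ b x v) μ) (hF : Integrable F μ) :
    ∫ t, φ t * correlation μ F (fun x => fderiv ℝ b x v) t ∂μ =
      ∫ t, fderiv ℝ φ t v * correlation μ F b t ∂μ := by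
  rw [integral_mul_correlation_swap,
    integral_mul_correlation_fderiv_left (φ := fun t => φ (-t)) (hφ.comp contDiff_neg)
      (hφc.comp_homeomorph (Homeomorph.neg E)) hb v hbi hb' hF,
    integral_mul_correlation_swap _ F b, ← integral_neg]
  refine integral_congr_ae (.of_forall fun t => ?_)
  have h : HasFDerivAt (fun t => φ (-t)) (-fderiv ℝ φ (-t)) t := by
    have h1 : HasFDerivAt (fun t : E => -t) (-ContinuousLinearMap.id ℝ E) t :=
      (hasFDerivAt_id t).neg
    simpa [Function.comp_def] using
      ((hφ.differentiable one_ne_zero (-t)).hasFDerivAt).comp t h1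
  simp [h.fderiv]

/-- For compactly supported differentiable functions with square integrable derivatives, two
directional derivatives may be exchanged under the integral. -/
theorem integral_fderiv_mul_fderiv_comm {a b : E → ℝ} (v w : E)
    (ha : Differentiable ℝ a) (hb : Differentiable ℝ b)
    (hac : HasCompactSupport a) (hbc : HasCompactSupport b)
    (hav : MemLp (fun x => fderiv ℝ a x v) 2 μ) (haw : MemLp (fun x => fderiv ℝ a x w) 2 μ)
    (hbv : MemLp (fun x => fderiv ℝ b x v) 2 μ) (hbw : MemLp (fun x => fderiv ℝ b x w) 2 μ) :
    ∫ x, fderiv ℝ a x v * fderiv ℝ b x w ∂μ = ∫ x, fderiv ℝ a x w * fderiv ℝ b x v ∂μ := by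
  have key : ∀ {f : E → ℝ}, HasCompactSupport f → MemLp f 2 μ → Integrable f μ := by
    intro f hc hf
    rw [← integrableOn_iff_integrable_of_support_subset (subset_tsupport f)]
    have : IsFiniteMeasure (μ.restrict (tsupport f)) := ⟨by simpa using hc.measure_lt_top⟩
    exact (hf.restrict _).integrable one_le_two
  have iav := key (hac.fderiv_apply (𝕜 := ℝ) v) hav
  have iaw := key (hac.fderiv_apply (𝕜 := ℝ) w) haw
  have ibv := key (hbc.fderiv_apply (𝕜 := ℝ) v) hbv
  have ibw := key (hbc.fderiv_apply (𝕜 := ℝ) w) hbw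
  have ia := ha.continuous.integrable_of_hasCompactSupport (μ := μ) hac
  have ib := hb.continuous.integrable_of_hasCompactSupport (μ := μ) hbc
  obtain ⟨Ca, hCa⟩ := ha.continuous.bounded_above_of_compact_support hac
  have c1 := continuous_correlation hav hbw
  have c2 := continuous_correlation haw hbv
  have hparts : correlation μ a (fun x => fderiv ℝ b x w) =
      fun t => -correlation μ (fun x => fderiv ℝ a x w) b t := by
    funext t
    obtain ⟨Cb, hCb⟩ := hb.continuous.bounded_above_of_compact_support hbc
    have e := integral_mul_fderiv_eq_neg_fderiv_mul_of_integrable (μ := μ)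
      (f := fun x => a (t + x)) (g := b) (v := w)
      (by
        simp only [fderiv_comp_add_left]
        exact (iaw.comp_add_left t).mul_bdd hb.continuous.aestronglyMeasurable (.of_forall hCb))
      (ibw.bdd_mul (ha.continuous.comp (continuous_const.add continuous_id)).aestronglyMeasurable
        (.of_forall fun x => hCa (t + x)))
      (ib.bdd_mul (ha.continuous.comp (continuous_const.add continuous_id)).aestronglyMeasurable
        (.of_forall fun x => hCa (t + x)))
      (fun x _ => (ha.comp (differentiable_id.const_add t)) x)
      (fun x _ => hb x)
    simpa only [fderiv_comp_add_left, correlation] using e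
  have hae := ae_eq_of_integral_contDiff_smul_eq (μ := μ) c1.locallyIntegrable
    c2.locallyIntegrable fun φ hφ hφc => by
      have hφ1 : ContDiff ℝ 1 φ := hφ.of_le (by exact_mod_cast le_top)
      simp only [smul_eq_mul]
      rw [integral_mul_correlation_fderiv_left hφ1 hφc ha v ia iav ibw, hparts,
        integral_mul_correlation_fderiv_right hφ1 hφc hb v ib ibv iaw, ← integral_neg]
      simp
  have heq := congrFun ((Continuous.ae_eq_iff_eq μ c1 c2).1 hae) 0
  simpa [correlation] using heq

end Correlation

section CompactlySupported

lemma hasCompactSupport_indicator_of_compactly_supported {X : Type*} [TopologicalSpace X]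
    [R1Space X] {Ω S : Set X}
    (hS : IsCompact S) {W : X → ℝ} (h0 : ∀ x ∈ Ω, x ∉ S → W x = 0) :
    HasCompactSupport (Ω.indicator W) := by
  refine HasCompactSupport.intro hS fun x hx => ?_
  by_cases hy' : x ∈ Ω
  · rw [Set.indicator_of_mem hy', h0 x hy' hx]
  · rw [Set.indicator_of_notMem hy']

variable {E : Type*} [NormedAddCommGroup E] [NormedSpace ℝ E]

lemma hasFDerivAt_indicator_of_compactly_supported {Ω S : Set E} (hΩ : IsOpen Ω)
    (hS : IsCompact S) (hSΩ : S ⊆ Ω) {W : E → ℝ} (hW : ∀ x ∈ Ω, DifferentiableAt ℝ W x)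
    (h0 : ∀ x ∈ Ω, x ∉ S → W x = 0) (x : E) :
    HasFDerivAt (Ω.indicator W) (Ω.indicator (fderiv ℝ W) x) x := by
  by_cases hx : x ∈ Ω
  · rw [Set.indicator_of_mem hx]
    refine (hW x hx).hasFDerivAt.congr_of_eventuallyEq ?_
    filter_upwards [hΩ.mem_nhds hx] with y hy
    rw [Set.indicator_of_mem hy]
  · rw [Set.indicator_of_notMem hx]
    refine (hasFDerivAt_const (0 : ℝ) x).congr_of_eventuallyEq ?_
    filter_upwards [hS.isClosed.isOpen_compl.mem_nhds (fun h => hx (hSΩ h))] with y hy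
    by_cases hy' : y ∈ Ω
    · rw [Set.indicator_of_mem hy', h0 y hy' hy]
    · rw [Set.indicator_of_notMem hy']

variable [FiniteDimensional ℝ E] [MeasurableSpace E] [BorelSpace E] {μ : Measure E}
  [μ.IsAddHaarMeasure]

lemma setIntegral_fderiv_eq_zero {Ω S : Set E} (hΩ : IsOpen Ω)
    (hS : IsCompact S) (hSΩ : S ⊆ Ω) {W : E → ℝ} (hW : ∀ x ∈ Ω, DifferentiableAt ℝ W x)
    (h0 : ∀ x ∈ Ω, x ∉ S → W x = 0) (v : E)
    (hi : IntegrableOn (fun x => fderiv ℝ W x v) Ω μ) :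
    ∫ x in Ω, fderiv ℝ W x v ∂μ = 0 := by
  have hd := hasFDerivAt_indicator_of_compactly_supported hΩ hS hSΩ hW h0
  have hc := hasCompactSupport_indicator_of_compactly_supported hS h0
  have hf : (fun x => fderiv ℝ (Ω.indicator W) x v) = Ω.indicator fun x => fderiv ℝ W x v := by
    funext x
    rw [(hd x).fderiv]
    by_cases hx : x ∈ Ω <;> simp [hx]
  have hi' : Integrable (fun x => fderiv ℝ (Ω.indicator W) x v) μ := by
    rw [hf, integrable_indicator_iff hΩ.measurableSet]
    exact hi
  have hcont : Continuous (Ω.indicator W) :=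
    continuous_iff_continuousAt.2 fun x => (hd x).continuousAt
  have e := integral_mul_fderiv_eq_neg_fderiv_mul_of_integrable (μ := μ)
    (f := fun _ => (1 : ℝ)) (g := Ω.indicator W) (v := v) (by simp) (by simpa using hi')
    (by simpa using hcont.integrable_of_hasCompactSupport hc)
    (fun x _ => differentiableAt_const _) (fun x _ => (hd x).differentiableAt)
  simp only [one_mul, hf] at e
  rw [integral_indicator hΩ.measurableSet] at e
  simpa using e

lemma setIntegral_fderiv_mul_fderiv_comm {Ω S : Set E} (hΩ : IsOpen Ω)
    (hS : IsCompact S) (hSΩ : S ⊆ Ω) {a b : E → ℝ} (ha : ∀ x ∈ Ω, DifferentiableAt ℝ a x)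
    (hb : ∀ x ∈ Ω, DifferentiableAt ℝ b x) (ha0 : ∀ x ∈ Ω, x ∉ S → a x = 0)
    (hb0 : ∀ x ∈ Ω, x ∉ S → b x = 0) (v w : E)
    (hav : MemLp (fun x => fderiv ℝ a x v) 2 (μ.restrict Ω))
    (haw : MemLp (fun x => fderiv ℝ a x w) 2 (μ.restrict Ω))
    (hbv : MemLp (fun x => fderiv ℝ b x v) 2 (μ.restrict Ω))
    (hbw : MemLp (fun x => fderiv ℝ b x w) 2 (μ.restrict Ω)) :
    ∫ x in Ω, fderiv ℝ a x v * fderiv ℝ b x w ∂μ =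
      ∫ x in Ω, fderiv ℝ a x w * fderiv ℝ b x v ∂μ := by
  have hda := hasFDerivAt_indicator_of_compactly_supported hΩ hS hSΩ ha ha0
  have hdb := hasFDerivAt_indicator_of_compactly_supported hΩ hS hSΩ hb hb0
  have hf : ∀ {W : E → ℝ}, (∀ x, HasFDerivAt (Ω.indicator W) (Ω.indicator (fderiv ℝ W) x) x) →
      ∀ v, (fun x => fderiv ℝ (Ω.indicator W) x v) = Ω.indicator fun x => fderiv ℝ W x v := by
    intro W hd v
    funext x
    rw [(hd x).fderiv]
    by_cases hx : x ∈ Ω <;> simp [hx]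
  have e := integral_fderiv_mul_fderiv_comm (μ := μ) v w
    (fun x => (hda x).differentiableAt) (fun x => (hdb x).differentiableAt)
    (hasCompactSupport_indicator_of_compactly_supported hS ha0)
    (hasCompactSupport_indicator_of_compactly_supported hS hb0)
    (by rw [hf hda]; exact (memLp_indicator_iff_restrict hΩ.measurableSet).2 hav)
    (by rw [hf hda]; exact (memLp_indicator_iff_restrict hΩ.measurableSet).2 haw)
    (by rw [hf hdb]; exact (memLp_indicator_iff_restrict hΩ.measurableSet).2 hbv)
    (by rw [hf hdb]; exact (memLp_indicator_iff_restrict hΩ.measurableSet).2 hbw)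
  have hm : ∀ v w, (fun x => fderiv ℝ (Ω.indicator a) x v * fderiv ℝ (Ω.indicator b) x w) =
      Ω.indicator fun x => fderiv ℝ a x v * fderiv ℝ b x w := by
    intro v w
    funext x
    rw [(hda x).fderiv, (hdb x).fderiv]
    by_cases hx : x ∈ Ω <;> simp [hx]
  rwa [hm, hm, integral_indicator hΩ.measurableSet, integral_indicator hΩ.measurableSet] at e

end CompactlySupported

lemma exists_bound_of_contDiffAt {E : Type*} [NormedAddCommGroup E] [NormedSpace ℝ E]
    {W : E → ℝ} {K : Set E} (hK : IsCompact K)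
    (hW : ∀ x ∈ K, ContDiffAt ℝ 1 W x) :
    ∃ M, 0 ≤ M ∧ ∀ x ∈ K, ‖W x‖ ≤ M ∧ ∀ v, ‖fderiv ℝ W x v‖ ≤ M * ‖v‖ := by
  obtain ⟨C, hC⟩ := hK.exists_bound_of_continuousOn (f := W)
    fun x hx => (hW x hx).continuousAt.continuousWithinAt
  obtain ⟨D, hD⟩ := hK.exists_bound_of_continuousOn (f := fderiv ℝ W)
    fun x hx => ((hW x hx).continuousAt_fderiv one_ne_zero).continuousWithinAt
  refine ⟨max 0 (max C D), le_max_left _ _, fun x hx => ⟨(hC x hx).trans (by simp), fun v => ?_⟩⟩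
  exact ((fderiv ℝ W x).le_opNorm v).trans
    (mul_le_mul_of_nonneg_right ((hD x hx).trans (by simp)) (norm_nonneg _))

section IsBddH1

variable {E : Type*} [NormedAddCommGroup E] [NormedSpace ℝ E]
  [MeasurableSpace E] {μ : Measure E} {Ω : Set E} {V W : E → ℝ}

/-- Bounded functions that are differentiable on `Ω` with square integrable derivative. -/
structure IsBddH1 (μ : Measure E) (Ω : Set E) (W : E → ℝ) : Prop where
  differentiableAt : ∀ x ∈ Ω, DifferentiableAt ℝ W x
  bounded : ∃ M, ∀ x ∈ Ω, ‖W x‖ ≤ M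
  memLp_fderiv : ∀ v, MemLp (fun x => fderiv ℝ W x v) 2 (μ.restrict Ω)

namespace IsBddH1

lemma integrableOn_fderiv (hW : IsBddH1 μ Ω W) (hfin : μ Ω ≠ ⊤) (v : E) :
    IntegrableOn (fun x => fderiv ℝ W x v) Ω μ := by
  have : IsFiniteMeasure (μ.restrict Ω) := ⟨by simpa using hfin.lt_top⟩
  exact (hW.memLp_fderiv v).integrable one_le_two

lemma zero : IsBddH1 μ Ω (fun _ => 0) where
  differentiableAt x _ := differentiableAt_const _
  bounded := ⟨0, by simp⟩
  memLp_fderiv v := by simp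

variable [BorelSpace E]

lemma aestronglyMeasurable (hW : IsBddH1 μ Ω W) (hΩ : IsOpen Ω) :
    AEStronglyMeasurable W (μ.restrict Ω) :=
  ContinuousOn.aestronglyMeasurable
    (fun x hx => (hW.differentiableAt x hx).continuousAt.continuousWithinAt) hΩ.measurableSet

lemma memLp_mul (hW : IsBddH1 μ Ω W) (hΩ : IsOpen Ω) {F : E → ℝ}
    (hF : MemLp F 2 (μ.restrict Ω)) : MemLp (fun x => W x * F x) 2 (μ.restrict Ω) := by
  obtain ⟨M, hM⟩ := hW.bounded
  refine hF.of_le_mul (c := M) ((hW.aestronglyMeasurable hΩ).mul hF.1) ?_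
  filter_upwards [ae_restrict_mem hΩ.measurableSet] with x hx
  rw [norm_mul]
  exact mul_le_mul_of_nonneg_right (hM x hx) (norm_nonneg _)

lemma memLp (hW : IsBddH1 μ Ω W) (hΩ : IsOpen Ω) (hfin : μ Ω ≠ ⊤) (p : ENNReal) :
    MemLp W p (μ.restrict Ω) := by
  have : IsFiniteMeasure (μ.restrict Ω) := ⟨by simpa using hfin.lt_top⟩
  obtain ⟨M, hM⟩ := hW.bounded
  exact MemLp.of_bound (hW.aestronglyMeasurable hΩ) M
    ((ae_restrict_mem hΩ.measurableSet).mono hM)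

lemma mul (hV : IsBddH1 μ Ω V) (hW : IsBddH1 μ Ω W) (hΩ : IsOpen Ω) :
    IsBddH1 μ Ω (fun x => V x * W x) where
  differentiableAt x hx := (hV.differentiableAt x hx).mul (hW.differentiableAt x hx)
  bounded := by
    obtain ⟨M, hM⟩ := hV.bounded
    obtain ⟨N, hN⟩ := hW.bounded
    refine ⟨M * N, fun x hx => ?_⟩
    rw [norm_mul]
    exact mul_le_mul (hM x hx) (hN x hx) (norm_nonneg _) ((norm_nonneg _).trans (hM x hx))
  memLp_fderiv v := by
    refine ((hV.memLp_mul hΩ (hW.memLp_fderiv v)).add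
      (hW.memLp_mul hΩ (hV.memLp_fderiv v))).ae_eq ?_
    filter_upwards [ae_restrict_mem hΩ.measurableSet] with x hx
    rw [fderiv_fun_mul (hV.differentiableAt x hx) (hW.differentiableAt x hx)]
    simp

lemma add (hV : IsBddH1 μ Ω V) (hW : IsBddH1 μ Ω W) (hΩ : IsOpen Ω) :
    IsBddH1 μ Ω (fun x => V x + W x) where
  differentiableAt x hx := (hV.differentiableAt x hx).add (hW.differentiableAt x hx)
  bounded := by
    obtain ⟨M, hM⟩ := hV.bounded
    obtain ⟨N, hN⟩ := hW.bounded
    exact ⟨M + N, fun x hx => (norm_add_le _ _).trans (add_le_add (hM x hx) (hN x hx))⟩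
  memLp_fderiv v := by
    refine ((hV.memLp_fderiv v).add (hW.memLp_fderiv v)).ae_eq ?_
    filter_upwards [ae_restrict_mem hΩ.measurableSet] with x hx
    rw [fderiv_fun_add (hV.differentiableAt x hx) (hW.differentiableAt x hx)]
    simp

lemma sum {ι : Type*} (s : Finset ι) {W : ι → E → ℝ} (hW : ∀ i ∈ s, IsBddH1 μ Ω (W i))
    (hΩ : IsOpen Ω) : IsBddH1 μ Ω (fun x => ∑ i ∈ s, W i x) := by
  classical
  induction s using Finset.induction_on with
  | empty => simpa using zero
  | insert a s ha ih =>
    simp only [Finset.sum_insert ha]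
    exact (hW a (by simp)).add (ih fun i hi => hW i (by simp [hi])) hΩ

lemma comp (hW : IsBddH1 μ Ω W) (hΩ : IsOpen Ω) {ρ ρ' : ℝ → ℝ}
    (hρ : ∀ s, HasDerivAt ρ (ρ' s) s) (hρ' : Continuous ρ') :
    IsBddH1 μ Ω (fun x => ρ (W x)) := by
  obtain ⟨M, hM⟩ := hW.bounded
  have hmem : ∀ x ∈ Ω, W x ∈ Metric.closedBall (0 : ℝ) M := fun x hx => by simpa using hM x hx
  have hρc : Continuous ρ := continuous_iff_continuousAt.2 fun s => (hρ s).continuousAt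
  obtain ⟨C, hC⟩ := (isCompact_closedBall (0 : ℝ) M).exists_bound_of_continuousOn hρc.continuousOn
  obtain ⟨D, hD⟩ := (isCompact_closedBall (0 : ℝ) M).exists_bound_of_continuousOn hρ'.continuousOn
  refine ⟨fun x hx => (hρ _).differentiableAt.comp x (hW.differentiableAt x hx),
    ⟨C, fun x hx => hC _ (hmem x hx)⟩, fun v => ?_⟩
  have h : MemLp (fun x => ρ' (W x) * fderiv ℝ W x v) 2 (μ.restrict Ω) := by
    refine (hW.memLp_fderiv v).of_le_mul (c := D)
      ((hρ'.comp_aestronglyMeasurable (hW.aestronglyMeasurable hΩ)).mul (hW.memLp_fderiv v).1) ?_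
    filter_upwards [ae_restrict_mem hΩ.measurableSet] with x hx
    rw [norm_mul]
    exact mul_le_mul_of_nonneg_right (hD _ (hmem x hx)) (norm_nonneg _)
  refine h.ae_eq ?_
  filter_upwards [ae_restrict_mem hΩ.measurableSet] with x hx
  have := (hρ (W x)).comp_hasFDerivAt x (hW.differentiableAt x hx).hasFDerivAt
  simp only [Function.comp_def] at this
  simp [this.fderiv]

end IsBddH1

lemma IsBddH1.of_contDiffAt [BorelSpace E] (hΩ : IsOpen Ω) (hK : IsCompact (closure Ω))
    (hfin : μ Ω ≠ ⊤) (hW : ∀ x ∈ closure Ω, ContDiffAt ℝ 1 W x) : IsBddH1 μ Ω W := by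
  have : IsFiniteMeasure (μ.restrict Ω) := ⟨by simpa using hfin.lt_top⟩
  obtain ⟨M, -, hM⟩ := exists_bound_of_contDiffAt hK hW
  refine ⟨fun x hx => (hW x (subset_closure hx)).differentiableAt one_ne_zero,
    ⟨M, fun x hx => (hM x (subset_closure hx)).1⟩, fun v => ?_⟩
  refine MemLp.of_bound (measurable_fderiv_apply_const ℝ W v).aestronglyMeasurable (M * ‖v‖) ?_
  filter_upwards [ae_restrict_mem hΩ.measurableSet] with x hx
  exact (hM x (subset_closure hx)).2 v

end IsBddH1

/-- The partial derivative in the `i`-th coordinate direction. -/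
noncomputable abbrev pderiv3 (i : Fin 3) (W : (Fin 3 → ℝ) → ℝ) (x : Fin 3 → ℝ) : ℝ :=
  fderiv ℝ W x (Pi.single i 1)

section Pderiv

variable {V W : (Fin 3 → ℝ) → ℝ} {x : Fin 3 → ℝ}

lemma pderiv3_mul (hV : DifferentiableAt ℝ V x) (hW : DifferentiableAt ℝ W x) (i : Fin 3) :
    pderiv3 i (fun y => V y * W y) x = V x * pderiv3 i W x + W x * pderiv3 i V x := by
  simp [pderiv3, fderiv_fun_mul hV hW]

lemma pderiv3_sum {ι : Type*} {s : Finset ι} {W : ι → (Fin 3 → ℝ) → ℝ}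
    (hW : ∀ j ∈ s, DifferentiableAt ℝ (W j) x) (i : Fin 3) :
    pderiv3 i (fun y => ∑ j ∈ s, W j y) x = ∑ j ∈ s, pderiv3 i (W j) x := by
  simp [pderiv3, fderiv_fun_sum hW]

lemma pderiv3_comp (hW : DifferentiableAt ℝ W x) {ρ : ℝ → ℝ} {r : ℝ}
    (hρ : HasDerivAt ρ r (W x)) (i : Fin 3) :
    pderiv3 i (fun y => ρ (W y)) x = r * pderiv3 i W x := by
  have := hρ.comp_hasFDerivAt x hW.hasFDerivAt
  simp only [Function.comp_def] at this
  simp [pderiv3, this.fderiv]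

end Pderiv

section Energy

variable {Ω S : Set (Fin 3 → ℝ)} {W V : (Fin 3 → ℝ) → ℝ}

lemma IsBddH1.integral_pderiv3_eq_zero (hW : IsBddH1 volume Ω W) (hΩ : IsOpen Ω)
    (hfin : volume Ω ≠ ⊤) (hS : IsCompact S) (hSΩ : S ⊆ Ω) (h0 : ∀ x ∈ Ω, x ∉ S → W x = 0)
    (i : Fin 3) : ∫ x in Ω, pderiv3 i W x = 0 :=
  setIntegral_fderiv_eq_zero hΩ hS hSΩ hW.differentiableAt h0 _ (hW.integrableOn_fderiv hfin _)

lemma IsBddH1.integrableOn_pderiv3_mul (hV : IsBddH1 volume Ω V) (hW : IsBddH1 volume Ω W)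
    (i j : Fin 3) : IntegrableOn (fun x => pderiv3 i V x * pderiv3 j W x) Ω :=
  (hV.memLp_fderiv _).integrable_mul (hW.memLp_fderiv _)

/-- The divergence identities behind the Korn inequality, localised by a cutoff that is a function
of a defining function of the domain. -/
lemma setIntegral_cutoff_energy_eq_zero (hΩ : IsOpen Ω) (hfin : volume Ω ≠ ⊤) (hS : IsCompact S)
    (hSΩ : S ⊆ Ω) {v : Fin 3 → (Fin 3 → ℝ) → ℝ} (hv : ∀ i, IsBddH1 volume Ω (v i))
    (hdiv : ∀ x ∈ Ω, ∑ i, pderiv3 i (v i) x = 0) {f : (Fin 3 → ℝ) → ℝ}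
    (hf : IsBddH1 volume Ω f) (hf' : ∀ i, IsBddH1 volume Ω (pderiv3 i f))
    {p : Fin 3 → Fin 3 → Fin 3 → (Fin 3 → ℝ) → ℝ} (hp : ∀ i j l, IsBddH1 volume Ω (p i j l))
    {θ θ' z z' : ℝ → ℝ} (hθ : ∀ s, HasDerivAt θ (θ' s) s) (hθ' : Continuous θ')
    (hz : ∀ s, HasDerivAt z (z' s) s) (hz' : Continuous z') (hzθ : ∀ s, z s = 2 * θ s * θ' s)
    (h0 : ∀ x ∈ Ω, x ∉ S → θ (f x) = 0)
    (hpf : ∀ x ∈ Ω, z (f x) ≠ 0 → ∀ i j, ∑ l, p i j l x * pderiv3 l f x =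
      pderiv3 j (pderiv3 i f) x) :
    ∫ x in Ω, (θ (f x) ^ 2 * ∑ i, ∑ j, pderiv3 i (v j) x * pderiv3 j (v i) x
      - z' (f x) * (∑ i, v i x * pderiv3 i f x) ^ 2
      + θ (f x) ^ 2 * ∑ i, ∑ j, ∑ l, pderiv3 l (fun y => v i y * v j y * p i j l y) x) = 0 := by
  have hη := hf.comp hΩ hθ hθ'
  have hζ := hf.comp hΩ hz hz'
  have hg : IsBddH1 volume Ω (fun x => ∑ i, v i x * pderiv3 i f x) :=
    IsBddH1.sum _ (fun i _ => (hv i).mul (hf' i) hΩ) hΩ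
  have ha := fun i => hη.mul (hv i) hΩ
  have hb := fun j => (hζ.mul hg hΩ).mul (hv j) hΩ
  have hc0 := fun i j l => ((hv i).mul (hv j) hΩ).mul (hp i j l) hΩ
  have hc := fun i j l => (hη.mul hη hΩ).mul (hc0 i j l) hΩ
  have ha0 : ∀ i, ∀ x ∈ Ω, x ∉ S → θ (f x) * v i x = 0 := fun i x hx hxS => by
    simp [h0 x hx hxS]
  have i1 : ∀ i j, IntegrableOn (fun x => pderiv3 i (fun y => θ (f y) * v j y) x *
      pderiv3 j (fun y => θ (f y) * v i y) x - pderiv3 j (fun y => θ (f y) * v j y) x *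
      pderiv3 i (fun y => θ (f y) * v i y) x) Ω := fun i j =>
    ((ha j).integrableOn_pderiv3_mul (ha i) i j).sub
      ((ha j).integrableOn_pderiv3_mul (ha i) j i)
  have i2 := fun j => (hb j).integrableOn_fderiv hfin (Pi.single j 1)
  have i3 := fun i j l => (hc i j l).integrableOn_fderiv hfin (Pi.single l 1)
  have e1 := fun i j => integral_sub ((ha j).integrableOn_pderiv3_mul (ha i) i j)
    ((ha j).integrableOn_pderiv3_mul (ha i) j i)
  have e1' : ∀ i j, ∫ x in Ω, (pderiv3 i (fun y => θ (f y) * v j y) x *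
      pderiv3 j (fun y => θ (f y) * v i y) x - pderiv3 j (fun y => θ (f y) * v j y) x *
      pderiv3 i (fun y => θ (f y) * v i y) x) = 0 := fun i j => by
    rw [e1, sub_eq_zero]
    exact setIntegral_fderiv_mul_fderiv_comm hΩ hS hSΩ (ha j).differentiableAt
      (ha i).differentiableAt (ha0 j) (ha0 i) _ _ ((ha j).memLp_fderiv _)
      ((ha j).memLp_fderiv _) ((ha i).memLp_fderiv _) ((ha i).memLp_fderiv _)
  have e2 := fun j => (hb j).integral_pderiv3_eq_zero hΩ hfin hS hSΩ
    (fun x hx hxS => by simp [hzθ, h0 x hx hxS]) j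
  have e3 := fun i j l => (hc i j l).integral_pderiv3_eq_zero hΩ hfin hS hSΩ
    (fun x hx hxS => by simp [h0 x hx hxS]) l
  have I1 := integrable_finsetSum Finset.univ fun i _ =>
    integrable_finsetSum Finset.univ fun j _ => i1 i j
  have I2 := integrable_finsetSum Finset.univ fun j _ => i2 j
  have I3 := integrable_finsetSum Finset.univ fun i _ =>
    integrable_finsetSum Finset.univ fun j _ => integrable_finsetSum Finset.univ fun l _ => i3 i j l
  have E1 : ∫ x in Ω, (∑ i, ∑ j, (pderiv3 i (fun y => θ (f y) * v j y) x *
      pderiv3 j (fun y => θ (f y) * v i y) x - pderiv3 j (fun y => θ (f y) * v j y) x *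
      pderiv3 i (fun y => θ (f y) * v i y) x)) = 0 := by
    rw [integral_finsetSum _ fun i _ => integrable_finsetSum Finset.univ fun j _ => i1 i j]
    refine Finset.sum_eq_zero fun i _ => ?_
    rw [integral_finsetSum _ fun j _ => i1 i j]
    exact Finset.sum_eq_zero fun j _ => e1' i j
  have E2 := (integral_finsetSum Finset.univ fun j _ => i2 j).trans
    (Finset.sum_eq_zero fun j _ => e2 j)
  have E3 : ∫ x in Ω, (∑ i, ∑ j, ∑ l, pderiv3 l
      (fun y => θ (f y) * θ (f y) * (v i y * v j y * p i j l y)) x) = 0 := by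
    rw [integral_finsetSum _ fun i _ => integrable_finsetSum Finset.univ fun j _ =>
      integrable_finsetSum Finset.univ fun l _ => i3 i j l]
    refine Finset.sum_eq_zero fun i _ => ?_
    rw [integral_finsetSum _ fun j _ => integrable_finsetSum Finset.univ fun l _ => i3 i j l]
    refine Finset.sum_eq_zero fun j _ => ?_
    rw [integral_finsetSum _ fun l _ => i3 i j l]
    exact Finset.sum_eq_zero fun l _ => e3 i j l
  have key := (integral_add (I1.sub I2) I3).trans
    (congrArg₂ (· + ·) ((integral_sub I1 I2).trans (congrArg₂ (· - ·) E1 E2)) E3)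
  rw [sub_zero, add_zero] at key
  rw [← key]
  refine setIntegral_congr_fun hΩ.measurableSet fun x hx => ?_
  have dv := fun i => (hv i).differentiableAt x hx
  have df' := fun i => (hf' i).differentiableAt x hx
  have df := hf.differentiableAt x hx
  have dη := hη.differentiableAt x hx
  have dζ := hζ.differentiableAt x hx
  have P1 : ∀ i j, pderiv3 i (fun y => θ (f y) * v j y) x =
      θ (f x) * pderiv3 i (v j) x + v j x * (θ' (f x) * pderiv3 i f x) := fun i j => by
    rw [pderiv3_mul dη (dv j), pderiv3_comp df (hθ _)]
  have P2 : ∀ j, pderiv3 j (fun y => ∑ i, v i y * pderiv3 i f y) x =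
      ∑ i, (v i x * pderiv3 j (pderiv3 i f) x + pderiv3 i f x * pderiv3 j (v i) x) := fun j => by
    rw [pderiv3_sum (fun i _ => (dv i).fun_mul (df' i))]
    exact Finset.sum_congr rfl fun i _ => pderiv3_mul (dv i) (df' i) j
  have P3 : ∀ j, pderiv3 j (fun y => z (f y) * (∑ i, v i y * pderiv3 i f y) * v j y) x =
      z (f x) * (∑ i, v i x * pderiv3 i f x) * pderiv3 j (v j) x + v j x *
        (z (f x) * (∑ i, (v i x * pderiv3 j (pderiv3 i f) x + pderiv3 i f x * pderiv3 j (v i) x))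
          + (∑ i, v i x * pderiv3 i f x) * (z' (f x) * pderiv3 j f x)) := fun j => by
    rw [pderiv3_mul (dζ.fun_mul (hg.differentiableAt x hx)) (dv j),
      pderiv3_mul dζ (hg.differentiableAt x hx), P2, pderiv3_comp df (hz _)]
  have P4 : ∀ i j l, pderiv3 l (fun y => θ (f y) * θ (f y) * (v i y * v j y * p i j l y)) x =
      θ (f x) ^ 2 * pderiv3 l (fun y => v i y * v j y * p i j l y) x +
        v i x * v j x * z (f x) * (p i j l x * pderiv3 l f x) := fun i j l => by
    rw [pderiv3_mul (dη.fun_mul dη) ((hc0 i j l).differentiableAt x hx), pderiv3_mul dη dη,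
      pderiv3_comp df (hθ _), hzθ]
    ring
  have P5 : (∑ i, ∑ j, ∑ l, pderiv3 l
      (fun y => θ (f y) * θ (f y) * (v i y * v j y * p i j l y)) x) =
      θ (f x) ^ 2 * (∑ i, ∑ j, ∑ l, pderiv3 l (fun y => v i y * v j y * p i j l y) x) +
      ∑ i, ∑ j, v i x * v j x * z (f x) * pderiv3 j (pderiv3 i f) x := by
    simp only [P4, Finset.sum_add_distrib, ← Finset.mul_sum]
    congr 1
    refine Finset.sum_congr rfl fun i _ => Finset.sum_congr rfl fun j _ => ?_
    by_cases h : z (f x) = 0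
    · simp [h]
    · rw [hpf x hx h]
  have hd := hdiv x hx
  simp only [Pi.sub_apply]
  simp only [P1, P3]
  rw [P5]
  generalize (∑ i, ∑ j, ∑ l, pderiv3 l (fun y => v i y * v j y * p i j l y) x) = D
  generalize hdd : (fun i j => pderiv3 i (v j) x) = d
  generalize hhh : (fun i j => pderiv3 j (pderiv3 i f) x) = h
  generalize hpp : (fun i => pderiv3 i f x) = q
  generalize hvv : (fun i => v i x) = w
  simp only [show ∀ i j, pderiv3 i (v j) x = d i j from fun i j => by rw [← hdd],
    show ∀ i j, pderiv3 j (pderiv3 i f) x = h i j from fun i j => by rw [← hhh],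
    show ∀ i, pderiv3 i f x = q i from fun i => by rw [← hpp],
    show ∀ i, v i x = w i from fun i => by rw [← hvv], hzθ] at hd ⊢
  simp only [Fin.sum_univ_three] at hd ⊢
  linear_combination (θ (f x) ^ 2 * (d 0 0 + d 1 1 + d 2 2) +
    4 * θ (f x) * θ' (f x) * (w 0 * q 0 + w 1 * q 1 + w 2 * q 2)) * hd

end Energy

lemma hasDerivAt_max_sub_zero_sq (δ s : ℝ) :
    HasDerivAt (fun t => max (t - δ) 0 ^ 2) (2 * max (s - δ) 0) s := by
  rw [hasDerivAt_iff_isLittleO]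
  refine Asymptotics.IsBigO.trans_isLittleO (g := fun t => (t - s) ^ 2) ?_
    (by simpa using Asymptotics.isLittleO_pow_sub_sub s one_lt_two)
  refine Asymptotics.IsBigO.of_bound 1 (Filter.Eventually.of_forall fun t => ?_)
  rw [Real.norm_eq_abs, Real.norm_eq_abs, abs_of_nonneg (sq_nonneg (t - s)), abs_le, smul_eq_mul]
  rcases max_cases (t - δ) 0 with ⟨h, h'⟩ | ⟨h, h'⟩ <;>
    rcases max_cases (s - δ) 0 with ⟨k, k'⟩ | ⟨k, k'⟩ <;> rw [h, k] <;>
    constructor <;> nlinarith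

lemma integrable_of_tendsto_of_integral_le {α : Type*} [MeasurableSpace α] {μ : Measure α}
    {F : ℕ → α → ℝ} {G : α → ℝ} {B : ℝ} (hF : ∀ n, Integrable (F n) μ)
    (hF0 : ∀ n, ∀ᵐ x ∂μ, 0 ≤ F n x) (hB : ∀ n, ∫ x, F n x ∂μ ≤ B)
    (hlim : ∀ᵐ x ∂μ, Filter.Tendsto (fun n => F n x) Filter.atTop (nhds (G x))) :
    Integrable G μ := by
  refine ⟨aestronglyMeasurable_of_tendsto_ae _ (fun n => (hF n).1) hlim, ?_⟩
  have hG : ∫⁻ x, ‖G x‖ₑ ∂μ = ∫⁻ x, Filter.liminf (fun n => ‖F n x‖ₑ) Filter.atTop ∂μ :=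
    lintegral_congr_ae (hlim.mono fun x hx => hx.enorm.liminf_eq.symm)
  rw [HasFiniteIntegral, hG]
  refine (lintegral_liminf_le' fun n => (hF n).1.aemeasurable.enorm).trans_lt ?_
  refine (Filter.liminf_le_of_le (a := ENNReal.ofReal B) (by isBoundedDefault)
    fun b hb => ?_).trans_lt ENNReal.ofReal_lt_top
  obtain ⟨n, hn⟩ := hb.exists
  refine hn.trans ?_
  have : ∫⁻ x, ‖F n x‖ₑ ∂μ = ∫⁻ x, ENNReal.ofReal (F n x) ∂μ :=
    lintegral_congr_ae ((hF0 n).mono fun x hx => by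
      simp only [Real.enorm_eq_ofReal hx])
  rw [this, ← ofReal_integral_eq_lintegral_ofReal (hF n) (hF0 n)]
  exact ENNReal.ofReal_le_ofReal (hB n)

section Hardy

variable {Ω : Set (Fin 3 → ℝ)} {f g : (Fin 3 → ℝ) → ℝ} {m : ℝ}

lemma contDiff_pderiv3 (hf : ContDiff ℝ (⊤ : ℕ∞) f) (i : Fin 3) :
    ContDiff ℝ (⊤ : ℕ∞) (pderiv3 i f) :=
  (hf.fderiv_right (m := (⊤ : ℕ∞)) (by simp)).clm_apply contDiff_const

lemma hardy_pointwise {ψ h L m : ℝ} {a b d : Fin 3 → ℝ} (hm : 0 < m) (hψ : 0 ≤ ψ)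
    (hL : |∑ i, d i| ≤ L) (hq : m ≤ ∑ i, b i ^ 2 ∨ ψ ≤ 1 / m) :
    h ^ 2 * ψ ^ 2 * ∑ i, b i ^ 2 ≤
      4 * ((∑ i, (h ^ 2 * (ψ * d i + b i * (ψ ^ 2 * b i)) + ψ * b i * (2 * h * a i))) +
        2 * ∑ i, a i ^ 2 + (L ^ 2 / m + L / m) * h ^ 2) := by
  have hL0 : 0 ≤ L := (abs_nonneg _).trans hL
  have key : ψ * L ≤ ψ ^ 2 * (∑ i, b i ^ 2) / 4 + (L ^ 2 / m + L / m) := by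
    have h1 : 0 ≤ ∑ i, b i ^ 2 := Finset.sum_nonneg fun i _ => sq_nonneg _
    rcases hq with hq | hq
    · have h2 : ψ ^ 2 * m ≤ ψ ^ 2 * ∑ i, b i ^ 2 := mul_le_mul_of_nonneg_left hq (sq_nonneg _)
      have h3 : ψ * L ≤ ψ ^ 2 * m / 4 + L ^ 2 / m := by
        rw [← sub_nonneg]
        have : ψ ^ 2 * m / 4 + L ^ 2 / m - ψ * L = (ψ * m / 2 - L) ^ 2 / m := by
          field_simp; ring
        rw [this]; positivity
      have : 0 ≤ L / m := by positivity
      linarith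
    · have h2 : ψ * L ≤ 1 / m * L := mul_le_mul_of_nonneg_right hq hL0
      have : 0 ≤ L ^ 2 / m := by positivity
      have h4 : 1 / m * L = L / m := by ring
      nlinarith [mul_nonneg (sq_nonneg ψ) h1]
  have key2 := mul_le_mul_of_nonneg_left key (sq_nonneg h)
  have hd := mul_le_mul_of_nonneg_left (neg_le_of_abs_le hL) (mul_nonneg (sq_nonneg h) hψ)
  generalize L ^ 2 / m + L / m = C at *
  simp only [Fin.sum_univ_three] at *
  nlinarith [sq_nonneg (h * ψ * b 0 + 2 * a 0), sq_nonneg (h * ψ * b 1 + 2 * a 1),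
    sq_nonneg (h * ψ * b 2 + 2 * a 2)]

lemma integrableOn_hardy_max (hΩ : IsOpen Ω) (hK : IsCompact (closure Ω)) (hfin : volume Ω ≠ ⊤)
    (hf : ContDiff ℝ (⊤ : ℕ∞) f) (hneg : ∀ x ∈ Ω, f x < 0) (hm : 0 < m)
    (hq : ∀ x ∈ Ω, -f x ≤ m → m ≤ ∑ l, pderiv3 l f x ^ 2) (hg : IsBddH1 volume Ω g)
    (hgc : ContinuousOn g (closure Ω)) (hg0 : ∀ x ∈ frontier Ω, g x = 0) :
    IntegrableOn (fun x => max (g x) 0 ^ 2 * ((-f x)⁻¹ ^ 2 * ∑ l, pderiv3 l f x ^ 2)) Ω := by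
  have hcl : ∀ x ∈ closure Ω, f x ≤ 0 := fun x hx =>
    closure_minimal (fun y hy => (hneg y hy).le) (isClosed_le hf.continuous continuous_const) hx
  have hpc := fun i => contDiff_pderiv3 hf i
  have hppc := fun i j => contDiff_pderiv3 (hpc i) j
  obtain ⟨L, hL⟩ := hK.exists_bound_of_continuousOn
    (f := fun x => ∑ i, pderiv3 i (pderiv3 i f) x)
    (continuous_finsetSum _ fun i _ => (hppc i i).continuous).continuousOn
  set C := L ^ 2 / m + L / m
  set B : ℝ := ∫ x in Ω, 4 * (2 * ∑ i, pderiv3 i g x ^ 2 + C * g x ^ 2)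
  set e : ℕ → ℝ := fun n => 1 / ((n : ℝ) + 1)
  have he : ∀ n, 0 < e n := fun n => by positivity
  have helim : Filter.Tendsto e Filter.atTop (nhds 0) := tendsto_one_div_add_atTop_nhds_zero_nat
  set F : ℕ → (Fin 3 → ℝ) → ℝ := fun n x =>
    max (g x - e n) 0 ^ 2 * ((e n - f x)⁻¹ ^ 2 * ∑ l, pderiv3 l f x ^ 2)
  set W : ℕ → Fin 3 → (Fin 3 → ℝ) → ℝ := fun n i x =>
    max (g x - e n) 0 ^ 2 * ((e n - f x)⁻¹ * pderiv3 i f x)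
  have hpos : ∀ n, ∀ x ∈ closure Ω, 0 < e n - f x := fun n x hx => by
    linarith [hcl x hx, he n]
  have hψ : ∀ n, ∀ x ∈ closure Ω, ContDiffAt ℝ 1 (fun x => (e n - f x)⁻¹) x := fun n x hx =>
    (contDiffAt_const.sub (hf.contDiffAt.of_le (by simp))).inv (hpos n x hx).ne'
  have hψp : ∀ n i, IsBddH1 volume Ω (fun x => (e n - f x)⁻¹ * pderiv3 i f x) := fun n i =>
    IsBddH1.of_contDiffAt hΩ hK hfin fun x hx =>
      (hψ n x hx).mul ((hpc i).contDiffAt.of_le (by simp))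
  have hh : ∀ n, IsBddH1 volume Ω (fun x => max (g x - e n) 0 ^ 2) := fun n =>
    hg.comp hΩ (fun s => hasDerivAt_max_sub_zero_sq (e n) s) (by fun_prop)
  have hW : ∀ n i, IsBddH1 volume Ω (W n i) := fun n i => (hh n).mul (hψp n i) hΩ
  have hWint : ∀ n i, ∫ x in Ω, pderiv3 i (W n i) x = 0 := fun n i => by
    refine (hW n i).integral_pderiv3_eq_zero hΩ hfin (S := closure Ω ∩ g ⁻¹' Set.Ici (e n))
      ?_ ?_ ?_ i
    · exact hK.of_isClosed_subset (hgc.preimage_isClosed_of_isClosed isClosed_closure isClosed_Ici)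
        Set.inter_subset_left
    · rintro x ⟨hx, hx'⟩
      by_contra hxΩ
      have : g x = 0 := hg0 x ⟨hx, by rwa [hΩ.interior_eq]⟩
      rw [Set.mem_preimage, this] at hx'
      exact (he n).not_ge hx'
    · intro x hx hxS
      have : g x < e n := by
        by_contra! h
        exact hxS ⟨subset_closure hx, h⟩
      simp only [W]
      rw [max_eq_right (by linarith)]
      simp
  have hWi : ∀ n, IntegrableOn (fun x => ∑ i, pderiv3 i (W n i) x) Ω := fun n =>
    integrable_finsetSum _ fun i _ => (hW n i).integrableOn_fderiv hfin _
  have hWsum : ∀ n, ∫ x in Ω, ∑ i, pderiv3 i (W n i) x = 0 := fun n =>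
    (integral_finsetSum Finset.univ fun i _ =>
      (hW n i).integrableOn_fderiv hfin (Pi.single i 1)).trans
      (Finset.sum_eq_zero fun i _ => hWint n i)
  have hgi : IntegrableOn (fun x => 2 * ∑ i, pderiv3 i g x ^ 2 + C * g x ^ 2) Ω :=
    ((integrable_finsetSum _ fun i _ => (hg.memLp_fderiv _).integrable_sq).const_mul _).add
      ((hg.memLp hΩ hfin 2).integrable_sq.const_mul _)
  have hL0 : ∀ x ∈ Ω, 0 ≤ C := fun x hx => by
    have := (norm_nonneg _).trans (hL x (subset_closure hx))
    positivity
  have hFle : ∀ n, ∀ x ∈ Ω, F n x ≤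
      4 * ((∑ i, pderiv3 i (W n i) x) + (2 * ∑ i, pderiv3 i g x ^ 2 + C * g x ^ 2)) := by
    intro n x hx
    have hxc := subset_closure hx
    have hpn := hpos n x hxc
    have dψ : ∀ i, pderiv3 i (fun x => (e n - f x)⁻¹) x = (e n - f x)⁻¹ ^ 2 * pderiv3 i f x := by
      intro i
      have hd : HasDerivAt (fun s => (e n - s)⁻¹) ((e n - f x)⁻¹ ^ 2) (f x) := by
        have := ((hasDerivAt_id (f x)).const_sub (e n)).fun_inv hpn.ne'
        simpa using this
      exact pderiv3_comp (hf.differentiable (by simp)).differentiableAt hd i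
    have dW : ∀ i, pderiv3 i (W n i) x = max (g x - e n) 0 ^ 2 *
        ((e n - f x)⁻¹ * pderiv3 i (pderiv3 i f) x +
          pderiv3 i f x * ((e n - f x)⁻¹ ^ 2 * pderiv3 i f x)) +
        (e n - f x)⁻¹ * pderiv3 i f x * (2 * max (g x - e n) 0 * pderiv3 i g x) := by
      intro i
      rw [pderiv3_mul ((hh n).differentiableAt x hx) ((hψp n i).differentiableAt x hx),
        pderiv3_comp (hg.differentiableAt x hx) (hasDerivAt_max_sub_zero_sq (e n) (g x)),
        pderiv3_mul ((hψ n x hxc).differentiableAt one_ne_zero)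
          ((hpc i).differentiable (by simp)).differentiableAt, dψ]
    have key := hardy_pointwise (h := max (g x - e n) 0) (a := fun i => pderiv3 i g x)
      (b := fun i => pderiv3 i f x) (d := fun i => pderiv3 i (pderiv3 i f) x) hm
      (inv_pos.2 hpn).le (hL x hxc) (by
        by_cases h : -f x ≤ m
        · exact Or.inl (hq x hx h)
        · right
          rw [inv_eq_one_div]
          exact one_div_le_one_div_of_le hm (by linarith [he n]))
    have hle : max (g x - e n) 0 ^ 2 ≤ g x ^ 2 := by
      rcases max_cases (g x - e n) 0 with ⟨h, h'⟩ | ⟨h, h'⟩ <;> rw [h]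
      · nlinarith [he n]
      · simpa using sq_nonneg (g x)
    simp only [F, dW]
    have := mul_le_mul_of_nonneg_left hle (hL0 x hx)
    simp only [C] at this ⊢
    linarith
  have hF0 : ∀ n x, 0 ≤ F n x := fun n x => by positivity
  have hdom : ∀ n, IntegrableOn (fun x =>
      4 * ((∑ i, pderiv3 i (W n i) x) + (2 * ∑ i, pderiv3 i g x ^ 2 + C * g x ^ 2))) Ω :=
    fun n => ((hWi n).add hgi).const_mul 4
  have hFi : ∀ n, IntegrableOn (F n) Ω := by
    intro n
    refine (hdom n).mono' ?_ ?_
    · refine ContinuousOn.aestronglyMeasurable ?_ hΩ.measurableSet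
      refine ContinuousOn.mul (fun x hx =>
        ((hh n).differentiableAt x hx).continuousAt.continuousWithinAt) (ContinuousOn.mul ?_ ?_)
      · exact ContinuousOn.pow (fun x hx =>
          (hψ n x (subset_closure hx)).continuousAt.continuousWithinAt) 2
      · exact (continuous_finsetSum _ fun i _ => (hpc i).continuous.pow 2).continuousOn
    · filter_upwards [ae_restrict_mem hΩ.measurableSet] with x hx
      rw [Real.norm_eq_abs, abs_of_nonneg (hF0 n x)]
      exact hFle n x hx
  refine integrable_of_tendsto_of_integral_le (B := B) hFi
    (fun n => Filter.Eventually.of_forall (hF0 n)) (fun n => ?_) ?_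
  · refine (setIntegral_mono_on (hFi n) (hdom n) hΩ.measurableSet (hFle n)).trans_eq ?_
    rw [integral_const_mul, integral_add (hWi n) hgi, hWsum, zero_add, ← integral_const_mul]
  · filter_upwards [ae_restrict_mem hΩ.measurableSet] with x hx
    have h1 : Filter.Tendsto (fun n => max (g x - e n) 0 ^ 2) Filter.atTop
        (nhds (max (g x - 0) 0 ^ 2)) := ((helim.const_sub _).max tendsto_const_nhds).pow 2
    have h2 : Filter.Tendsto (fun n => (e n - f x)⁻¹) Filter.atTop (nhds (0 - f x)⁻¹) :=
      (helim.sub_const _).inv₀ (by linarith [hneg x hx])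
    simpa [F] using h1.mul ((h2.pow 2).mul_const (∑ l, pderiv3 l f x ^ 2))

/-- A Hardy inequality: functions vanishing on the boundary are controlled by the distance to it,
as measured by the defining function. -/
lemma integrableOn_hardy (hΩ : IsOpen Ω) (hK : IsCompact (closure Ω)) (hfin : volume Ω ≠ ⊤)
    (hf : ContDiff ℝ (⊤ : ℕ∞) f) (hneg : ∀ x ∈ Ω, f x < 0) (hm : 0 < m)
    (hq : ∀ x ∈ Ω, -f x ≤ m → m ≤ ∑ l, pderiv3 l f x ^ 2) (hg : IsBddH1 volume Ω g)
    (hgc : ContinuousOn g (closure Ω)) (hg0 : ∀ x ∈ frontier Ω, g x = 0) :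
    IntegrableOn (fun x => g x ^ 2 * ((-f x)⁻¹ ^ 2 * ∑ l, pderiv3 l f x ^ 2)) Ω := by
  have hg' : IsBddH1 volume Ω (fun x => -g x) :=
    hg.comp hΩ (ρ := fun s => -s) (ρ' := fun _ => -1) (fun s => hasDerivAt_neg s) continuous_const
  refine ((integrableOn_hardy_max hΩ hK hfin hf hneg hm hq hg hgc hg0).add
    (integrableOn_hardy_max hΩ hK hfin hf hneg hm hq hg' hgc.neg
      fun x hx => by simp [hg0 x hx])).congr (Filter.Eventually.of_forall fun x => ?_)
  simp only [Pi.add_apply]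
  rw [← add_mul]
  congr 1
  rcases le_total (g x) 0 with h | h
  · rw [max_eq_right h, max_eq_left (by linarith)]; ring
  · rw [max_eq_left h, max_eq_right (by linarith)]; ring

end Hardy

lemma exists_cutoff_profile : ∃ (σ σ' Z' : ℝ → ℝ) (C : ℝ), (∀ t, HasDerivAt σ (σ' t) t) ∧
    Continuous σ' ∧ (∀ t, HasDerivAt (fun t => 2 * σ t * σ' t) (Z' t) t) ∧ Continuous Z' ∧
    (∀ t ≤ 0, σ t = 0) ∧ (∀ t, 1 ≤ t → σ t = 1) ∧ (∀ t, |σ t| ≤ 1) ∧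
    (∀ t, 2 * σ t * σ' t ≠ 0 → t ∈ Set.Icc (0 : ℝ) 1) ∧
    (∀ t, Z' t ≠ 0 → t ∈ Set.Icc (0 : ℝ) 1) ∧ ∀ t, |Z' t| ≤ C := by
  have h1 : ContDiff ℝ (⊤ : ℕ∞) Real.smoothTransition := Real.smoothTransition.contDiff
  have h2 : ContDiff ℝ (⊤ : ℕ∞) (deriv Real.smoothTransition) :=
    (contDiff_infty_iff_deriv.1 h1).2
  set Z : ℝ → ℝ := fun t => 2 * Real.smoothTransition t * deriv Real.smoothTransition t
  have h3 : ContDiff ℝ (⊤ : ℕ∞) Z := (contDiff_const.mul h1).mul h2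
  have h4 : ContDiff ℝ (⊤ : ℕ∞) (deriv Z) := (contDiff_infty_iff_deriv.1 h3).2
  have hZ : ∀ t, t ∉ Set.Icc (0 : ℝ) 1 → Z t = 0 := by
    intro t ht
    by_cases h : t < 0
    · simp [Z, Real.smoothTransition.zero_of_nonpos h.le]
    · have h1t : 1 < t := by
        by_contra! h'
        exact ht ⟨not_lt.1 h, h'⟩
      have : Real.smoothTransition =ᶠ[nhds t] fun _ => 1 := by
        filter_upwards [lt_mem_nhds h1t] with s hs
        exact Real.smoothTransition.one_of_one_le hs.le
      simp [Z, this.deriv_eq]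
  have hZ' : ∀ t, t ∉ Set.Icc (0 : ℝ) 1 → deriv Z t = 0 := by
    intro t ht
    have : Z =ᶠ[nhds t] fun _ => 0 := by
      filter_upwards [isClosed_Icc.isOpen_compl.mem_nhds ht] with s hs
      exact hZ s hs
    simp [this.deriv_eq]
  obtain ⟨C, hC⟩ := (isCompact_Icc (a := (0 : ℝ)) (b := 1)).exists_bound_of_continuousOn
    h4.continuous.continuousOn
  refine ⟨Real.smoothTransition, deriv Real.smoothTransition, deriv Z, C,
    fun t => (h1.differentiable (by simp)).differentiableAt.hasDerivAt, h2.continuous,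
    fun t => (h3.differentiable (by simp)).differentiableAt.hasDerivAt, h4.continuous,
    fun t ht => Real.smoothTransition.zero_of_nonpos ht,
    fun t ht => Real.smoothTransition.one_of_one_le ht,
    fun t => by rw [abs_of_nonneg (Real.smoothTransition.nonneg t)]
                exact Real.smoothTransition.le_one t,
    fun t => not_imp_comm.1 (hZ t), fun t => not_imp_comm.1 (hZ' t), fun t => ?_⟩
  by_cases ht : t ∈ Set.Icc (0 : ℝ) 1
  · exact hC t ht
  · rw [hZ' t ht, abs_zero]
    exact (norm_nonneg _).trans (hC 0 (by simp))

section Limit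

variable {Ω : Set (Fin 3 → ℝ)} {f : (Fin 3 → ℝ) → ℝ} {m : ℝ}

lemma setIntegral_energy_eq_zero (hΩ : IsOpen Ω) (hK : IsCompact (closure Ω))
    (hfin : volume Ω ≠ ⊤) (hf : ContDiff ℝ (⊤ : ℕ∞) f) (hneg : ∀ x ∈ Ω, f x < 0)
    (hfr : ∀ x ∈ frontier Ω, f x = 0) (hm : 0 < m)
    (hq : ∀ x ∈ Ω, -f x ≤ m → m ≤ ∑ l, pderiv3 l f x ^ 2)
    {v : Fin 3 → (Fin 3 → ℝ) → ℝ} (hv : ∀ i, IsBddH1 volume Ω (v i))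
    (hvc : ∀ i, ContinuousOn (v i) (closure Ω))
    (hdiv : ∀ x ∈ Ω, ∑ i, pderiv3 i (v i) x = 0)
    (htan : ∀ x ∈ frontier Ω, ∑ i, v i x * pderiv3 i f x = 0)
    {p : Fin 3 → Fin 3 → Fin 3 → (Fin 3 → ℝ) → ℝ} (hp : ∀ i j l, IsBddH1 volume Ω (p i j l))
    (hpf : ∀ x ∈ Ω, -f x ≤ m → ∀ i j, ∑ l, p i j l x * pderiv3 l f x =
      pderiv3 j (pderiv3 i f) x) :
    ∫ x in Ω, ((∑ i, ∑ j, pderiv3 i (v j) x * pderiv3 j (v i) x) +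
      ∑ i, ∑ j, ∑ l, pderiv3 l (fun y => v i y * v j y * p i j l y) x) = 0 := by
  obtain ⟨σ, σ', Z', C, hσ, hσ', hZ, hZ', hσ0, hσ1, hσle, hZs, hZs', hC⟩ := exists_cutoff_profile
  have hC0 : 0 ≤ C := (abs_nonneg _).trans (hC 0)
  have hf1 : IsBddH1 volume Ω f :=
    IsBddH1.of_contDiffAt hΩ hK hfin fun x _ => hf.contDiffAt.of_le (by simp)
  have hpc := fun i => contDiff_pderiv3 hf i
  have hpi : ∀ i, IsBddH1 volume Ω (pderiv3 i f) := fun i =>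
    IsBddH1.of_contDiffAt hΩ hK hfin fun x _ => (hpc i).contDiffAt.of_le (by simp)
  have hg : IsBddH1 volume Ω (fun x => ∑ i, v i x * pderiv3 i f x) :=
    IsBddH1.sum _ (fun i _ => (hv i).mul (hpi i) hΩ) hΩ
  have hgc : ContinuousOn (fun x => ∑ i, v i x * pderiv3 i f x) (closure Ω) :=
    continuousOn_finsetSum _ fun i _ => (hvc i).mul (hpc i).continuous.continuousOn
  have hhardy := integrableOn_hardy hΩ hK hfin hf hneg hm hq hg hgc htan
  set T : (Fin 3 → ℝ) → ℝ := fun x => ∑ i, ∑ j, pderiv3 i (v j) x * pderiv3 j (v i) x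
  set D : (Fin 3 → ℝ) → ℝ :=
    fun x => ∑ i, ∑ j, ∑ l, pderiv3 l (fun y => v i y * v j y * p i j l y) x
  set g : (Fin 3 → ℝ) → ℝ := fun x => ∑ i, v i x * pderiv3 i f x
  have hT : IntegrableOn T Ω := integrable_finsetSum _ fun i _ => integrable_finsetSum _ fun j _ =>
    (hv j).integrableOn_pderiv3_mul (hv i) i j
  have hD : IntegrableOn D Ω := integrable_finsetSum _ fun i _ => integrable_finsetSum _ fun j _ =>
    integrable_finsetSum _ fun l _ =>
      (((hv i).mul (hv j) hΩ).mul (hp i j l) hΩ).integrableOn_fderiv hfin _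
  set N : ℕ → ℝ := fun n => (n : ℝ) + 1
  have hN : ∀ n, 0 < N n := fun n => by positivity
  have hNlim : Filter.Tendsto N Filter.atTop Filter.atTop :=
    Filter.tendsto_atTop_add_const_right _ _ tendsto_natCast_atTop_atTop
  set a : ℕ → ℝ → ℝ := fun n s => -N n * s - 1
  have ha : ∀ n s, HasDerivAt (a n) (-N n) s := fun n s => by
    simpa [a] using ((hasDerivAt_id s).const_mul (-N n)).sub_const 1
  set F : ℕ → (Fin 3 → ℝ) → ℝ := fun n x =>
    σ (a n (f x)) ^ 2 * T x - N n ^ 2 * Z' (a n (f x)) * g x ^ 2 + σ (a n (f x)) ^ 2 * D x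
  have hF : ∀ᶠ n in Filter.atTop, ∫ x in Ω, F n x = 0 := by
    filter_upwards [hNlim.eventually_ge_atTop (2 / m)] with n hn
    refine setIntegral_cutoff_energy_eq_zero hΩ hfin
      (S := closure Ω ∩ f ⁻¹' Set.Iic (-(1 / N n))) ?_ ?_ hv hdiv hf1 hpi hp
      (θ := fun s => σ (a n s)) (θ' := fun s => σ' (a n s) * -N n)
      (z := fun s => -N n * (2 * σ (a n s) * σ' (a n s))) (z' := fun s => N n ^ 2 * Z' (a n s))
      (fun s => (hσ _).comp s (ha n s)) (by fun_prop) (fun s => ?_) (by fun_prop)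
      (fun s => by ring) ?_ ?_
    · exact hK.inter_right (isClosed_Iic.preimage hf.continuous)
    · rintro x ⟨hx, hx'⟩
      by_contra hxΩ
      have : f x = 0 := hfr x ⟨hx, by rwa [hΩ.interior_eq]⟩
      rw [Set.mem_preimage, this, Set.mem_Iic] at hx'
      have : 0 < 1 / N n := one_div_pos.2 (hN n)
      linarith
    · have := ((hZ (a n s)).comp s (ha n s)).const_mul (-N n)
      exact this.congr_deriv (by ring)
    · intro x hx hxS
      have h1 : -(1 / N n) < f x := by
        by_contra! h
        exact hxS ⟨subset_closure hx, h⟩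
      refine hσ0 _ ?_
      have := mul_lt_mul_of_pos_left h1 (hN n)
      have h2 : N n * -(1 / N n) = -1 := by field_simp [(hN n).ne']
      simp only [a]
      linarith
    · intro x hx hz
      refine hpf x hx ?_
      have := (hZs _ (right_ne_zero_of_mul hz)).2
      simp only [a] at this
      rw [div_le_iff₀ hm] at hn
      have h3 : N n * -f x ≤ N n * m := by linarith
      exact le_of_mul_le_mul_left h3 (hN n)
  have hZbound : ∀ n, 2 / m ≤ N n → ∀ x ∈ Ω, |N n ^ 2 * Z' (a n (f x)) * g x ^ 2| ≤
      4 * C / m * (g x ^ 2 * ((-f x)⁻¹ ^ 2 * ∑ l, pderiv3 l f x ^ 2)) := by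
    intro n hn x hx
    have hfx : 0 < -f x := by linarith [hneg x hx]
    by_cases hz : Z' (a n (f x)) = 0
    · simp only [hz, mul_zero, zero_mul, abs_zero]
      positivity
    have hb := (hZs' _ hz).2
    simp only [a] at hb
    rw [div_le_iff₀ hm] at hn
    have h3 : N n * -f x ≤ N n * m := by linarith
    have hqx := hq x hx (le_of_mul_le_mul_left h3 (hN n))
    have h4 : N n ≤ 2 * (-f x)⁻¹ := by
      rw [← div_eq_mul_inv, le_div_iff₀ hfx]; linarith
    have h5 : N n ^ 2 ≤ 4 * (-f x)⁻¹ ^ 2 := by nlinarith [hN n]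
    rw [abs_mul, abs_mul, abs_of_nonneg (sq_nonneg (N n)), abs_of_nonneg (sq_nonneg (g x))]
    calc N n ^ 2 * |Z' (a n (f x))| * g x ^ 2
        ≤ 4 * (-f x)⁻¹ ^ 2 * C * g x ^ 2 := by gcongr; exact hC _
      _ = 4 * C / m * (g x ^ 2 * ((-f x)⁻¹ ^ 2 * m)) := by field_simp
      _ ≤ _ := by gcongr
  have hlim : Filter.Tendsto (fun n => ∫ x in Ω, F n x) Filter.atTop
      (nhds (∫ x in Ω, (T x + D x))) := by
    refine tendsto_integral_filter_of_dominated_convergence (fun x => |T x| +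
      4 * C / m * (g x ^ 2 * ((-f x)⁻¹ ^ 2 * ∑ l, pderiv3 l f x ^ 2)) + |D x|)
      (Filter.Eventually.of_forall fun n => ?_) ?_ ?_ ?_
    · have hσc : Continuous σ := continuous_iff_continuousAt.2 fun s => (hσ s).continuousAt
      have m1 : Continuous fun x => σ (a n (f x)) ^ 2 := by
        have := hf.continuous; fun_prop
      have m2 : Continuous fun x => N n ^ 2 * Z' (a n (f x)) := by
        have := hf.continuous; fun_prop
      exact ((m1.aestronglyMeasurable.mul hT.1).sub (m2.aestronglyMeasurable.mul
        ((hg.aestronglyMeasurable hΩ).pow 2))).add (m1.aestronglyMeasurable.mul hD.1)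
    · filter_upwards [hNlim.eventually_ge_atTop (2 / m)] with n hn
      filter_upwards [ae_restrict_mem hΩ.measurableSet] with x hx
      have h1 : |σ (a n (f x)) ^ 2| ≤ 1 := by
        rw [abs_pow]; exact pow_le_one₀ (abs_nonneg _) (hσle _)
      refine (norm_add_le _ _).trans (add_le_add ((norm_sub_le _ _).trans
        (add_le_add ?_ (hZbound n hn x hx))) ?_)
      · rw [Real.norm_eq_abs, abs_mul]
        exact mul_le_of_le_one_left (abs_nonneg _) h1
      · rw [Real.norm_eq_abs, abs_mul]
        exact mul_le_of_le_one_left (abs_nonneg _) h1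
    · exact (hT.abs.add (hhardy.const_mul _)).add hD.abs
    · filter_upwards [ae_restrict_mem hΩ.measurableSet] with x hx
      refine tendsto_const_nhds.congr' ?_
      filter_upwards [hNlim.eventually_gt_atTop (2 / -f x)] with n hn
      have hfx : 0 < -f x := by linarith [hneg x hx]
      rw [div_lt_iff₀ hfx] at hn
      have h1 : 1 < a n (f x) := by simp only [a]; linarith
      have h2 : Z' (a n (f x)) = 0 := by
        by_contra h
        exact h1.not_ge (hZs' _ h).2
      simp only [F, hσ1 _ h1.le, h2]
      ring
  exact tendsto_nhds_unique hlim (tendsto_const_nhds.congr' (hF.mono fun n hn => hn.symm))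

end Limit

lemma mul_mul_add_mul_le {a b c d r s M : ℝ} (hr : |r| ≤ M) (hs : |s| ≤ M) :
    a * b * s + r * (a * d + b * c) ≤
      M / 2 * (a ^ 2 + b ^ 2) + (d ^ 2 / 12 + 3 * M ^ 2 * a ^ 2) +
        (c ^ 2 / 12 + 3 * M ^ 2 * b ^ 2) := by
  have hM : 0 ≤ M := (abs_nonneg r).trans hr
  have hr2 : r ^ 2 ≤ M ^ 2 := sq_le_sq' (abs_le.1 hr).1 (abs_le.1 hr).2
  have h1 : a * b * s ≤ M / 2 * (a ^ 2 + b ^ 2) := by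
    obtain ⟨h, h'⟩ := abs_le.1 hs
    nlinarith [mul_nonneg (sub_nonneg.2 h') (sq_nonneg (a + b)),
      mul_nonneg (sub_nonneg.2 h) (sq_nonneg (a - b))]
  have h2 : r * (a * d) ≤ d ^ 2 / 12 + 3 * M ^ 2 * a ^ 2 := by
    nlinarith [sq_nonneg (d - 6 * r * a), mul_nonneg (sub_nonneg.2 hr2) (sq_nonneg a)]
  have h3 : r * (b * c) ≤ c ^ 2 / 12 + 3 * M ^ 2 * b ^ 2 := by
    nlinarith [sq_nonneg (c - 6 * r * b), mul_nonneg (sub_nonneg.2 hr2) (sq_nonneg b)]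
  linarith

section Bound

variable {Ω : Set (Fin 3 → ℝ)} {f : (Fin 3 → ℝ) → ℝ}

lemma exists_pos_le_sum_sq_pderiv3 (hK : IsCompact (closure Ω)) (hΩ : IsOpen Ω)
    (hf : ContDiff ℝ (⊤ : ℕ∞) f) (hneg : ∀ x ∈ Ω, f x < 0) (hfr : ∀ x ∈ frontier Ω, f x = 0)
    (hgrad : ∀ x ∈ frontier Ω, 0 < ∑ l, pderiv3 l f x ^ 2) :
    ∃ m > 0, ∀ x ∈ closure Ω, -f x ≤ m → m ≤ ∑ l, pderiv3 l f x ^ 2 := by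
  rcases (closure Ω).eq_empty_or_nonempty with h | h
  · exact ⟨1, one_pos, by simp [h]⟩
  have hqc : Continuous fun x => (∑ l, pderiv3 l f x ^ 2) - f x :=
    (continuous_finsetSum _ fun i _ => (contDiff_pderiv3 hf i).continuous.pow 2).sub hf.continuous
  obtain ⟨x₀, hx₀, hmin⟩ := hK.exists_isMinOn h hqc.continuousOn
  have hpos : 0 < (∑ l, pderiv3 l f x₀ ^ 2) - f x₀ := by
    by_cases hx : x₀ ∈ Ω
    · have : 0 ≤ ∑ l, pderiv3 l f x₀ ^ 2 := Finset.sum_nonneg fun i _ => sq_nonneg _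
      linarith [hneg x₀ hx]
    · have hx' : x₀ ∈ frontier Ω := ⟨hx₀, by rwa [hΩ.interior_eq]⟩
      rw [hfr x₀ hx', sub_zero]
      exact hgrad x₀ hx'
  refine ⟨((∑ l, pderiv3 l f x₀ ^ 2) - f x₀) / 2, by positivity, fun x hx hxm => ?_⟩
  have : (∑ l, pderiv3 l f x₀ ^ 2) - f x₀ ≤ (∑ l, pderiv3 l f x ^ 2) - f x := hmin hx
  linarith

lemma exists_contDiffAt_hessian_factor (hf : ContDiff ℝ (⊤ : ℕ∞) f) {K : Set (Fin 3 → ℝ)} {m : ℝ}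
    (hm : 0 < m) (hq : ∀ x ∈ K, -f x ≤ m → m ≤ ∑ l, pderiv3 l f x ^ 2) :
    ∃ p : Fin 3 → Fin 3 → Fin 3 → (Fin 3 → ℝ) → ℝ,
      (∀ i j l, ∀ x ∈ K, ContDiffAt ℝ 1 (p i j l) x) ∧
      ∀ x ∈ K, -f x ≤ m → ∀ i j, ∑ l, p i j l x * pderiv3 l f x =
        pderiv3 j (pderiv3 i f) x := by
  have hpc := fun i => contDiff_pderiv3 hf i
  have hq0 : ∀ x, 0 ≤ ∑ l, pderiv3 l f x ^ 2 := fun x => Finset.sum_nonneg fun i _ => sq_nonneg _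
  set k : (Fin 3 → ℝ) → ℝ := fun x => (∑ l, pderiv3 l f x ^ 2) + expNegInvGlue (-f x - m)
  have hk : ∀ x ∈ K, k x ≠ 0 := fun x hx => by
    by_cases h : -f x ≤ m
    · exact (add_pos_of_pos_of_nonneg (hm.trans_le (hq x hx h)) (expNegInvGlue.nonneg _)).ne'
    · exact (add_pos_of_nonneg_of_pos (hq0 x)
        (expNegInvGlue.pos_of_pos (by linarith [not_le.1 h]))).ne'
  have hkc : ContDiff ℝ 1 k :=
    (ContDiff.sum fun i _ => ((hpc i).of_le (by simp)).pow 2).add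
      (expNegInvGlue.contDiff.comp ((hf.of_le (by simp)).neg.sub contDiff_const))
  refine ⟨fun i j l x => pderiv3 j (pderiv3 i f) x * (k x)⁻¹ * pderiv3 l f x,
    fun i j l x hx => ?_, fun x hx hxm i j => ?_⟩
  · exact (((contDiff_pderiv3 (hpc i) j).contDiffAt.of_le (by simp)).mul
      (hkc.contDiffAt.inv (hk x hx))).mul ((hpc l).contDiffAt.of_le (by simp))
  · have : k x = ∑ l, pderiv3 l f x ^ 2 := by
      simp only [k]
      rw [expNegInvGlue.zero_of_nonpos (by linarith), add_zero]
    have hkx := hk x hx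
    calc ∑ l, pderiv3 j (pderiv3 i f) x * (k x)⁻¹ * pderiv3 l f x * pderiv3 l f x
        = pderiv3 j (pderiv3 i f) x * (k x)⁻¹ * ∑ l, pderiv3 l f x ^ 2 := by
          rw [Finset.mul_sum]
          exact Finset.sum_congr rfl fun l _ => by ring
      _ = _ := by rw [← this]; field_simp

/-- Korn's inequality for divergence-free fields tangent to the boundary, with a constant depending
only on the domain. -/
lemma exists_setIntegral_grad_sq_le (hΩ : IsOpen Ω) (hK : IsCompact (closure Ω))
    (hfin : volume Ω ≠ ⊤) (hf : ContDiff ℝ (⊤ : ℕ∞) f) (hneg : ∀ x ∈ Ω, f x < 0)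
    (hfr : ∀ x ∈ frontier Ω, f x = 0)
    (hgrad : ∀ x ∈ frontier Ω, 0 < ∑ l, pderiv3 l f x ^ 2) :
    ∃ C, 0 ≤ C ∧ ∀ v : Fin 3 → (Fin 3 → ℝ) → ℝ, (∀ i, IsBddH1 volume Ω (v i)) →
      (∀ i, ContinuousOn (v i) (closure Ω)) → (∀ x ∈ Ω, ∑ i, pderiv3 i (v i) x = 0) →
      (∀ x ∈ frontier Ω, ∑ i, v i x * pderiv3 i f x = 0) →
      ∫ x in Ω, ∑ i, ∑ j, pderiv3 j (v i) x ^ 2 ≤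
        4 * (∫ x in Ω, ∑ i, ∑ j, ((pderiv3 j (v i) x + pderiv3 i (v j) x) / 2) ^ 2) +
          C * ∫ x in Ω, ∑ i, v i x ^ 2 := by
  obtain ⟨m, hm, hq⟩ := exists_pos_le_sum_sq_pderiv3 hK hΩ hf hneg hfr hgrad
  obtain ⟨p, hpc, hpf⟩ := exists_contDiffAt_hessian_factor hf hm hq
  choose B hB0 hB using fun i j l => exists_bound_of_contDiffAt hK (hpc i j l)
  set M := ∑ i, ∑ j, ∑ l, B i j l
  have hBM : ∀ i j l, B i j l ≤ M := fun i j l =>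
    (Finset.single_le_sum (f := fun l => B i j l) (fun l _ => hB0 i j l)
      (Finset.mem_univ l)).trans <|
    (Finset.single_le_sum (f := fun j => ∑ l, B i j l)
      (fun j _ => Finset.sum_nonneg fun l _ => hB0 i j l) (Finset.mem_univ j)).trans <|
    Finset.single_le_sum (f := fun i => ∑ j, ∑ l, B i j l)
      (fun i _ => Finset.sum_nonneg fun j _ => Finset.sum_nonneg fun l _ => hB0 i j l)
      (Finset.mem_univ i)
  have hM0 : 0 ≤ M := (hB0 0 0 0).trans (hBM 0 0 0)
  have hp : ∀ i j l, IsBddH1 volume Ω (p i j l) := fun i j l =>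
    IsBddH1.of_contDiffAt hΩ hK hfin (hpc i j l)
  refine ⟨108 * M ^ 2 + 18 * M, by positivity, fun v hv hvc hdiv htan => ?_⟩
  have h0 := setIntegral_energy_eq_zero hΩ hK hfin hf hneg hfr hm
    (fun x hx => hq x (subset_closure hx)) hv hvc hdiv htan hp
    (fun x hx => hpf x (subset_closure hx))
  have hE : IntegrableOn (fun x => ∑ i, ∑ j, pderiv3 j (v i) x ^ 2) Ω :=
    integrable_finsetSum _ fun i _ => integrable_finsetSum _ fun j _ =>
      ((hv i).memLp_fderiv _).integrable_sq
  have hS : IntegrableOn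
      (fun x => ∑ i, ∑ j, ((pderiv3 j (v i) x + pderiv3 i (v j) x) / 2) ^ 2) Ω :=
    integrable_finsetSum _ fun i _ => integrable_finsetSum _ fun j _ => by
      have := (((hv i).memLp_fderiv (Pi.single j 1)).add
        ((hv j).memLp_fderiv (Pi.single i 1))).integrable_sq.div_const 4
      refine this.congr (Filter.Eventually.of_forall fun x => ?_)
      simp only [Pi.add_apply]
      ring
  have hV : IntegrableOn (fun x => ∑ i, v i x ^ 2) Ω :=
    integrable_finsetSum _ fun i _ => ((hv i).memLp hΩ hfin 2).integrable_sq
  have hTD : IntegrableOn (fun x => (∑ i, ∑ j, pderiv3 i (v j) x * pderiv3 j (v i) x) +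
      ∑ i, ∑ j, ∑ l, pderiv3 l (fun y => v i y * v j y * p i j l y) x) Ω :=
    (integrable_finsetSum _ fun i _ => integrable_finsetSum _ fun j _ =>
      (hv j).integrableOn_pderiv3_mul (hv i) i j).add
    (integrable_finsetSum _ fun i _ => integrable_finsetSum _ fun j _ =>
      integrable_finsetSum _ fun l _ =>
        (((hv i).mul (hv j) hΩ).mul (hp i j l) hΩ).integrableOn_fderiv hfin _)
  have hpt : ∀ x ∈ Ω, ∑ i, ∑ j, pderiv3 j (v i) x ^ 2 ≤
      4 * (∑ i, ∑ j, ((pderiv3 j (v i) x + pderiv3 i (v j) x) / 2) ^ 2) +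
        (108 * M ^ 2 + 18 * M) * (∑ i, v i x ^ 2) -
      2 * ((∑ i, ∑ j, pderiv3 i (v j) x * pderiv3 j (v i) x) +
        ∑ i, ∑ j, ∑ l, pderiv3 l (fun y => v i y * v j y * p i j l y) x) := by
    intro x hx
    have hxc := subset_closure hx
    have hterm : ∀ i j l, pderiv3 l (fun y => v i y * v j y * p i j l y) x ≤
        M / 2 * (v i x ^ 2 + v j x ^ 2) + (pderiv3 l (v j) x ^ 2 / 12 + 3 * M ^ 2 * v i x ^ 2) +
          (pderiv3 l (v i) x ^ 2 / 12 + 3 * M ^ 2 * v j x ^ 2) := by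
      intro i j l
      have dv := fun i => (hv i).differentiableAt x hx
      rw [pderiv3_mul ((dv i).fun_mul (dv j)) ((hp i j l).differentiableAt x hx),
        pderiv3_mul (dv i) (dv j)]
      refine mul_mul_add_mul_le (((hB i j l x hxc).1).trans (hBM i j l)) ?_
      have := (hB i j l x hxc).2 (Pi.single l 1)
      rw [Pi.norm_single, norm_one, mul_one] at this
      exact this.trans (hBM i j l)
    have hsum := Finset.sum_le_sum fun i (_ : i ∈ Finset.univ) =>
      Finset.sum_le_sum fun j (_ : j ∈ Finset.univ) =>
      Finset.sum_le_sum fun l (_ : l ∈ Finset.univ) => hterm i j l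
    generalize (∑ i, ∑ j, ∑ l, pderiv3 l (fun y => v i y * v j y * p i j l y) x) = D at *
    simp only [Fin.sum_univ_three] at *
    linarith
  have hSV := (hS.const_mul 4).add (hV.const_mul (108 * M ^ 2 + 18 * M))
  refine (setIntegral_mono_on hE (hSV.sub (hTD.const_mul 2)) hΩ.measurableSet hpt).trans_eq ?_
  refine (integral_sub hSV (hTD.const_mul 2)).trans ?_
  rw [integral_const_mul, h0, mul_zero, sub_zero]
  refine (integral_add (hS.const_mul 4) (hV.const_mul _)).trans ?_
  rw [integral_const_mul, integral_const_mul]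

end Bound

section Curvature

variable {f : (Fin 3 → ℝ) → ℝ} {x : Fin 3 → ℝ}

lemma sum_sq_grad13_pos (hx : grad13 f x ≠ 0) : 0 < ∑ i, grad13 f x i ^ 2 := by
  obtain ⟨i, hi⟩ := Function.ne_iff.1 hx
  exact Finset.sum_pos' (fun i _ => sq_nonneg _) ⟨i, Finset.mem_univ i, sq_pos_of_ne_zero hi⟩

lemma contDiffAt_unitNormal13 (hf : ContDiff ℝ (⊤ : ℕ∞) f) (hx : grad13 f x ≠ 0) :
    ContDiffAt ℝ 1 (unitNormal13 f) x := by
  have hg : ∀ i, ContDiff ℝ 1 (fun y => grad13 f y i) := fun i =>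
    (contDiff_pderiv3 hf i).of_le (by simp)
  have hs := sum_sq_grad13_pos hx
  have hq : ContDiffAt ℝ 1 (fun y => ∑ i, grad13 f y i ^ 2) x :=
    (ContDiff.sum fun i _ => (hg i).pow 2).contDiffAt
  exact ((hq.sqrt hs.ne').inv (Real.sqrt_pos.2 hs).ne').smul (contDiff_pi.2 hg).contDiffAt

lemma sum_sq_unitNormal13 (hx : grad13 f x ≠ 0) : ∑ i, unitNormal13 f x i ^ 2 = 1 := by
  have hs := sum_sq_grad13_pos hx
  simp only [unitNormal13, Pi.smul_apply, smul_eq_mul, mul_pow, ← Finset.mul_sum, inv_pow,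
    Real.sq_sqrt hs.le]
  exact inv_mul_cancel₀ hs.ne'

lemma fderiv_eq_sqrt_mul_unitNormal13 (hx : grad13 f x ≠ 0) (t : Fin 3 → ℝ) :
    fderiv ℝ f x t = Real.sqrt (∑ i, grad13 f x i ^ 2) * ∑ i, t i * unitNormal13 f x i := by
  have hs := Real.sqrt_pos.2 (sum_sq_grad13_pos hx)
  have h1 : fderiv ℝ f x t = ∑ i, t i * grad13 f x i := by
    conv_lhs => rw [pi_eq_sum_univ' t]
    simp [grad13]
  rw [h1, Finset.mul_sum]
  refine Finset.sum_congr rfl fun i _ => ?_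
  simp only [unitNormal13, Pi.smul_apply, smul_eq_mul]
  field_simp

/-- A compact level surface is not everywhere flat. -/
lemma exists_fderiv_unitNormal13_ne_zero (hf : ContDiff ℝ (⊤ : ℕ∞) f)
    (hc : IsCompact (f ⁻¹' {0})) (hne : (f ⁻¹' {0}).Nonempty)
    (hgrad : ∀ x ∈ f ⁻¹' {0}, grad13 f x ≠ 0) :
    ∃ x ∈ f ⁻¹' {0}, ∃ v, fderiv ℝ (unitNormal13 f) x v ≠ 0 := by
  by_contra! hflat
  have hN := fun x hx => contDiffAt_unitNormal13 hf (hgrad x hx)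
  have hNi : ∀ x ∈ f ⁻¹' {0}, ∀ i, ContDiffAt ℝ 1 (fun y => unitNormal13 f y i) x :=
    fun x hx i => contDiffAt_pi.1 (hN x hx) i
  have key : ∀ p : Fin 3 → ℝ, ∀ x ∈ f ⁻¹' {0},
      ∑ i, (x i - p i) ^ 2 - (∑ i, (x i - p i) * unitNormal13 f x i) ^ 2 ≤ 0 := by
    intro p
    set G : (Fin 3 → ℝ) → ℝ := fun x =>
      ∑ i, (x i - p i) ^ 2 - (∑ i, (x i - p i) * unitNormal13 f x i) ^ 2 with hG
    have hGc : ∀ x ∈ f ⁻¹' {0}, ContDiffAt ℝ 1 G x := fun x hx => by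
      have h := hNi x hx
      have h2 : ∀ i, ContDiffAt ℝ 1 (fun y : Fin 3 → ℝ => y i - p i) x := fun i =>
        (contDiff_apply ℝ ℝ i).contDiffAt.sub contDiffAt_const
      exact (ContDiffAt.sum fun i _ => (h2 i).pow 2).sub
        ((ContDiffAt.sum fun i _ => (h2 i).mul (h i)).pow 2)
    obtain ⟨y, hy, hmax⟩ := hc.exists_isMaxOn hne
      fun x hx => (hGc x hx).continuousAt.continuousWithinAt
    have hy0 : f y = 0 := hy
    suffices G y = 0 from fun x hx => (hmax hx).trans this.le
    have hlevel : f ⁻¹' {0} = {x | f x = f y} := by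
      ext x; simp [hy0]
    have hloc : IsLocalExtrOn G {x | f x = f y} y := by
      rw [← hlevel]
      exact Or.inr hmax.localize
    obtain ⟨a, b, hab, hlin⟩ := hloc.exists_multipliers_of_hasStrictFDerivAt_1d
      (hf.contDiffAt.hasStrictFDerivAt (by simp)) ((hGc y hy).hasStrictFDerivAt one_ne_zero)
    have hN0 : ∀ i, HasFDerivAt (fun x => unitNormal13 f x i) (0 : (Fin 3 → ℝ) →L[ℝ] ℝ) y := by
      have h1 := ((hN y hy).differentiableAt one_ne_zero).hasFDerivAt
      rw [show fderiv ℝ (unitNormal13 f) y = 0 from ContinuousLinearMap.ext (hflat y hy)] at h1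
      intro i
      simpa using hasFDerivAt_pi'.1 h1 i
    have hunit := sum_sq_unitNormal13 (hgrad y hy)
    set n := unitNormal13 f y with hn
    set w : Fin 3 → ℝ := fun i => y i - p i with hw
    set s := ∑ i, w i * n i with hs
    have hGf : ∀ t, fderiv ℝ G y t = 2 * ∑ i, w i * t i - 2 * s * ∑ i, t i * n i := by
      intro t
      have hwi : ∀ i, HasFDerivAt (fun x : Fin 3 → ℝ => x i - p i)
          (ContinuousLinearMap.proj (R := ℝ) (φ := fun _ : Fin 3 => ℝ) i) y := fun i =>
        (hasFDerivAt_apply i y).sub_const (p i)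
      have h1 := (HasFDerivAt.fun_sum (u := Finset.univ) fun i _ => (hwi i).pow 2).sub
        ((HasFDerivAt.fun_sum (u := Finset.univ) fun i _ => (hwi i).mul (hN0 i)).pow 2)
      have h2 : HasFDerivAt G _ y := h1
      rw [h2.fderiv]
      simp [Fin.sum_univ_three, hs, hw, hn]
      ring
    set t : Fin 3 → ℝ := fun i => w i - s * n i with ht
    have htn : ∑ i, t i * n i = 0 := by
      simp only [ht, Fin.sum_univ_three] at hs hunit ⊢
      linear_combination -hs - s * hunit
    have hft : fderiv ℝ f y t = 0 := by
      rw [fderiv_eq_sqrt_mul_unitNormal13 (hgrad y hy), htn, mul_zero]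
    have hb : b ≠ 0 := by
      rintro rfl
      have ha : a ≠ 0 := fun ha => hab (by simp [ha])
      rw [zero_smul, add_zero, smul_eq_zero_iff_right ha] at hlin
      exact hgrad y hy (by funext i; simp [grad13, hlin])
    have hGt : fderiv ℝ G y t = 0 := by
      have := DFunLike.congr_fun hlin t
      simpa [hft, hb] using this
    rw [hGf, htn] at hGt
    have : G y = ∑ i, w i * t i := by
      simp only [hG, ht, Fin.sum_univ_three] at hs ⊢
      rw [← hn, ← hs]
      simp only [hw] at hs ⊢
      linear_combination -s * hs
    rw [this]
    linarith
  obtain ⟨x, hx⟩ := hne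
  have h1 : ∀ i, 1 ≤ unitNormal13 f x i ^ 2 := fun i => by
    have := key (x - Pi.single i 1) x hx
    simp only [Pi.sub_apply, sub_sub_cancel] at this
    simp only [Pi.single_apply, ite_pow, one_pow, ite_mul, one_mul, zero_mul, Finset.sum_ite_eq',
      Finset.mem_univ, if_true, ne_eq, OfNat.ofNat_ne_zero, not_false_eq_true, zero_pow] at this
    linarith
  have h2 := sum_sq_unitNormal13 (hgrad x hx)
  rw [Fin.sum_univ_three] at h2
  linarith [h1 0, h1 1, h1 2]

lemma exists_pos_le_of_fderiv_unitNormal13_le (hf : ContDiff ℝ (⊤ : ℕ∞) f)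
    (hc : IsCompact (f ⁻¹' {0})) (hne : (f ⁻¹' {0}).Nonempty)
    (hgrad : ∀ x ∈ f ⁻¹' {0}, grad13 f x ≠ 0) :
    ∃ lam₀ > 0, ∀ lam : ℝ, (∀ x ∈ f ⁻¹' {0}, ∀ v : Fin 3 → ℝ,
        Real.sqrt (∑ i, (fderiv ℝ (unitNormal13 f) x v i) ^ 2) ≤
          lam * Real.sqrt (∑ i, (v i) ^ 2)) → lam₀ ≤ lam := by
  obtain ⟨x, hx, v, hv⟩ := exists_fderiv_unitNormal13_ne_zero hf hc hne hgrad
  have hpos : ∀ w : Fin 3 → ℝ, w ≠ 0 → 0 < Real.sqrt (∑ i, w i ^ 2) := fun w hw => by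
    obtain ⟨i, hi⟩ := Function.ne_iff.1 hw
    refine Real.sqrt_pos.2 (Finset.sum_pos' (fun i _ => sq_nonneg _) ⟨i, Finset.mem_univ i, ?_⟩)
    have : w i ≠ 0 := hi
    positivity
  have hv0 : v ≠ 0 := by
    rintro rfl
    exact hv (map_zero _)
  exact ⟨_, div_pos (hpos _ hv) (hpos v hv0), fun lam h =>
    (div_le_iff₀ (hpos v hv0)).2 (h x hx v)⟩

end Curvature

section Field

variable {Ω : Set (Fin 3 → ℝ)} {u : (Fin 3 → ℝ) → (Fin 3 → ℝ)}

lemma pderiv3_apply_eq_jac13 {x : Fin 3 → ℝ} (hu : DifferentiableAt ℝ u x) (i j : Fin 3) :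
    pderiv3 j (fun y => u y i) x = jac13 u x i j := by
  have := (hasFDerivAt_pi'.1 hu.hasFDerivAt i).fderiv
  simp [pderiv3, this, jac13]

lemma memH13.isBddH1 {f : (Fin 3 → ℝ) → ℝ} (hu : memH13 Ω f u) (hΩ : IsOpen Ω)
    (hK : IsCompact (closure Ω)) (i : Fin 3) : IsBddH1 volume Ω (fun x => u x i) := by
  obtain ⟨hc, hd, -, -, -, hJ⟩ := hu
  have hdi : ∀ x ∈ Ω, DifferentiableAt ℝ (fun y => u y i) x := fun x hx =>
    differentiableAt_pi.1 (hd x hx) i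
  refine ⟨hdi, ?_, fun v => ?_⟩
  · obtain ⟨M, hM⟩ := hK.exists_bound_of_continuousOn hc
    exact ⟨M, fun x hx => (norm_le_pi_norm (u x) i).trans (hM x (subset_closure hx))⟩
  have hj : ∀ j, MemLp (pderiv3 j (fun y => u y i)) 2 (volume.restrict Ω) := fun j => by
    have hm := (measurable_fderiv_apply_const ℝ (fun y => u y i)
      (Pi.single j 1)).aestronglyMeasurable (μ := volume.restrict Ω)
    refine (memLp_two_iff_integrable_sq hm).2 (hJ.mono' (hm.pow 2) ?_)
    filter_upwards [ae_restrict_mem hΩ.measurableSet] with x hx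
    rw [Real.norm_eq_abs, abs_of_nonneg (sq_nonneg _)]
    have h1 : fderiv ℝ (fun y => u y i) x (Pi.single j 1) = jac13 u x i j :=
      pderiv3_apply_eq_jac13 (hd x hx) i j
    rw [h1, frobSq13]
    exact (Finset.single_le_sum (f := fun j => jac13 u x i j ^ 2) (fun j _ => sq_nonneg _)
      (Finset.mem_univ j)).trans (Finset.single_le_sum (f := fun i => ∑ j, jac13 u x i j ^ 2)
      (fun i _ => Finset.sum_nonneg fun j _ => sq_nonneg _) (Finset.mem_univ i))
  refine (memLp_finsetSum Finset.univ fun j _ => (hj j).const_mul (v j)).ae_eq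
    (Filter.Eventually.of_forall fun x => ?_)
  conv_rhs => rw [pi_eq_sum_univ' v]
  simp [pderiv3]

end Field

/-- Step 1 of Proposition 5.1: on a bounded smooth domain `Ω ⊆ ℝ³`, if the
principal curvatures of `∂Ω` (i.e. the differential of the Gauss map,
here the derivative of the unit normal extension `N = ∇f/|∇f|`) are bounded
by `lam`, then, given the trace inequality
`‖u‖²_{L²(∂Ω)} ≤ Ctr ‖u‖_{L²(Ω)} ‖u‖_{H¹(Ω)}`, there is `K > 0` with
`‖Du‖_{L²} ≤ 2 ‖Su‖_{L²} + K lam ‖u‖_{L²}` for all `u ∈ H¹_{σ,tan}(Ω)`. -/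
theorem grad_le_symGrad_add_curvature
    (f : (Fin 3 → ℝ) → ℝ) (hf : ContDiff ℝ (⊤ : ℕ∞) f)
    (Ω : Set (Fin 3 → ℝ))
    (hΩ : Ω = f ⁻¹' Set.Iio (0 : ℝ))
    (hbdd : Bornology.IsBounded Ω) (hconn : IsConnected Ω)
    (hfront : frontier Ω = f ⁻¹' {(0 : ℝ)})
    (hgrad : ∀ x ∈ frontier Ω, grad13 f x ≠ 0)
    (Ctr : ℝ) (hCtr : 0 < Ctr)
    (htrace : ∀ u, memH13 Ω f u →
      (∫ x in frontier Ω, (∑ i, (u x i) ^ 2) ∂μH[2]) ≤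
        Ctr * Real.sqrt (∫ x in Ω, ∑ i, (u x i) ^ 2) *
          Real.sqrt ((∫ x in Ω, ∑ i, (u x i) ^ 2) +
            ∫ x in Ω, frobSq13 (jac13 u x))) :
    ∃ K > 0, ∀ lam : ℝ, 0 ≤ lam →
      (∀ x ∈ frontier Ω, ∀ v : Fin 3 → ℝ,
        Real.sqrt (∑ i, (fderiv ℝ (unitNormal13 f) x v i) ^ 2) ≤
          lam * Real.sqrt (∑ i, (v i) ^ 2)) →
      ∀ u, memH13 Ω f u →
        Real.sqrt (∫ x in Ω, frobSq13 (jac13 u x)) ≤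
          2 * Real.sqrt (∫ x in Ω, frobSq13 (symJac13 u x)) +
            K * lam * Real.sqrt (∫ x in Ω, ∑ i, (u x i) ^ 2) := by
  have hopen : IsOpen Ω := hΩ ▸ isOpen_Iio.preimage hf.continuous
  have hK : IsCompact (closure Ω) := hbdd.isCompact_closure
  have hfin : volume Ω ≠ ⊤ := hbdd.measure_lt_top.ne
  have hneg : ∀ x ∈ Ω, f x < 0 := fun x hx => by rwa [hΩ] at hx
  have hfr : ∀ x ∈ frontier Ω, f x = 0 := fun x hx => by rwa [hfront] at hx
  have hfc : IsCompact (f ⁻¹' {0}) :=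
    hfront ▸ hK.of_isClosed_subset isClosed_frontier frontier_subset_closure
  have hfne : (f ⁻¹' {0}).Nonempty := by
    rw [← hfront, nonempty_frontier_iff]
    refine ⟨hconn.nonempty, fun h => ?_⟩
    exact NormedSpace.unbounded_univ ℝ (Fin 3 → ℝ) (h ▸ hbdd)
  obtain ⟨lam₀, hlam₀, hcurv⟩ := exists_pos_le_of_fderiv_unitNormal13_le hf hfc hfne
    (hfront ▸ hgrad)
  obtain ⟨C, hC0, hC⟩ := exists_setIntegral_grad_sq_le hopen hK hfin hf hneg hfr
    fun x hx => sum_sq_grad13_pos (hgrad x hx)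
  refine ⟨Real.sqrt C / lam₀ + 1, by positivity, fun lam hlam hle u hu => ?_⟩
  have hlam' := hcurv lam (hfront ▸ hle)
  have hcomp := fun x hx i j => pderiv3_apply_eq_jac13 (hu.2.1 x hx) i j
  have hmain := hC (fun i x => u x i) (hu.isBddH1 hopen hK)
    (fun i => (continuous_apply i).comp_continuousOn hu.1)
    (fun x hx => by simp only [hcomp x hx]; exact hu.2.2.1 x hx)
    (fun x hx => hu.2.2.2.1 x hx)
  have e1 : ∫ x in Ω, ∑ i, ∑ j, pderiv3 j (fun y => u y i) x ^ 2 =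
      ∫ x in Ω, frobSq13 (jac13 u x) :=
    setIntegral_congr_fun hopen.measurableSet fun x hx => by
      simp only [hcomp x hx, frobSq13]
  have e2 : ∫ x in Ω, ∑ i, ∑ j,
      ((pderiv3 j (fun y => u y i) x + pderiv3 i (fun y => u y j) x) / 2) ^ 2 =
      ∫ x in Ω, frobSq13 (symJac13 u x) :=
    setIntegral_congr_fun hopen.measurableSet fun x hx => by
      simp only [hcomp x hx, frobSq13, symJac13]
  rw [e1, e2] at hmain
  set J := ∫ x in Ω, frobSq13 (jac13 u x)
  have hS0 : 0 ≤ ∫ x in Ω, frobSq13 (symJac13 u x) :=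
    integral_nonneg fun x => Finset.sum_nonneg fun i _ => Finset.sum_nonneg fun j _ => sq_nonneg _
  have hU0 : 0 ≤ ∫ x in Ω, ∑ i, u x i ^ 2 :=
    integral_nonneg fun x => Finset.sum_nonneg fun i _ => sq_nonneg _
  set S := ∫ x in Ω, frobSq13 (symJac13 u x)
  set U := ∫ x in Ω, ∑ i, u x i ^ 2
  have h1 : Real.sqrt J ≤ 2 * Real.sqrt S + Real.sqrt C * Real.sqrt U := by
    refine Real.sqrt_le_iff.2 ⟨by positivity, hmain.trans ?_⟩
    have hS := Real.sq_sqrt hS0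
    have hU := Real.sq_sqrt hU0
    have hCs := Real.sq_sqrt hC0
    have : 0 ≤ Real.sqrt S * (Real.sqrt C * Real.sqrt U) := by positivity
    calc 4 * S + C * U = 4 * Real.sqrt S ^ 2 + Real.sqrt C ^ 2 * Real.sqrt U ^ 2 := by
          rw [hS, hU, hCs]
      _ ≤ _ := by nlinarith
  have h2 : Real.sqrt C ≤ (Real.sqrt C / lam₀ + 1) * lam := by
    have h3 : Real.sqrt C / lam₀ * lam₀ ≤ Real.sqrt C / lam₀ * lam := by gcongr
    rw [div_mul_cancel₀ _ hlam₀.ne'] at h3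
    linarith
  exact h1.trans (by gcongr)
end
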